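/- arXiv:1609.04473 — 2 statements merged into one kernel-verified Lean document; each statement's English description precedes it below -/
import Mathlib

section
/- (Existence of renormalization fixed points) For every positive rational number β there exists N < ∞ such that for all positive integers a, b with b ≥ N and a/b = β, the renormalization operator R has an (a,b)-renormalizable fixed point: there exists a Lorenz map f* that is (a,b)-renormalizable and satisfies R f* = f*. -/
open Set Filter Topology MeasureTheory Function

noncomputable section

/-- The nonlinearity `Nφ = D log Dφ = φ''/φ'`. -/
def nonlinearity (φ : ℝ → ℝ) : ℝ → ℝ := fun x => deriv (deriv φ) x / deriv φ x

/-- The Schwarzian derivative `Sφ = D(Nφ) - (Nφ)²/2`. -/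
def schwarzian (φ : ℝ → ℝ) : ℝ → ℝ := fun x =>
  deriv (nonlinearity φ) x - (nonlinearity φ x) ^ 2 / 2

/-- `φ` is an orientation-preserving C³ diffeomorphism of `[0,1]` with
nonpositive Schwarzian derivative. -/
structure IsSDiffeo (φ : ℝ → ℝ) : Prop where
  contDiff : ContDiffOn ℝ 3 φ (Icc 0 1)
  fix0 : φ 0 = 0
  fix1 : φ 1 = 1
  derivPos : ∀ x ∈ Icc (0:ℝ) 1, 0 < deriv φ x
  schwNonpos : ∀ x ∈ Icc (0:ℝ) 1, schwarzian φ x ≤ 0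

/-- The nonlinearity norm `‖φ‖ = sup |Nφ|` over `[0,1]`. -/
def diffeoNorm (φ : ℝ → ℝ) : ℝ := sSup ((fun x => |nonlinearity φ x|) '' Icc 0 1)

/-- Left branch of the standard family: `q₋(x) = u (1 - |(c-x)/c|^α)`. -/
def qminus (α u c : ℝ) : ℝ → ℝ := fun x => u * (1 - |(c - x) / c| ^ α)

/-- Right branch of the standard family: `q₊(x) = 1 + v (-1 + |(x-c)/(1-c)|^α)`. -/
def qplus (α v c : ℝ) : ℝ → ℝ := fun x => 1 + v * (-1 + |(x - c) / (1 - c)| ^ α)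

/-- A Lorenz map with critical exponent `α`: a tuple `(u,v,c,φ,ψ)` with
branches `f₋ = φ ∘ q₋` on `[0,c)` and `f₊ = ψ ∘ q₊` on `(c,1]`, such that
`x < f₋(x)` on `(0,c]` and `f₊(x) < x` on `[c,1)`. -/
structure LorenzMap (α : ℝ) where
  u : ℝ
  v : ℝ
  c : ℝ
  φ : ℝ → ℝ
  ψ : ℝ → ℝ
  hu : u ∈ Icc (0:ℝ) 1
  hv : v ∈ Icc (0:ℝ) 1
  hc : c ∈ Ioo (0:ℝ) 1
  hφ : IsSDiffeo φ
  hψ : IsSDiffeo ψ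
  hleft : ∀ x ∈ Ioc (0:ℝ) c, x < φ (qminus α u c x)
  hright : ∀ x ∈ Ico c (1:ℝ), ψ (qplus α v c x) < x

namespace LorenzMap

variable {α : ℝ}

/-- The left branch `f₋ = φ ∘ q₋`. -/
def fm (f : LorenzMap α) : ℝ → ℝ := fun x => f.φ (qminus α f.u f.c x)

/-- The right branch `f₊ = ψ ∘ q₊`. -/
def fp (f : LorenzMap α) : ℝ → ℝ := fun x => f.ψ (qplus α f.v f.c x)

/-- The Lorenz map as a function (its value at the critical point itself is
irrelevant; we use the right branch there). -/
def toFun (f : LorenzMap α) : ℝ → ℝ := fun x => if x < f.c then f.fm x else f.fp x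

/-- `f ∈ L_δ`: both diffeomorphic parts have nonlinearity norm `< δ`. -/
def memL (f : LorenzMap α) (δ : ℝ) : Prop := diffeoNorm f.φ < δ ∧ diffeoNorm f.ψ < δ

/-- The preimage `f₋⁻¹(y)` of a point under the left branch, taken in `[0, c]`. -/
def fmInv (f : LorenzMap α) : ℝ → ℝ := fun y => invFunOn f.fm (Icc 0 f.c) y

/-- The preimage `f₊⁻¹(y)` of a point under the right branch, taken in `[c, 1]`. -/
def fpInv (f : LorenzMap α) : ℝ → ℝ := fun y => invFunOn f.fp (Icc f.c 1) y

end LorenzMap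

/-- First return time of `x` to `C` under `F`. -/
def firstReturn (F : ℝ → ℝ) (C : Set ℝ) (x : ℝ) : ℕ := sInf {k : ℕ | 0 < k ∧ F^[k] x ∈ C}

/-- `[l,r] ⊊ [0,1]` is a renormalization interval for `f`, whose first-return map
is affinely conjugate to the Lorenz map `g`. -/
def IsRenormPair {α : ℝ} (f g : LorenzMap α) (l r : ℝ) : Prop :=
  0 ≤ l ∧ l < f.c ∧ f.c < r ∧ r ≤ 1 ∧ (0 < l ∨ r < 1) ∧
  g.c = (f.c - l) / (r - l) ∧
  ∀ x ∈ Icc l r, x ≠ f.c →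
    (∃ k, 0 < k ∧ f.toFun^[k] x ∈ Icc l r) ∧
    f.toFun^[firstReturn f.toFun (Icc l r) x] x = l + (r - l) * g.toFun ((x - l) / (r - l))

/-- `f` is renormalizable. -/
def Renormalizable {α : ℝ} (f : LorenzMap α) : Prop := ∃ g l r, IsRenormPair f g l r

/-- `[l,r]` is the return interval of `f`: the largest renormalization interval. -/
def IsReturnInterval {α : ℝ} (f : LorenzMap α) (l r : ℝ) : Prop :=
  (∃ g, IsRenormPair f g l r) ∧
  ∀ g' l' r', IsRenormPair f g' l' r' → Icc l' r' ⊆ Icc l r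

/-- `g = R f` is the renormalization of `f` (rescaled first-return map to the
return interval). -/
def IsRenormalizationOf {α : ℝ} (f g : LorenzMap α) : Prop :=
  ∃ l r, IsReturnInterval f l r ∧ IsRenormPair f g l r

/-- The `(a,b)` combinatorics of renormalization on the interval `[l,r]`, where
`C₋ = [l,c)` and `C₊ = (c,r]`:
`f(C₋) > f²(C₋) > ⋯ > f^a(C₋) > c`, `C₋ ⊂ f^(a+1)(C₋) ⊂ C`, and
`f(C₊) < f²(C₊) < ⋯ < f^b(C₊) < c`, `C₊ ⊂ f^(b+1)(C₊) ⊂ C`. -/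
def ABCombinatorics {α : ℝ} (f : LorenzMap α) (l r : ℝ) (a b : ℕ) : Prop :=
  0 < a ∧ 0 < b ∧
  (∀ i, 1 ≤ i → i ≤ a → ∀ x ∈ Ico l f.c, f.c < f.toFun^[i] x) ∧
  (∀ i, 1 ≤ i → i + 1 ≤ a → ∀ x ∈ Ico l f.c, ∀ y ∈ Ico l f.c,
    f.toFun^[i+1] x < f.toFun^[i] y) ∧
  Ico l f.c ⊆ f.toFun^[a+1] '' Ico l f.c ∧ f.toFun^[a+1] '' Ico l f.c ⊆ Icc l r ∧
  (∀ i, 1 ≤ i → i ≤ b → ∀ x ∈ Ioc f.c r, f.toFun^[i] x < f.c) ∧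
  (∀ i, 1 ≤ i → i + 1 ≤ b → ∀ x ∈ Ioc f.c r, ∀ y ∈ Ioc f.c r,
    f.toFun^[i] x < f.toFun^[i+1] y) ∧
  Ioc f.c r ⊆ f.toFun^[b+1] '' Ioc f.c r ∧ f.toFun^[b+1] '' Ioc f.c r ⊆ Icc l r

/-- `f` is `(a,b)`-renormalizable with return interval `[l,r]`. -/
def ABRenormWith {α : ℝ} (f : LorenzMap α) (a b : ℕ) (l r : ℝ) : Prop :=
  IsReturnInterval f l r ∧ ABCombinatorics f l r a b

/-- `f` is `(a,b)`-renormalizable. -/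
def ABRenormalizable {α : ℝ} (f : LorenzMap α) (a b : ℕ) : Prop :=
  ∃ l r, ABRenormWith f a b l r

/-- A sequence of successive renormalizations: `F (k+1) = R (F k)`. -/
def RenormSeq {α : ℝ} (F : ℕ → LorenzMap α) : Prop :=
  ∀ k, IsRenormalizationOf (F k) (F (k + 1))

/-! ### Part 1: an abstract fixed point lemma for holomorphic self-maps -/

theorem fp_lipschitz {ι : Type*} (V : Set (ι → ℂ)) (T : (ι → ℂ) → ι → ℂ)
    (hVlin : ∀ X ∈ V, ∀ Y ∈ V, ∀ t : ℂ, X + t • Y ∈ V)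
    (hTb : ∀ X ∈ V, (∀ i, ‖X i‖ ≤ 1) → ∀ i, ‖T X i‖ ≤ 1 / 8)
    (hTd : ∀ X ∈ V, ∀ Y ∈ V, ∀ t : ℂ, (∀ i, ‖(X + t • Y) i‖ ≤ 1) → ∀ i,
      DifferentiableAt ℂ (fun t : ℂ => T (X + t • Y) i) t)
    (hV0 : (0 : ι → ℂ) ∈ V)
    (X : ι → ℂ) (hX : X ∈ V) (X' : ι → ℂ) (hX' : X' ∈ V) (hX1 : ∀ i, ‖X i‖ ≤ 1 / 8)
    (d : ℝ) (hd0 : 0 < d) (hd : d ≤ 1 / 4)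
    (h : ∀ i, ‖X' i - X i‖ ≤ d) (i : ι) : ‖T X' i - T X i‖ ≤ d / 2 := by
  set Y : ι → ℂ := (1 / (2 * d) : ℂ) • (X' - X) with hY
  have hYV : Y ∈ V := by
    have h1 : X' - X ∈ V := by
      have := hVlin X' hX' X hX (-1)
      simpa [sub_eq_add_neg] using this
    have := hVlin 0 hV0 _ h1 (1 / (2 * d) : ℂ)
    simpa [hY] using this
  have hYb : ∀ i, ‖Y i‖ ≤ 1 / 2 := by
    intro i
    have : ‖Y i‖ = 1 / (2 * d) * ‖X' i - X i‖ := by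
      simp [hY, abs_of_pos hd0]
    rw [this]
    calc 1 / (2 * d) * ‖X' i - X i‖ ≤ 1 / (2 * d) * d := by
          gcongr; exact h i
      _ = 1 / 2 := by field_simp
  have hb : ∀ t : ℂ, ‖t‖ < 1 → ∀ i, ‖(X + t • Y) i‖ ≤ 1 := by
    intro t ht i
    have h1 : ‖(X + t • Y) i‖ ≤ ‖X i‖ + ‖t‖ * ‖Y i‖ := by
      simp only [Pi.add_apply, Pi.smul_apply, smul_eq_mul]
      exact (norm_add_le _ _).trans (by rw [norm_mul])
    have h2 : ‖t‖ * ‖Y i‖ ≤ 1 * (1 / 2) := by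
      apply mul_le_mul ht.le (hYb i) (norm_nonneg _) zero_le_one
    linarith [hX1 i]
  have hdiff : DifferentiableOn ℂ (fun t : ℂ => T (X + t • Y) i) (Metric.ball 0 1) := by
    intro t ht
    have ht' : ‖t‖ < 1 := by simpa using ht
    exact (hTd X hX Y hYV t (hb t ht') i).differentiableWithinAt
  have hmaps : MapsTo (fun t : ℂ => T (X + t • Y) i) (Metric.ball 0 1)
      (Metric.closedBall ((fun t : ℂ => T (X + t • Y) i) 0) (1 / 4)) := by
    intro t ht
    have ht' : ‖t‖ < 1 := by simpa using ht
    rw [Metric.mem_closedBall, dist_eq_norm]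
    have h1 := hTb _ (hVlin X hX Y hYV t) (hb t ht') i
    have h2 := hTb _ (hVlin X hX Y hYV 0) (hb 0 (by simp)) i
    show ‖T (X + t • Y) i - T (X + (0 : ℂ) • Y) i‖ ≤ 1 / 4
    calc _ ≤ _ := norm_sub_le _ _
      _ ≤ 1 / 8 + 1 / 8 := add_le_add h1 h2
      _ = 1 / 4 := by norm_num
  have hz : ((2 * d : ℝ) : ℂ) ∈ Metric.ball (0 : ℂ) 1 := by
    rw [Metric.mem_ball, dist_zero_right, Complex.norm_real, Real.norm_eq_abs,
      abs_of_pos (by positivity)]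
    linarith
  have key := Complex.dist_le_div_mul_dist_of_mapsTo_ball hdiff hmaps hz
  have e1 : X + ((2 * d : ℝ) : ℂ) • Y = X' := by
    funext j
    have : (d : ℂ) ≠ 0 := by exact_mod_cast hd0.ne'
    simp only [hY, Pi.add_apply, Pi.smul_apply, Pi.sub_apply, smul_eq_mul]
    push_cast
    field_simp
    ring
  have e2 : X + (0 : ℂ) • Y = X := by simp
  simp only [e1, e2] at key
  rw [dist_eq_norm, dist_zero_right, Complex.norm_real, Real.norm_eq_abs,
    abs_of_pos (by positivity)] at key
  linarith

theorem fp_exists {ι : Type*} (V R : Set (ι → ℂ)) (T : (ι → ℂ) → ι → ℂ)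
    (hV0 : (0 : ι → ℂ) ∈ V) (hR0 : (0 : ι → ℂ) ∈ R)
    (hVlin : ∀ X ∈ V, ∀ Y ∈ V, ∀ t : ℂ, X + t • Y ∈ V)
    (hVcl : ∀ (u : ℕ → ι → ℂ) (X : ι → ℂ), (∀ n, u n ∈ V) → TendstoUniformly u X atTop → X ∈ V)
    (hRcl : ∀ (u : ℕ → ι → ℂ) (X : ι → ℂ), (∀ n, u n ∈ R) → TendstoUniformly u X atTop → X ∈ R)
    (hTV : ∀ X ∈ V, (∀ i, ‖X i‖ ≤ 1) → T X ∈ V)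
    (hTR : ∀ X ∈ V, (∀ i, ‖X i‖ ≤ 1) → X ∈ R → T X ∈ R)
    (hTb : ∀ X ∈ V, (∀ i, ‖X i‖ ≤ 1) → ∀ i, ‖T X i‖ ≤ 1 / 8)
    (hTd : ∀ X ∈ V, ∀ Y ∈ V, ∀ t : ℂ, (∀ i, ‖(X + t • Y) i‖ ≤ 1) → ∀ i,
      DifferentiableAt ℂ (fun t : ℂ => T (X + t • Y) i) t) :
    ∃ X ∈ V, X ∈ R ∧ (∀ i, ‖X i‖ ≤ 1) ∧ T X = X := by
  have hlip := fp_lipschitz V T hVlin hTb hTd hV0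
  set u : ℕ → ι → ℂ := fun n => T^[n] 0 with hu
  have hus : ∀ n, u (n + 1) = T (u n) := fun n => iterate_succ_apply' T n 0
  have hall : ∀ n, u n ∈ V ∧ u n ∈ R ∧ ∀ i, ‖u n i‖ ≤ 1 / 8 := by
    intro n
    induction n with
    | zero => exact ⟨hV0, hR0, by simp [hu]⟩
    | succ n ih =>
      have h1 : ∀ i, ‖u n i‖ ≤ 1 := fun i => (ih.2.2 i).trans (by norm_num)
      rw [hus]
      exact ⟨hTV _ ih.1 h1, hTR _ ih.1 h1 ih.2.1, hTb _ ih.1 h1⟩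
  have hstep : ∀ n i, ‖u (n + 1) i - u n i‖ ≤ 1 / 4 * (1 / 2) ^ n := by
    intro n
    induction n with
    | zero =>
      intro i
      have h1 := (hall 1).2.2 i
      have h2 := (hall 0).2.2 i
      calc _ ≤ _ := norm_sub_le _ _
        _ ≤ 1 / 8 + 1 / 8 := add_le_add h1 h2
        _ = _ := by norm_num
    | succ n ih =>
      intro i
      have := hlip (u n) (hall n).1 (u (n + 1)) (hall (n + 1)).1 (hall n).2.2 (1 / 4 * (1 / 2) ^ n)
        (by positivity) (by
          have : ((1 : ℝ) / 2) ^ n ≤ 1 := pow_le_one₀ (by norm_num) (by norm_num)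
          linarith) ih i
      rw [hus (n + 1), hus n] at *
      calc _ ≤ _ := this
        _ = _ := by ring
  have hstep' : ∀ i n, dist (u n i) (u (n + 1) i) ≤ 1 / 4 * (1 / 2) ^ n := by
    intro i n
    rw [dist_comm, dist_eq_norm]; exact hstep n i
  have hlim : ∀ i, ∃ x, Tendsto (fun n => u n i) atTop (𝓝 x) := fun i =>
    cauchySeq_tendsto_of_complete
      (cauchySeq_of_le_geometric (1 / 2) (1 / 4) (by norm_num) (hstep' i))
  choose X hX using hlim
  have hdist : ∀ n i, ‖X i - u n i‖ ≤ 1 / 2 * (1 / 2) ^ n := by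
    intro n i
    have := dist_le_of_le_geometric_of_tendsto (1 / 2) (1 / 4) (by norm_num) (hstep' i) (hX i) n
    rw [dist_comm, dist_eq_norm] at this
    calc _ ≤ _ := this
      _ = _ := by ring
  have hg : Tendsto (fun n : ℕ => (1 / 2 : ℝ) * (1 / 2) ^ n) atTop (𝓝 0) := by
    have := (tendsto_pow_atTop_nhds_zero_of_lt_one (r := (1 / 2 : ℝ)) (by norm_num)
      (by norm_num)).const_mul (1 / 2)
    simpa using this
  have hunif : TendstoUniformly u X atTop := by
    rw [Metric.tendstoUniformly_iff]
    intro e he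
    filter_upwards [hg.eventually_lt_const he] with n hn i
    rw [dist_eq_norm]
    exact (hdist n i).trans_lt hn
  have hXb : ∀ i, ‖X i‖ ≤ 1 / 8 := fun i =>
    le_of_tendsto (hX i).norm (Eventually.of_forall fun n => (hall n).2.2 i)
  have hXV := hVcl u X (fun n => (hall n).1) hunif
  refine ⟨X, hXV, hRcl u X (fun n => (hall n).2.1) hunif,
    fun i => (hXb i).trans (by norm_num), ?_⟩
  funext i
  have h1 : Tendsto (fun n => u (n + 1) i) atTop (𝓝 (X i)) := (hX i).comp (tendsto_add_atTop_nat 1)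
  have h2 : Tendsto (fun n => u (n + 1) i) atTop (𝓝 (T X i)) := by
    rw [tendsto_iff_norm_sub_tendsto_zero]
    refine squeeze_zero' (Eventually.of_forall fun n => norm_nonneg _) ?_ hg
    filter_upwards [eventually_ge_atTop 1] with n hn
    rw [hus n, norm_sub_rev]
    have hd : (1 / 2 : ℝ) * (1 / 2) ^ n ≤ 1 / 4 := by
      have : ((1 : ℝ) / 2) ^ n ≤ (1 / 2) ^ 1 := pow_le_pow_of_le_one (by norm_num) (by norm_num) hn
      linarith
    have := hlip (u n) (hall n).1 X hXV (hall n).2.2 _ (by positivity) hd (hdist n) i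
    have hp : (0 : ℝ) < 1 / 2 * (1 / 2) ^ n := by positivity
    linarith
  exact tendsto_nhds_unique h2 h1

/-! ### Elementary complex estimates -/

theorem norm_one_sub_cpow_le {γ : ℝ} (h0 : 0 < γ) (h1 : γ < 1) {w : ℂ} (hw : ‖w‖ < 1) :
    ‖1 - (1 - w) ^ (γ : ℂ)‖ ≤ ‖w‖ := by
  have hre : ∀ t ∈ Icc (0 : ℝ) 1, ‖(t : ℂ) * w‖ ≤ t * ‖w‖ := by
    intro t ht
    rw [norm_mul, Complex.norm_real, Real.norm_eq_abs, abs_of_nonneg ht.1]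
  have hlt : ∀ t ∈ Icc (0 : ℝ) 1, t * ‖w‖ < 1 := by
    intro t ht
    calc t * ‖w‖ ≤ 1 * ‖w‖ := by gcongr; exact ht.2
      _ < 1 := by linarith
  have hslit : ∀ t ∈ Icc (0 : ℝ) 1, (1 - (t : ℂ) * w) ∈ Complex.slitPlane := by
    intro t ht
    left
    have := (Complex.abs_re_le_norm ((t : ℂ) * w)).trans (hre t ht)
    have h2 := hlt t ht
    rw [Complex.sub_re, Complex.one_re]
    linarith [le_abs_self ((t : ℂ) * w).re]
  have hlow : ∀ t ∈ Icc (0 : ℝ) 1, 1 - t * ‖w‖ ≤ ‖1 - (t : ℂ) * w‖ := by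
    intro t ht
    have := norm_sub_norm_le (1 : ℂ) ((t : ℂ) * w)
    rw [norm_one] at this
    linarith [hre t ht]
  have hder : ∀ t ∈ Icc (0 : ℝ) 1, HasDerivAt (fun t : ℝ => 1 - (1 - (t : ℂ) * w) ^ (γ : ℂ))
      (γ * (1 - (t : ℂ) * w) ^ ((γ : ℂ) - 1) * w) t := by
    intro t ht
    have e1 : HasDerivAt (fun t : ℝ => 1 - (t : ℂ) * w) (-w) t := by
      have := ((Complex.ofRealCLM.hasDerivAt (x := t)).mul_const w).const_sub 1
      simpa using this
    have e3 := ((hasDerivAt_id (1 - (t : ℂ) * w)).cpow_const (c := (γ : ℂ)) (hslit t ht))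
    have e2 := (e3.comp t e1).const_sub 1
    refine e2.congr_deriv ?_
    simp only [id]
    ring
  have hderB : ∀ t ∈ Icc (0 : ℝ) 1, HasDerivAt (fun t : ℝ => 1 - (1 - t * ‖w‖) ^ γ)
      (γ * (1 - t * ‖w‖) ^ (γ - 1) * ‖w‖) t := by
    intro t ht
    have e1 : HasDerivAt (fun t : ℝ => 1 - t * ‖w‖) (-‖w‖) t := by
      have := ((hasDerivAt_id t).mul_const ‖w‖).const_sub 1
      simpa using this
    have e2 := (e1.rpow_const (p := γ) (Or.inl (by linarith [hlt t ht]))).const_sub 1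
    refine e2.congr_deriv ?_
    ring
  have key := image_norm_le_of_norm_deriv_right_le_deriv_boundary'
    (f := fun t : ℝ => 1 - (1 - (t : ℂ) * w) ^ (γ : ℂ)) (a := 0) (b := 1)
    (B := fun t : ℝ => 1 - (1 - t * ‖w‖) ^ γ)
    (fun t ht => (hder t ht).continuousAt.continuousWithinAt)
    (fun t ht => (hder t (Ico_subset_Icc_self ht)).hasDerivWithinAt)
    (by simp)
    (fun t ht => (hderB t ht).continuousAt.continuousWithinAt)
    (fun t ht => (hderB t (Ico_subset_Icc_self ht)).hasDerivWithinAt)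
    (by
      intro t ht
      have ht' := Ico_subset_Icc_self ht
      rw [norm_mul, norm_mul, Complex.norm_real, Real.norm_eq_abs, abs_of_pos h0]
      gcongr
      have hne : (1 - (t : ℂ) * w) ≠ 0 := Complex.slitPlane_ne_zero (hslit t ht')
      have : ((γ : ℂ) - 1) = ((γ - 1 : ℝ) : ℂ) := by push_cast; rfl
      rw [this, Complex.norm_cpow_real]
      exact Real.rpow_le_rpow_of_nonpos (by linarith [hlt t ht']) (hlow t ht') (by linarith))
  have := key (x := 1) ⟨zero_le_one, le_rfl⟩
  simp only [Complex.ofReal_one, one_mul] at this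
  refine this.trans ?_
  have h3 : (1 - ‖w‖) ^ (1 : ℝ) ≤ (1 - ‖w‖) ^ γ :=
    Real.rpow_le_rpow_of_exponent_ge (by linarith) (by linarith [norm_nonneg w]) h1.le
  rw [Real.rpow_one] at h3
  linarith

/-! ### Part 2: one-sided complex estimates -/

/-- `Λ(z) = 1 - z + ε h(z)`. -/
def cLam (ε : ℝ) (h : ℂ → ℂ) (z : ℂ) : ℂ := 1 - z + ε * h z
/-- The derivative of `Λ`. -/
def cLamd (ε : ℝ) (h : ℂ → ℂ) (z : ℂ) : ℂ := -1 + ε * deriv h z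
/-- The inverse branch. -/
def cG (γ ε : ℝ) (h : ℂ → ℂ) (c : ℂ) (z : ℂ) : ℂ := c * (1 - cLam ε h z ^ (γ : ℂ))
/-- The logarithm of the derivative of the inverse branch. -/
def cEll (γ ε : ℝ) (h : ℂ → ℂ) (c : ℂ) (z : ℂ) : ℂ :=
  Complex.log γ + Complex.log c + ((γ : ℂ) - 1) * Complex.log (cLam ε h z)
    + Complex.log (-cLamd ε h z)
/-- The logarithm of the derivative of the iterated inverse branch. -/
def cS (γ ε : ℝ) (h : ℂ → ℂ) (c : ℂ) (n : ℕ) (z : ℂ) : ℂ :=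
  ∑ k ∈ Finset.range n, cEll γ ε h c ((cG γ ε h c)^[k] z)

/-- Standing assumptions for one side. -/
structure SideOK (γ ε m : ℝ) (h : ℂ → ℂ) (c : ℂ) : Prop where
  g0 : 0 < γ
  g1 : γ < 1
  m0 : 0 < m
  m1 : m ≤ 1 / 2
  e0 : 0 < ε
  e1 : ε ≤ m / 16
  e2 : 2 * ε ≤ -Real.log γ
  hd : DifferentiableOn ℂ h (Metric.ball 0 3)
  hb : ∀ z, ‖h z‖ ≤ 1
  h0 : h 0 = 0
  c1 : ‖c‖ ≤ 1 - 3 * m / 4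
  c0 : 3 * m / 4 ≤ c.re

namespace SideOK
variable {γ ε m : ℝ} {h : ℂ → ℂ} {c : ℂ}

theorem h_le (H : SideOK γ ε m h c) {z : ℂ} (hz : ‖z‖ < 3) : ‖h z‖ ≤ ‖z‖ := by
  have := Complex.dist_le_div_mul_dist_of_mapsTo_ball (R₂ := 1) H.hd (z := z)
    (by intro w _; rw [H.h0]; simpa using H.hb w) (by simpa using hz)
  rw [H.h0, dist_zero_right, dist_zero_right] at this
  nlinarith [norm_nonneg z]

theorem dh_le (H : SideOK γ ε m h c) {z : ℂ} (hz : ‖z‖ < 2) : ‖deriv h z‖ ≤ 1 := by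
  have hsub : Metric.closedBall z 1 ⊆ Metric.ball (0 : ℂ) 3 := by
    intro w hw
    rw [Metric.mem_closedBall] at hw
    rw [Metric.mem_ball]
    have := dist_triangle w z 0
    rw [dist_zero_right z] at this
    linarith
  have := Complex.norm_deriv_le_of_forall_mem_sphere_norm_le (c := z) (R := 1) (C := 1) (f := h)
    one_pos ((H.hd.mono hsub).diffContOnCl_ball Subset.rfl) (fun w _ => H.hb w)
  simpa using this

theorem hasDerivAt_h (H : SideOK γ ε m h c) {z : ℂ} (hz : ‖z‖ < 3) :
    HasDerivAt h (deriv h z) z :=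
  (H.hd.differentiableAt (Metric.isOpen_ball.mem_nhds (by simpa using hz))).hasDerivAt

theorem hasDerivAt_lam (H : SideOK γ ε m h c) {z : ℂ} (hz : ‖z‖ < 3) :
    HasDerivAt (cLam ε h) (cLamd ε h z) z := by
  have := ((hasDerivAt_id z).const_sub 1).add ((H.hasDerivAt_h hz).const_mul (ε : ℂ))
  exact this

theorem lam_sub (H : SideOK γ ε m h c) {z : ℂ} (hz : ‖z‖ < 3) :
    ‖1 - cLam ε h z‖ ≤ (1 + ε) * ‖z‖ := by
  have e : 1 - cLam ε h z = z - ε * h z := by unfold cLam; ring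
  rw [e]
  have h1 := norm_sub_le z (ε * h z)
  rw [norm_mul, Complex.norm_real, Real.norm_eq_abs, abs_of_pos H.e0] at h1
  nlinarith [H.h_le hz, H.e0]

theorem rho_lt (H : SideOK γ ε m h c) {z : ℂ} (hz : ‖z‖ ≤ 1 - m / 2) :
    (1 + ε) * ‖z‖ ≤ 1 - 3 * m / 8 := by
  have := H.e1; have := H.m0; have := H.e0; have := H.m1
  have h2 : (1 + ε) * ‖z‖ ≤ (1 + m / 16) * (1 - m / 2) := by gcongr
  nlinarith

theorem lt3 (H : SideOK γ ε m h c) {z : ℂ} (hz : ‖z‖ ≤ 1 - m / 2) : ‖z‖ < 3 := by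
  linarith [H.m0]

theorem lam_re (H : SideOK γ ε m h c) {z : ℂ} (hz : ‖z‖ ≤ 1 - m / 2) :
    0 < (cLam ε h z).re := by
  have h1 := H.lam_sub (H.lt3 hz)
  have h2 := H.rho_lt hz
  have h3 := (le_abs_self _).trans (Complex.abs_re_le_norm (1 - cLam ε h z))
  rw [Complex.sub_re, Complex.one_re] at h3
  linarith [H.m0]

theorem lamd_sub (H : SideOK γ ε m h c) {z : ℂ} (hz : ‖z‖ < 2) :
    ‖-cLamd ε h z - 1‖ ≤ ε := by
  have e : -cLamd ε h z - 1 = -(ε * deriv h z) := by unfold cLamd; ring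
  rw [e, norm_neg, norm_mul, Complex.norm_real, Real.norm_eq_abs, abs_of_pos H.e0]
  nlinarith [H.dh_le hz, H.e0]

theorem e_le (H : SideOK γ ε m h c) : ε ≤ 1 / 32 := by linarith [H.e1, H.m1]

theorem lamd_re (H : SideOK γ ε m h c) {z : ℂ} (hz : ‖z‖ < 2) :
    0 < (-cLamd ε h z).re := by
  have h1 := H.lamd_sub hz
  have h3 := (neg_abs_le _).trans' (neg_le_neg (Complex.abs_re_le_norm (-cLamd ε h z - 1)))
  rw [Complex.sub_re, Complex.one_re] at h3
  linarith [H.e_le]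

theorem log_lamd (H : SideOK γ ε m h c) {z : ℂ} (hz : ‖z‖ < 2) :
    ‖Complex.log (-cLamd ε h z)‖ ≤ 2 * ε := by
  have h1 := H.lamd_sub hz
  have := Complex.norm_log_one_add_half_le_self (z := -cLamd ε h z - 1) (by linarith [H.e_le])
  rw [show 1 + (-cLamd ε h z - 1) = -cLamd ε h z by ring] at this
  linarith [H.e0]

theorem log_lam (H : SideOK γ ε m h c) {z : ℂ} (hz : ‖z‖ ≤ 1 - m / 2) :
    ‖Complex.log (cLam ε h z)‖ ≤ 2 / m * ‖z‖ := by
  have h1 := H.lam_sub (H.lt3 hz)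
  have h2 := H.rho_lt hz
  have hm := H.m0
  set w := cLam ε h z - 1 with hw
  have hw1 : ‖w‖ ≤ (1 + ε) * ‖z‖ := by rw [hw, norm_sub_rev]; exact h1
  have := Complex.norm_log_one_add_le (z := w) (by linarith)
  rw [show 1 + w = cLam ε h z by rw [hw]; ring] at this
  refine this.trans ?_
  have h3 : (1 - ‖w‖)⁻¹ ≤ 8 / (3 * m) := by
    rw [inv_le_comm₀ (by linarith) (by positivity)]
    rw [inv_div]; linarith
  have h4 : ‖w‖ ^ 2 * (1 - ‖w‖)⁻¹ / 2 ≤ ‖w‖ * (8 / (3 * m)) / 2 := by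
    have : ‖w‖ ^ 2 ≤ ‖w‖ := by nlinarith [norm_nonneg w]
    have h5 : 0 ≤ (1 - ‖w‖)⁻¹ := inv_nonneg.2 (by linarith)
    gcongr
  have h6 : ‖w‖ * (8 / (3 * m)) / 2 + ‖w‖ ≤ 2 / m * ‖z‖ := by
    have h7 : ‖w‖ ≤ 33 / 32 * ‖z‖ := by nlinarith [H.e_le, norm_nonneg z]
    have h8 : ‖w‖ * (8 / (3 * m)) / 2 + ‖w‖ = (4 / 3 + m) * ‖w‖ / m := by field_simp; ring
    rw [h8, show 2 / m * ‖z‖ = 2 * ‖z‖ / m by ring]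
    apply div_le_div_of_nonneg_right _ hm.le
    nlinarith [H.m1, norm_nonneg w, norm_nonneg z]
  linarith

theorem c_ne (H : SideOK γ ε m h c) : c ≠ 0 := by
  intro h; have := H.c0; rw [h] at this; simp at this; linarith [H.m0]

theorem G_le (H : SideOK γ ε m h c) {z : ℂ} (hz : ‖z‖ ≤ 1 - m / 2) :
    ‖cG γ ε h c z‖ ≤ (1 - m / 2) * ‖z‖ := by
  have h1 := H.lam_sub (H.lt3 hz)
  have h2 := H.rho_lt hz
  have h3 := norm_one_sub_cpow_le H.g0 H.g1 (w := 1 - cLam ε h z) (by linarith [H.m0])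
  rw [sub_sub_cancel] at h3
  unfold cG
  rw [norm_mul]
  have := H.e1; have := H.m0; have := H.e0; have := H.m1; have := H.c1
  calc ‖c‖ * ‖1 - cLam ε h z ^ (γ : ℂ)‖ ≤ (1 - 3 * m / 4) * ((1 + m / 16) * ‖z‖) := by
        have : ‖1 - cLam ε h z ^ (γ : ℂ)‖ ≤ (1 + m / 16) * ‖z‖ := by
          refine h3.trans (h1.trans ?_)
          gcongr
        have h5 : 0 ≤ 1 - 3 * m / 4 := by linarith
        gcongr
    _ = ((1 - 3 * m / 4) * (1 + m / 16)) * ‖z‖ := by ring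
    _ ≤ (1 - m / 2) * ‖z‖ := by
        apply mul_le_mul_of_nonneg_right _ (norm_nonneg z)
        nlinarith

theorem G_iter_le (H : SideOK γ ε m h c) {z : ℂ} (hz : ‖z‖ ≤ 1 - m / 2) (k : ℕ) :
    ‖(cG γ ε h c)^[k] z‖ ≤ (1 - m / 2) ^ k * ‖z‖ := by
  have hm := H.m0; have hm1 := H.m1
  induction k with
  | zero => simp
  | succ k ih =>
    have h1 : (1 - m / 2) ^ k ≤ 1 := pow_le_one₀ (by linarith) (by linarith)
    have h2 : ‖(cG γ ε h c)^[k] z‖ ≤ 1 - m / 2 := by nlinarith [norm_nonneg z]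
    rw [iterate_succ_apply', pow_succ']
    refine (H.G_le h2).trans ?_
    rw [mul_assoc]
    have : 0 ≤ 1 - m / 2 := by linarith
    gcongr

theorem G_iter_dom (H : SideOK γ ε m h c) {z : ℂ} (hz : ‖z‖ ≤ 1 - m / 2) (k : ℕ) :
    ‖(cG γ ε h c)^[k] z‖ ≤ 1 - m / 2 := by
  have hm := H.m0; have hm1 := H.m1
  have h1 : (1 - m / 2) ^ k ≤ 1 := pow_le_one₀ (by linarith) (by linarith)
  have := H.G_iter_le hz k
  nlinarith [norm_nonneg z]

theorem ell_sub (H : SideOK γ ε m h c) {z : ℂ} (hz : ‖z‖ ≤ 1 - m / 2) :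
    ‖cEll γ ε h c z - (Complex.log γ + Complex.log c)‖ ≤ 2 / m * ‖z‖ + 2 * ε := by
  have e : cEll γ ε h c z - (Complex.log γ + Complex.log c) =
    ((γ : ℂ) - 1) * Complex.log (cLam ε h z) + Complex.log (-cLamd ε h z) := by
    unfold cEll; ring
  rw [e]
  refine (norm_add_le _ _).trans (add_le_add ?_ (H.log_lamd (by linarith [H.m0])))
  rw [norm_mul]
  have h1 : ‖(γ : ℂ) - 1‖ ≤ 1 := by
    rw [show (γ : ℂ) - 1 = ((γ - 1 : ℝ) : ℂ) by push_cast; rfl, Complex.norm_real,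
      Real.norm_eq_abs, abs_le]
    constructor <;> linarith [H.g0, H.g1]
  calc _ ≤ 1 * ‖Complex.log (cLam ε h z)‖ := by gcongr
    _ ≤ _ := by rw [one_mul]; exact H.log_lam hz

theorem S_sub (H : SideOK γ ε m h c) {z : ℂ} (hz : ‖z‖ ≤ 1 - m / 2) (n : ℕ) :
    ‖cS γ ε h c n z - n * (Complex.log γ + Complex.log c)‖ ≤ 4 / m ^ 2 + 2 * ε * n := by
  have hm := H.m0; have hm1 := H.m1
  have key : ∀ n : ℕ, ‖cS γ ε h c n z - n * (Complex.log γ + Complex.log c)‖ ≤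
      4 / m ^ 2 * (1 - (1 - m / 2) ^ n) + 2 * ε * n := by
    intro n
    induction n with
    | zero => simp [cS]
    | succ n ih =>
      have e : cS γ ε h c (n + 1) z - (n + 1 : ℕ) * (Complex.log γ + Complex.log c) =
        (cS γ ε h c n z - n * (Complex.log γ + Complex.log c)) +
        (cEll γ ε h c ((cG γ ε h c)^[n] z) - (Complex.log γ + Complex.log c)) := by
        unfold cS; rw [Finset.sum_range_succ]; push_cast; ring
      rw [e]
      have h1 := H.ell_sub (H.G_iter_dom hz n)
      have h2 := H.G_iter_le hz n
      have h3 : ‖(cG γ ε h c)^[n] z‖ ≤ (1 - m / 2) ^ n := by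
        have : 0 ≤ (1 - m / 2) ^ n := pow_nonneg (by linarith) n
        nlinarith [norm_nonneg z]
      have h4 : 2 / m * ‖(cG γ ε h c)^[n] z‖ ≤ 2 / m * (1 - m / 2) ^ n := by gcongr
      have h5 : 4 / m ^ 2 * (1 - (1 - m / 2) ^ (n + 1)) =
        4 / m ^ 2 * (1 - (1 - m / 2) ^ n) + 2 / m * (1 - m / 2) ^ n := by
        rw [pow_succ]; field_simp; ring
      rw [h5]; push_cast
      linarith [norm_add_le (cS γ ε h c n z - n * (Complex.log γ + Complex.log c))
        (cEll γ ε h c ((cG γ ε h c)^[n] z) - (Complex.log γ + Complex.log c))]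
  refine (key n).trans ?_
  have : 0 ≤ 4 / m ^ 2 * (1 - m / 2) ^ n := by
    have : 0 ≤ (1 - m / 2) ^ n := pow_nonneg (by linarith) n
    positivity
  linarith

theorem exp_S_le (H : SideOK γ ε m h c) {z : ℂ} (hz : ‖z‖ ≤ 1 - m / 2) (n : ℕ) :
    ‖Complex.exp (cS γ ε h c n z)‖ ≤ Real.exp (4 / m ^ 2) := by
  have h1 := (le_abs_self _).trans ((Complex.abs_re_le_norm _).trans (H.S_sub hz n))
  rw [Complex.norm_exp]
  apply Real.exp_le_exp.2
  have e : (cS γ ε h c n z - n * (Complex.log γ + Complex.log c)).re =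
    (cS γ ε h c n z).re - n * (Real.log γ + Real.log ‖c‖) := by
    rw [Complex.sub_re, ← Complex.ofReal_natCast, Complex.re_ofReal_mul, Complex.add_re,
      Complex.log_re, Complex.log_re, Complex.norm_real, Real.norm_eq_abs, abs_of_pos H.g0]
  rw [e] at h1
  have h2 : Real.log ‖c‖ ≤ 0 := Real.log_nonpos (norm_nonneg _) (by linarith [H.c1, H.m0])
  have h3 : (n : ℝ) * (Real.log γ + Real.log ‖c‖ + 2 * ε) ≤ 0 := by
    apply mul_nonpos_of_nonneg_of_nonpos n.cast_nonneg
    linarith [H.e2]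
  nlinarith

theorem hasDerivAt_G (H : SideOK γ ε m h c) {z : ℂ} (hz : ‖z‖ ≤ 1 - m / 2) :
    HasDerivAt (cG γ ε h c) (Complex.exp (cEll γ ε h c z)) z := by
  have h1 := H.hasDerivAt_lam (H.lt3 hz)
  have hre := H.lam_re hz
  have hne : cLam ε h z ≠ 0 := by intro h; rw [h] at hre; simp at hre
  have hre' := H.lamd_re (z := z) (by linarith [H.m0])
  have hne' : -cLamd ε h z ≠ 0 := by intro h; rw [h] at hre'; simp at hre'
  have h2 := ((h1.cpow_const (c := (γ : ℂ)) (Or.inl hre)).const_sub 1).const_mul c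
  refine h2.congr_deriv ?_
  unfold cEll
  rw [Complex.exp_add, Complex.exp_add, Complex.exp_add, Complex.exp_log H.c_ne,
    Complex.exp_log hne', Complex.exp_log (by exact_mod_cast H.g0.ne'),
    Complex.cpow_def_of_ne_zero hne, mul_comm (Complex.log _)]
  ring

theorem hasDerivAt_G_iter (H : SideOK γ ε m h c) {z : ℂ} (hz : ‖z‖ ≤ 1 - m / 2) (n : ℕ) :
    HasDerivAt ((cG γ ε h c)^[n]) (Complex.exp (cS γ ε h c n z)) z := by
  induction n with
  | zero => simpa [cS] using hasDerivAt_id z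
  | succ n ih =>
    have h1 := H.hasDerivAt_G (H.G_iter_dom hz n)
    have h2 := h1.comp z ih
    rw [iterate_succ']
    refine h2.congr_deriv ?_
    unfold cS
    rw [Finset.sum_range_succ, Complex.exp_add, mul_comm]

end SideOK

/-! ### Holomorphic families -/

/-- A family of functions, holomorphic in the parameter near `t₀`. -/
def HolFam (h : ℂ → ℂ → ℂ) (t₀ : ℂ) : Prop :=
  ∀ z : ℂ → ℂ, DifferentiableAt ℂ z t₀ → ‖z t₀‖ < 3 →
    DifferentiableAt ℂ (fun t => h t (z t)) t₀ ∧
    DifferentiableAt ℂ (fun t => deriv (h t) (z t)) t₀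

theorem holFam_lin {h k : ℂ → ℂ} (hh : DifferentiableOn ℂ h (Metric.ball 0 3))
    (hk : DifferentiableOn ℂ k (Metric.ball 0 3)) (t₀ : ℂ) :
    HolFam (fun t z => h z + t * k z) t₀ := by
  intro z hz h3
  have hmem : Metric.ball (0 : ℂ) 3 ∈ 𝓝 (z t₀) := Metric.isOpen_ball.mem_nhds (by simpa using h3)
  have e1 := (hh.differentiableAt hmem).comp t₀ hz
  have e2 := (hk.differentiableAt hmem).comp t₀ hz
  refine ⟨e1.add (differentiableAt_id.mul e2), ?_⟩
  have d1 := ((hh.deriv Metric.isOpen_ball).differentiableAt hmem).comp t₀ hz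
  have d2 := ((hk.deriv Metric.isOpen_ball).differentiableAt hmem).comp t₀ hz
  have d3 : DifferentiableAt ℂ (fun t => deriv h (z t) + t * deriv k (z t)) t₀ :=
    d1.add (differentiableAt_id.mul d2)
  refine d3.congr_of_eventuallyEq ?_
  filter_upwards [hz.continuousAt.eventually (Metric.isOpen_ball.mem_nhds
    (by simpa using h3 : z t₀ ∈ Metric.ball (0 : ℂ) 3))] with t ht
  have hmem : Metric.ball (0 : ℂ) 3 ∈ 𝓝 (z t) := Metric.isOpen_ball.mem_nhds ht
  have f1 := (hh.differentiableAt hmem).hasDerivAt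
  have f2 := (hk.differentiableAt hmem).hasDerivAt
  exact (f1.add (f2.const_mul t)).deriv

section fam
variable {γ ε m : ℝ} {h : ℂ → ℂ → ℂ} {c z : ℂ → ℂ} {t₀ : ℂ}

theorem HolFam.lam (hh : HolFam h t₀) (hz : DifferentiableAt ℂ z t₀) (h3 : ‖z t₀‖ < 3) :
    DifferentiableAt ℂ (fun t => cLam ε (h t) (z t)) t₀ := by
  unfold cLam
  exact (hz.const_sub 1).add ((hh z hz h3).1.const_mul _)

theorem HolFam.lamd (hh : HolFam h t₀) (hz : DifferentiableAt ℂ z t₀) (h3 : ‖z t₀‖ < 3) :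
    DifferentiableAt ℂ (fun t => cLamd ε (h t) (z t)) t₀ := by
  unfold cLamd
  exact ((hh z hz h3).2.const_mul _).const_add _

theorem HolFam.G (hh : HolFam h t₀) (hc : DifferentiableAt ℂ c t₀)
    (H : SideOK γ ε m (h t₀) (c t₀))
    (hz : DifferentiableAt ℂ z t₀) (h3 : ‖z t₀‖ ≤ 1 - m / 2) :
    DifferentiableAt ℂ (fun t => cG γ ε (h t) (c t) (z t)) t₀ := by
  unfold cG
  exact hc.mul (((hh.lam hz (H.lt3 h3)).cpow_const (Or.inl (H.lam_re h3))).const_sub 1)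

theorem HolFam.G_iter (hh : HolFam h t₀) (hc : DifferentiableAt ℂ c t₀)
    (H : SideOK γ ε m (h t₀) (c t₀))
    (hz : DifferentiableAt ℂ z t₀) (h3 : ‖z t₀‖ ≤ 1 - m / 2) (n : ℕ) :
    DifferentiableAt ℂ (fun t => (cG γ ε (h t) (c t))^[n] (z t)) t₀ := by
  induction n with
  | zero => simpa using hz
  | succ n ih =>
    simp only [iterate_succ_apply']
    exact hh.G hc H ih (H.G_iter_dom h3 n)

theorem HolFam.ell (hh : HolFam h t₀) (hc : DifferentiableAt ℂ c t₀)
    (H : SideOK γ ε m (h t₀) (c t₀))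
    (hz : DifferentiableAt ℂ z t₀) (h3 : ‖z t₀‖ ≤ 1 - m / 2) :
    DifferentiableAt ℂ (fun t => cEll γ ε (h t) (c t) (z t)) t₀ := by
  unfold cEll
  have h4 := H.lt3 h3
  exact (((hc.clog (Or.inl (by linarith [H.c0, H.m0]))).const_add _).add
    (((hh.lam hz h4).clog (Or.inl (H.lam_re h3))).const_mul _)).add
    ((hh.lamd hz h4).neg.clog (Or.inl (H.lamd_re (by linarith [H.m0]))))

theorem HolFam.S (hh : HolFam h t₀) (hc : DifferentiableAt ℂ c t₀)
    (H : SideOK γ ε m (h t₀) (c t₀))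
    (hz : DifferentiableAt ℂ z t₀) (h3 : ‖z t₀‖ ≤ 1 - m / 2) (n : ℕ) :
    DifferentiableAt ℂ (fun t => cS γ ε (h t) (c t) n (z t)) t₀ := by
  unfold cS
  exact DifferentiableAt.fun_sum fun k _ =>
    hh.ell hc H (hh.G_iter hc H hz h3 k) (H.G_iter_dom h3 k)
end fam

/-! ### Part 3: two-sided estimates -/

/-- `W(w) = 1 - G^n(d - w)`. -/
def cW (γ ε : ℝ) (k : ℂ → ℂ) (d : ℂ) (n : ℕ) (w : ℂ) : ℂ := 1 - (cG γ ε k d)^[n] (d - w)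
/-- `F(z) = Λ(W(s (z - c)))`. -/
def cF (γ ε : ℝ) (h : ℂ → ℂ) (c : ℂ) (k : ℂ → ℂ) (d : ℂ) (n : ℕ) (s z : ℂ) : ℂ :=
  cLam ε h (cW γ ε k d n (s * (z - c)))
/-- Logarithm of the derivative. -/
def cL (γ ε : ℝ) (h : ℂ → ℂ) (k : ℂ → ℂ) (d : ℂ) (n : ℕ) (w : ℂ) : ℂ :=
  Complex.log (-cLamd ε h (cW γ ε k d n w)) + cS γ ε k d n (d - w)

theorem nearly_affine {K K' : ℂ → ℂ} {η ξ : ℝ} {x z : ℂ}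
    (hK : ∀ z, ‖z‖ < 3 → HasDerivAt K (K' z) z) (hK' : ∀ z, ‖z‖ < 3 → ‖K' z - 1‖ ≤ η)
    (hη : η ≤ 1 / 8) (hξ : ξ ≤ 1 / 4) (hx : ‖x - 1‖ ≤ ξ) (hz : ‖z‖ < 3) :
    K 0 - K x ≠ 0 ∧ ‖(K z - K x) / (K 0 - K x) - (1 - z)‖ ≤ 30 * (η + ξ) := by
  have hx1 : ‖x‖ ≤ 5 / 4 := by
    have := norm_add_le (x - 1) 1
    rw [sub_add_cancel, norm_one] at this
    linarith
  have hη0 : 0 ≤ η := (norm_nonneg _).trans (hK' 0 (by simp))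
  have hdiff : ∀ z, ‖z‖ < 3 → ‖(K z - z) - (K x - x)‖ ≤ η * ‖z - x‖ := by
    intro z hz
    exact (convex_ball (0 : ℂ) 3).norm_image_sub_le_of_norm_hasDerivWithin_le
      (f := fun z => K z - z) (f' := fun z => K' z - 1)
      (fun w hw => ((hK w (by simpa using hw)).sub (hasDerivAt_id w)).hasDerivWithinAt)
      (fun w hw => hK' w (by simpa using hw)) (by simp; linarith) (by simpa using hz)
  set e1 := (K z - z) - (K x - x) with he1
  set e2 := (K 0 - 0) - (K x - x) with he2
  have h1 : ‖e1‖ ≤ η * 5 := by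
    refine (hdiff z hz).trans ?_
    have := norm_sub_le z x
    gcongr; linarith
  have h2 : ‖e2‖ ≤ η * (5 / 4) := by
    refine (hdiff 0 (by simp)).trans ?_
    rw [zero_sub, norm_neg]
    gcongr
  have hden : K 0 - K x = -x + e2 := by rw [he2]; ring
  have hnum : K z - K x = z - x + e1 := by rw [he1]; ring
  have hdl : 1 / 2 ≤ ‖-x + e2‖ := by
    have h3 : (1 : ℂ) = (-x + e2) * (-1) + ((1 - x) + e2) := by ring
    have h4 : ‖(1 : ℂ)‖ ≤ ‖(-x + e2) * (-1)‖ + (‖1 - x‖ + ‖e2‖) := by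
      conv_lhs => rw [h3]
      exact (norm_add_le _ _).trans (add_le_add le_rfl (norm_add_le _ _))
    rw [norm_one, norm_mul, norm_neg, norm_one, mul_one, norm_sub_rev] at h4
    linarith
  have hdne : -x + e2 ≠ 0 := by
    intro h; rw [h, norm_zero] at hdl; linarith
  rw [hden, hnum]
  refine ⟨hdne, ?_⟩
  have e : (z - x + e1) / (-x + e2) - (1 - z) = (z * (1 - x) + e1 - (1 - z) * e2) / (-x + e2) := by
    field_simp; ring
  rw [e, norm_div, div_le_iff₀ (by linarith)]
  have h5 : ‖z * (1 - x) + e1 - (1 - z) * e2‖ ≤ 3 * ξ + η * 5 + 4 * (η * (5 / 4)) := by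
    refine (norm_sub_le _ _).trans (add_le_add ((norm_add_le _ _).trans (add_le_add ?_ h1)) ?_)
    · rw [norm_mul, norm_sub_rev 1 x]
      gcongr
    · rw [norm_mul]
      have := norm_sub_le 1 z
      rw [norm_one] at this
      gcongr
      linarith
  have hξ0 : 0 ≤ ξ := (norm_nonneg _).trans hx
  nlinarith

section two
variable {γ ε m : ℝ} {h k : ℂ → ℂ} {c d : ℂ}

theorem SideOK.dom (Hj : SideOK γ ε m k d) {w : ℂ} (hw : ‖w‖ ≤ m / 4) :
    ‖d - w‖ ≤ 1 - m / 2 := by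
  have := norm_sub_le d w
  linarith [Hj.c1]

theorem SideOK.W_lt (Hj : SideOK γ ε m k d) (n : ℕ) {w : ℂ} (hw : ‖w‖ ≤ m / 4) :
    ‖cW γ ε k d n w‖ < 2 := by
  have h1 := Hj.G_iter_dom (Hj.dom hw) n
  have h2 := norm_sub_le 1 ((cG γ ε k d)^[n] (d - w))
  rw [norm_one] at h2
  unfold cW
  linarith [Hj.m0]

theorem SideOK.hasDerivAt_W (Hj : SideOK γ ε m k d) (n : ℕ) {w : ℂ} (hw : ‖w‖ ≤ m / 4) :
    HasDerivAt (cW γ ε k d n) (Complex.exp (cS γ ε k d n (d - w))) w := by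
  have h1 := Hj.hasDerivAt_G_iter (Hj.dom hw) n
  have h2 := (h1.comp w ((hasDerivAt_id w).const_sub d)).const_sub 1
  refine h2.congr_deriv ?_
  simp

theorem SideOK.L_sub (Hi : SideOK γ ε m h c) (Hj : SideOK γ ε m k d) (n : ℕ) {w : ℂ}
    (hw : ‖w‖ < m / 4) :
    ‖cL γ ε h k d n w - cL γ ε h k d n 0‖ ≤
      2 * (4 / m ^ 2 + 2 * ε * n + 2 * ε) / (m / 4) * ‖w‖ := by
  have hfh : ∀ t, HolFam (fun _ => h) t := fun t => by
    have := holFam_lin Hi.hd (k := 0) (differentiableOn_const 0) t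
    simpa using this
  have hfk : ∀ t, HolFam (fun _ => k) t := fun t => by
    have := holFam_lin Hj.hd (k := 0) (differentiableOn_const 0) t
    simpa using this
  have hd : DifferentiableOn ℂ (cL γ ε h k d n) (Metric.ball 0 (m / 4)) := by
    intro w hw
    have hw' : ‖w‖ < m / 4 := by simpa using hw
    have h2 : DifferentiableAt ℂ (cW γ ε k d n) w :=
      (Hj.hasDerivAt_W n hw'.le).differentiableAt
    have h3 := Hj.W_lt n hw'.le
    refine DifferentiableAt.differentiableWithinAt ?_
    refine DifferentiableAt.add ?_ ?_
    · exact ((hfh w).lamd h2 (by linarith)).neg.clog (Or.inl (Hi.lamd_re h3))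
    · exact (hfk w).S (differentiableAt_const d) Hj (differentiableAt_id.const_sub d)
        (Hj.dom hw'.le) n
  have hbd : ∀ w : ℂ, ‖w‖ ≤ m / 4 → ‖cL γ ε h k d n w - n * (Complex.log γ + Complex.log d)‖ ≤
      4 / m ^ 2 + 2 * ε * n + 2 * ε := by
    intro w hw
    unfold cL
    rw [add_sub_assoc]
    refine (norm_add_le _ _).trans ?_
    linarith [Hi.log_lamd (Hj.W_lt n hw), Hj.S_sub (Hj.dom hw) n]
  have := Complex.dist_le_div_mul_dist_of_mapsTo_ball
    (R₂ := 2 * (4 / m ^ 2 + 2 * ε * n + 2 * ε)) hd (z := w) (by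
      intro w hw
      have hw' : ‖w‖ < m / 4 := by simpa using hw
      rw [Metric.mem_closedBall, dist_eq_norm]
      have a1 := hbd w hw'.le
      have a2 := hbd 0 (by simp; linarith [Hi.m0])
      have := norm_sub_le (cL γ ε h k d n w - n * (Complex.log γ + Complex.log d))
        (cL γ ε h k d n 0 - n * (Complex.log γ + Complex.log d))
      rw [sub_sub_sub_cancel_right] at this
      linarith) (by simpa using hw)
  simpa [dist_eq_norm] using this

theorem sdom {s z c : ℂ} {m : ℝ} (hs : ‖s‖ < m / 16) (hc : ‖c‖ ≤ 1) (hz : ‖z‖ < 3) :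
    ‖s * (z - c)‖ ≤ 4 * ‖s‖ ∧ ‖s * (z - c)‖ < m / 4 := by
  rw [norm_mul]
  have := norm_sub_le z c
  have h2 : ‖s‖ * ‖z - c‖ ≤ ‖s‖ * 4 := by gcongr; linarith
  constructor <;> linarith

theorem SideOK.c_le (H : SideOK γ ε m h c) : ‖c‖ ≤ 1 := by linarith [H.c1, H.m0]

theorem SideOK.hasDerivAt_F (Hi : SideOK γ ε m h c) (Hj : SideOK γ ε m k d) (n : ℕ) {s z : ℂ}
    (hs : ‖s‖ < m / 16) (hz : ‖z‖ < 3) :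
    HasDerivAt (cF γ ε h c k d n s)
      (cLamd ε h (cW γ ε k d n (s * (z - c))) * (Complex.exp (cS γ ε k d n (d - s * (z - c))) * s))
      z := by
  have hw := (sdom hs Hi.c_le hz).2.le
  have h1 := Hj.hasDerivAt_W n hw
  have h2 := Hi.hasDerivAt_lam (z := cW γ ε k d n (s * (z - c))) (by linarith [Hj.W_lt n hw])
  have h3 : HasDerivAt (fun z => s * (z - c)) s z := by
    simpa using ((hasDerivAt_id z).sub_const c).const_mul s
  have h4 : HasDerivAt (fun z => cW γ ε k d n (s * (z - c))) _ z := HasDerivAt.comp (h₂ := cW γ ε k d n) z h1 h3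
  exact h2.comp z h4

theorem SideOK.ratio (Hi : SideOK γ ε m h c) (Hj : SideOK γ ε m k d) (n : ℕ) {s x z : ℂ}
    {η ξ : ℝ} (hs0 : s ≠ 0) (hs : ‖s‖ < m / 16)
    (hη : 64 * (4 / m ^ 2 + 2 * ε * n + 2 * ε) / m * ‖s‖ ≤ η)
    (hη1 : η ≤ 1 / 8) (hξ : ξ ≤ 1 / 4) (hx : ‖x - 1‖ ≤ ξ) (hz : ‖z‖ < 3) :
    cF γ ε h c k d n s 0 - cF γ ε h c k d n s x ≠ 0 ∧
    ‖(cF γ ε h c k d n s z - cF γ ε h c k d n s x) /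
      (cF γ ε h c k d n s 0 - cF γ ε h c k d n s x) - (1 - z)‖ ≤ 30 * (η + ξ) := by
  set L := cL γ ε h k d n with hL
  set q : ℂ := -(s * Complex.exp (L 0)) with hq
  have hq0 : q ≠ 0 := neg_ne_zero.2 (mul_ne_zero hs0 (Complex.exp_ne_zero _))
  have hm := Hi.m0
  have key := nearly_affine (K := fun z => cF γ ε h c k d n s z / q)
    (K' := fun z => Complex.exp (L (s * (z - c)) - L 0)) (η := η) (ξ := ξ) (x := x) (z := z)
    (by
      intro z hz
      have hw := (sdom hs Hi.c_le hz).2.le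
      refine ((Hi.hasDerivAt_F Hj n hs hz).div_const q).congr_deriv ?_
      have hre' := Hi.lamd_re (Hj.W_lt n hw)
      have hne' : -cLamd ε h (cW γ ε k d n (s * (z - c))) ≠ 0 := by
        intro h; rw [h] at hre'; simp at hre'
      rw [Complex.exp_sub]
      have e1 : Complex.exp (L (s * (z - c))) = -cLamd ε h (cW γ ε k d n (s * (z - c))) *
        Complex.exp (cS γ ε k d n (d - s * (z - c))) := by
        rw [hL]; unfold cL; rw [Complex.exp_add, Complex.exp_log hne']
      rw [e1, hq]
      have := Complex.exp_ne_zero (L 0)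
      field_simp)
    (by
      intro z hz
      have hw := sdom hs Hi.c_le hz
      have h1 := Hi.L_sub Hj n hw.2
      have h0 : 0 ≤ 4 / m ^ 2 + 2 * ε * n + 2 * ε := by have := Hi.e0; positivity
      have h2 : 2 * (4 / m ^ 2 + 2 * ε * n + 2 * ε) / (m / 4) * ‖s * (z - c)‖ ≤
        2 * (4 / m ^ 2 + 2 * ε * n + 2 * ε) / (m / 4) * (4 * ‖s‖) := by
        gcongr; exact hw.1
      have h3 : 2 * (4 / m ^ 2 + 2 * ε * n + 2 * ε) / (m / 4) * (4 * ‖s‖) =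
        (64 * (4 / m ^ 2 + 2 * ε * n + 2 * ε) / m * ‖s‖) / 2 := by field_simp; ring
      have h4 := Complex.norm_exp_sub_one_le (x := L (s * (z - c)) - L 0) (by linarith)
      linarith) hη1 hξ hx hz
  simp only [← sub_div] at key
  refine ⟨fun h => key.1 (by rw [h, zero_div]), ?_⟩
  rw [div_div_div_cancel_right₀ hq0] at key
  exact key.2
end two

/-! ### Conjugation symmetry -/

section conjsym
open ComplexConjugate
variable {γ ε m : ℝ} {h k : ℂ → ℂ} {c d : ℂ}

theorem slit_arg {z : ℂ} (hz : 0 < z.re) : z.arg ≠ Real.pi :=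
  (Complex.mem_slitPlane_iff_arg.1 (Or.inl hz)).1

theorem lam_conj (hh : ∀ z, h (conj z) = conj (h z)) (z : ℂ) :
    cLam ε h (conj z) = conj (cLam ε h z) := by
  unfold cLam; simp [hh]

theorem deriv_conj_of (hh : ∀ z, h (conj z) = conj (h z)) (z : ℂ) :
    deriv h (conj z) = conj (deriv h z) := by
  have e : h = conj ∘ h ∘ conj := by funext z; simp [hh]
  conv_lhs => rw [e]
  rw [deriv_conj_conj]
  simp

theorem lamd_conj (hh : ∀ z, h (conj z) = conj (h z)) (z : ℂ) :
    cLamd ε h (conj z) = conj (cLamd ε h z) := by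
  unfold cLamd; simp [deriv_conj_of hh]

theorem SideOK.G_conj (H : SideOK γ ε m h c) (hh : ∀ z, h (conj z) = conj (h z))
    (hc : conj c = c) {z : ℂ} (hz : ‖z‖ ≤ 1 - m / 2) :
    cG γ ε h c (conj z) = conj (cG γ ε h c z) := by
  unfold cG
  rw [lam_conj hh, map_mul, map_sub, hc, map_one, Complex.conj_cpow _ _ (slit_arg (H.lam_re hz)),
    Complex.conj_ofReal]

theorem SideOK.G_iter_conj (H : SideOK γ ε m h c) (hh : ∀ z, h (conj z) = conj (h z))
    (hc : conj c = c) {z : ℂ} (hz : ‖z‖ ≤ 1 - m / 2) (n : ℕ) :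
    (cG γ ε h c)^[n] (conj z) = conj ((cG γ ε h c)^[n] z) := by
  induction n with
  | zero => rfl
  | succ n ih =>
    rw [iterate_succ_apply', iterate_succ_apply', ih, H.G_conj hh hc (H.G_iter_dom hz n)]

theorem SideOK.ell_conj (H : SideOK γ ε m h c) (hh : ∀ z, h (conj z) = conj (h z))
    (hc : conj c = c) {z : ℂ} (hz : ‖z‖ ≤ 1 - m / 2) :
    cEll γ ε h c (conj z) = conj (cEll γ ε h c z) := by
  unfold cEll
  rw [lam_conj hh, lamd_conj hh, Complex.log_conj _ (slit_arg (H.lam_re hz)), ← map_neg,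
    Complex.log_conj _ (slit_arg (H.lamd_re (by linarith [H.m0])))]
  have e1 : conj (Complex.log c) = Complex.log c := by
    rw [← Complex.log_conj _ (slit_arg (by linarith [H.c0, H.m0])), hc]
  have e2 : conj (Complex.log γ) = Complex.log γ := by
    rw [← Complex.log_conj _ (slit_arg (by simpa using H.g0)), Complex.conj_ofReal]
  simp [e1, e2]

theorem SideOK.S_conj (H : SideOK γ ε m h c) (hh : ∀ z, h (conj z) = conj (h z))
    (hc : conj c = c) {z : ℂ} (hz : ‖z‖ ≤ 1 - m / 2) (n : ℕ) :
    cS γ ε h c n (conj z) = conj (cS γ ε h c n z) := by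
  unfold cS
  rw [map_sum]
  refine Finset.sum_congr rfl fun k _ => ?_
  rw [H.G_iter_conj hh hc hz, H.ell_conj hh hc (H.G_iter_dom hz k)]

theorem SideOK.W_conj (H : SideOK γ ε m k d) (hk : ∀ z, k (conj z) = conj (k z))
    (hd : conj d = d) (n : ℕ) {w : ℂ} (hw : ‖w‖ ≤ m / 4) :
    cW γ ε k d n (conj w) = conj (cW γ ε k d n w) := by
  unfold cW
  rw [map_sub, map_one, ← H.G_iter_conj hk hd (H.dom hw), map_sub, hd]

theorem SideOK.F_conj (Hi : SideOK γ ε m h c) (Hj : SideOK γ ε m k d)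
    (hh : ∀ z, h (conj z) = conj (h z)) (hk : ∀ z, k (conj z) = conj (k z))
    (hc : conj c = c) (hd : conj d = d) (n : ℕ) {s z : ℂ} (hs' : conj s = s)
    (hs : ‖s‖ < m / 16) (hz : ‖z‖ < 3) :
    cF γ ε h c k d n s (conj z) = conj (cF γ ε h c k d n s z) := by
  unfold cF
  have e : s * (conj z - c) = conj (s * (z - c)) := by
    rw [map_mul, map_sub, hc, hs']
  rw [e, Hj.W_conj hk hd n (sdom hs Hi.c_le hz).2.le, lam_conj hh]
end conjsym

/-! ### Part 4: the operator and its fixed point -/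

/-- Index set of the unknowns. -/
inductive Idx where
  | h (i : Bool) (z : ℂ)
  | x (i : Bool)
  | t
  | c

/-- Numerical parameters. -/
structure Par where
  α : ℝ
  γ : ℝ
  cs : ℝ
  m : ℝ
  r : ℝ
  ε : ℝ
  τ : ℝ
  Θ : ℝ
  n : Bool → ℕ

/-- Conditions on the parameters. -/
structure Par.OK (p : Par) : Prop where
  ha : 1 < p.α
  g0 : 0 < p.γ
  g1 : p.γ < 1
  m0 : 0 < p.m
  m1 : p.m ≤ 1 / 2
  cm0 : p.m ≤ p.cs
  cm1 : p.m ≤ 1 - p.cs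
  r0 : 0 < p.r
  r1 : p.r ≤ p.m / 4
  e0 : 0 < p.ε
  e1 : p.ε ≤ p.m / 16
  e2 : 2 * p.ε ≤ -Real.log p.γ
  t0 : 0 < p.τ
  T0 : 0 < p.Θ
  n0 : ∀ i, 0 < p.n i
  sig : Real.exp (-(p.n false * (p.τ / 2))) < p.m / 16
  eta : ∀ j, 64 * (4 / p.m ^ 2 + 2 * p.ε * p.n j + 2 * p.ε) / p.m *
    Real.exp (-(p.n false * (p.τ / 2))) ≤ p.ε / 480
  the : ∀ j, (1 - p.m / 2) ^ p.n j ≤ p.ε / 480 / 8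
  ht1 : ∀ c : ℂ, ‖c - p.cs‖ ≤ p.r →
    ‖-(Complex.log p.γ + Complex.log c) / (p.α - 1) - p.τ‖ ≤ p.τ / 32
  ht2 : (4 / p.m ^ 2 + 2 * p.ε * p.n false) / ((p.α - 1) * p.n false) ≤ p.τ / 32
  hc1 : ∀ c : ℂ, ‖c - p.cs‖ ≤ p.r →
    ‖c - (p.n false * (Complex.log p.γ + Complex.log c) -
      p.n true * (Complex.log p.γ + Complex.log (1 - c))) / (p.n false * p.Θ) - p.cs‖ ≤ p.r / 16
  hc2 : ((4 / p.m ^ 2 + 2 * p.ε * p.n false) + (4 / p.m ^ 2 + 2 * p.ε * p.n true)) /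
    (p.n false * p.Θ) ≤ p.r / 16

namespace Par
variable (p : Par)

/-- Function part of the state. -/
def hF (X : Idx → ℂ) (i : Bool) : ℂ → ℂ := fun z => X (Idx.h i z)
/-- Critical point. -/
def cX (X : Idx → ℂ) (i : Bool) : ℂ := if i then 1 - (p.cs + p.r * X Idx.c) else p.cs + p.r * X Idx.c
/-- Zero of `Λ`. -/
def xX (X : Idx → ℂ) (i : Bool) : ℂ := 1 + (p.ε / 480 : ℝ) * X (Idx.x i)
/-- Scaling. -/
def sX (X : Idx → ℂ) : ℂ := Complex.exp (-(p.n false * (p.τ + (p.τ / 2 : ℝ) * X Idx.t)))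
/-- The composed function. -/
def FX (X : Idx → ℂ) (i : Bool) (z : ℂ) : ℂ :=
  cF p.γ p.ε (hF X i) (p.cX X i) (hF X (!i)) (p.cX X (!i)) (p.n (!i)) (p.sX X) z
/-- The total distortion at the marked point of side `j`. -/
def SX (X : Idx → ℂ) (j : Bool) : ℂ :=
  cS p.γ p.ε (hF X j) (p.cX X j) (p.n j) (p.cX X j - p.sX X * (p.xX X (!j) - p.cX X (!j)))

open Classical in
/-- The operator. -/
def T (X : Idx → ℂ) : Idx → ℂ
  | .h i z => if ‖z‖ < 3 then
      ((p.FX X i z - p.FX X i (p.xX X i)) / (p.FX X i 0 - p.FX X i (p.xX X i)) - (1 - z)) / p.ε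
      else 0
  | .x i => (cW p.γ p.ε (hF X (!i)) (p.cX X (!i)) (p.n (!i))
      (p.sX X * (p.xX X i - p.cX X i)) - 1) / (p.ε / 480 : ℝ)
  | .t => (-p.SX X false / ((p.α - 1) * p.n false) - p.τ) / (p.τ / 2 : ℝ)
  | .c => (p.cs + p.r * X Idx.c - (p.SX X false - p.SX X true) / (p.n false * p.Θ) - p.cs) / p.r

/-- Admissible states. -/
def V : Set (Idx → ℂ) := {X | ∀ i, DifferentiableOn ℂ (hF X i) (Metric.ball 0 3) ∧ hF X i 0 = 0}
/-- Real states. -/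
def R : Set (Idx → ℂ) := {X | (∀ i z, X (Idx.h i (starRingEnd ℂ z)) = starRingEnd ℂ (X (Idx.h i z))) ∧
  (∀ i, starRingEnd ℂ (X (Idx.x i)) = X (Idx.x i)) ∧ starRingEnd ℂ (X Idx.t) = X Idx.t ∧
  starRingEnd ℂ (X Idx.c) = X Idx.c}

variable {p} {X : Idx → ℂ}

theorem OK.side (P : p.OK) (hX : X ∈ V) (hb : ∀ i, ‖X i‖ ≤ 1) (i : Bool) :
    SideOK p.γ p.ε p.m (hF X i) (p.cX X i) := by
  have hr := P.r1
  have hr0 := P.r0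
  have h1 : ‖(p.r : ℂ) * X Idx.c‖ ≤ p.r := by
    rw [norm_mul, Complex.norm_real, Real.norm_eq_abs, abs_of_pos P.r0]
    nlinarith [hb Idx.c]
  have h2 := Complex.abs_re_le_norm ((p.r : ℂ) * X Idx.c)
  have h3 := abs_le.1 (h2.trans h1)
  have := P.m0; have := P.m1; have := P.cm0; have := P.cm1
  refine ⟨P.g0, P.g1, P.m0, P.m1, P.e0, P.e1, P.e2, (hX i).1, fun z => hb _, (hX i).2, ?_, ?_⟩
  · cases i
    · simp only [cX, Bool.false_eq_true, if_false]
      refine (norm_add_le _ _).trans ?_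
      rw [Complex.norm_real, Real.norm_eq_abs, abs_of_pos (by linarith)]
      linarith
    · simp only [cX, if_true]
      rw [show (1 : ℂ) - (p.cs + p.r * X Idx.c) = ((1 - p.cs : ℝ) : ℂ) - p.r * X Idx.c by
        push_cast; ring]
      refine (norm_sub_le _ _).trans ?_
      rw [Complex.norm_real, Real.norm_eq_abs, abs_of_pos (by linarith)]
      linarith
  · cases i
    · simp only [cX, Bool.false_eq_true, if_false, Complex.add_re, Complex.ofReal_re]
      linarith
    · simp only [cX, if_true, Complex.add_re, Complex.ofReal_re, Complex.sub_re, Complex.one_re]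
      linarith

theorem OK.s_ne : p.sX X ≠ 0 := Complex.exp_ne_zero _

theorem OK.s_le (P : p.OK) (hb : ∀ i, ‖X i‖ ≤ 1) :
    ‖p.sX X‖ ≤ Real.exp (-(p.n false * (p.τ / 2))) := by
  unfold sX
  rw [Complex.norm_exp]
  apply Real.exp_le_exp.2
  rw [Complex.neg_re, ← Complex.ofReal_natCast, Complex.re_ofReal_mul, Complex.add_re,
    Complex.re_ofReal_mul, Complex.ofReal_re]
  have h2 := neg_le_of_abs_le ((Complex.abs_re_le_norm (X Idx.t)).trans (hb _))
  have : p.τ / 2 ≤ p.τ + p.τ / 2 * (X Idx.t).re := by nlinarith [P.t0]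
  have : (p.n false : ℝ) * (p.τ / 2) ≤ p.n false * (p.τ + p.τ / 2 * (X Idx.t).re) := by gcongr
  linarith

theorem OK.s_lt (P : p.OK) (hb : ∀ i, ‖X i‖ ≤ 1) : ‖p.sX X‖ < p.m / 16 :=
  (P.s_le hb).trans_lt P.sig

theorem OK.x_sub (P : p.OK) (hb : ∀ i, ‖X i‖ ≤ 1) (i : Bool) : ‖p.xX X i - 1‖ ≤ p.ε / 480 := by
  unfold xX
  rw [add_sub_cancel_left, norm_mul, Complex.norm_real, Real.norm_eq_abs,
    abs_of_pos (by linarith [P.e0])]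
  nlinarith [hb (Idx.x i), P.e0]

theorem OK.e_le (P : p.OK) : p.ε ≤ 1 / 32 := by linarith [P.e1, P.m1]

theorem OK.x_lt (P : p.OK) (hb : ∀ i, ‖X i‖ ≤ 1) (i : Bool) : ‖p.xX X i‖ < 3 := by
  have h1 := P.x_sub hb i
  have := norm_add_le (p.xX X i - 1) 1
  rw [sub_add_cancel, norm_one] at this
  linarith [P.e_le]

theorem OK.ratio (P : p.OK) (hX : X ∈ V) (hb : ∀ i, ‖X i‖ ≤ 1) (i : Bool) {z : ℂ} (hz : ‖z‖ < 3) :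
    p.FX X i 0 - p.FX X i (p.xX X i) ≠ 0 ∧
    ‖(p.FX X i z - p.FX X i (p.xX X i)) / (p.FX X i 0 - p.FX X i (p.xX X i)) - (1 - z)‖ ≤
      p.ε / 8 := by
  have he := P.e_le
  have hm := P.m0
  have he0 := P.e0
  have := (P.side hX hb i).ratio (P.side hX hb (!i)) (p.n (!i)) (s := p.sX X) (x := p.xX X i)
    (η := p.ε / 480) (ξ := p.ε / 480)
    OK.s_ne (P.s_lt hb) ((P.eta (!i)).trans' (by gcongr; exact P.s_le hb)) (by linarith)
    (by linarith) (P.x_sub hb i) hz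
  refine ⟨this.1, this.2.trans (by linarith)⟩

theorem OK.wdom (P : p.OK) (hX : X ∈ V) (hb : ∀ i, ‖X i‖ ≤ 1) (i : Bool) :
    ‖p.sX X * (p.xX X i - p.cX X i)‖ ≤ p.m / 4 :=
  (sdom (P.s_lt hb) (P.side hX hb i).c_le (P.x_lt hb i)).2.le

theorem OK.qdom (P : p.OK) (hX : X ∈ V) (hb : ∀ i, ‖X i‖ ≤ 1) (j : Bool) :
    ‖p.cX X j - p.sX X * (p.xX X (!j) - p.cX X (!j))‖ ≤ 1 - p.m / 2 :=
  (P.side hX hb j).dom (P.wdom hX hb (!j))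

theorem OK.c_sub (P : p.OK) (hb : ∀ i, ‖X i‖ ≤ 1) : ‖p.cX X false - p.cs‖ ≤ p.r := by
  simp only [cX, Bool.false_eq_true, if_false, add_sub_cancel_left]
  rw [norm_mul, Complex.norm_real, Real.norm_eq_abs, abs_of_pos P.r0]
  nlinarith [hb Idx.c, P.r0]

theorem OK.bound (P : p.OK) (hX : X ∈ V) (hb : ∀ i, ‖X i‖ ≤ 1) (i : Idx) :
    ‖p.T X i‖ ≤ 1 / 8 := by
  have he0 := P.e0
  have hα := P.ha
  have hn := P.n0 false
  have hn' : (0 : ℝ) < p.n false := by exact_mod_cast hn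
  have hcs := P.c_sub hb
  have hfs := (P.side hX hb false).S_sub (P.qdom hX hb false) (p.n false)
  have hts := (P.side hX hb true).S_sub (P.qdom hX hb true) (p.n true)
  cases i with
  | h i z =>
    simp only [T]
    split_ifs with hz
    · rw [norm_div, Complex.norm_real, Real.norm_eq_abs, abs_of_pos he0, div_le_iff₀ he0]
      linarith [(P.ratio hX hb i hz).2]
    · simp
  | x i =>
    simp only [T]
    rw [norm_div, Complex.norm_real, Real.norm_eq_abs, abs_of_pos (by linarith),
      div_le_iff₀ (by linarith)]
    unfold cW
    rw [sub_sub_cancel_left, norm_neg]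
    have h1 := (P.side hX hb (!i)).G_iter_le ((P.side hX hb (!i)).dom (P.wdom hX hb i)) (p.n (!i))
    have h2 := P.the (!i)
    have h3 := (P.side hX hb (!i)).dom (P.wdom hX hb i)
    have h4 : 0 ≤ (1 - p.m / 2) ^ p.n (!i) := pow_nonneg (by linarith [P.m1]) _
    have h5 := P.m0
    nlinarith
  | t =>
    simp only [T]
    have ht := P.t0
    rw [norm_div, Complex.norm_real, Real.norm_eq_abs, abs_of_pos (by linarith),
      div_le_iff₀ (by linarith)]
    have h1 := P.ht1 _ hcs
    have hαc : ((p.α : ℂ) - 1) ≠ 0 := by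
      rw [show (p.α : ℂ) - 1 = ((p.α - 1 : ℝ) : ℂ) by push_cast; rfl]
      exact_mod_cast (by linarith : p.α - 1 ≠ 0)
    have hnc : (p.n false : ℂ) ≠ 0 := by exact_mod_cast hn.ne'
    have e : -p.SX X false / ((p.α - 1) * p.n false) - p.τ =
      (-(Complex.log p.γ + Complex.log (p.cX X false)) / (p.α - 1) - p.τ) -
      (p.SX X false - p.n false * (Complex.log p.γ + Complex.log (p.cX X false))) /
        (((p.α - 1) * p.n false : ℝ) : ℂ) := by
      push_cast
      field_simp
      ring
    rw [e]
    refine (norm_sub_le _ _).trans ?_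
    have h2 : ‖(p.SX X false - p.n false * (Complex.log p.γ + Complex.log (p.cX X false))) /
        (((p.α - 1) * p.n false : ℝ) : ℂ)‖ ≤ p.τ / 32 := by
      rw [norm_div, Complex.norm_real, Real.norm_eq_abs,
        abs_of_pos (mul_pos (by linarith) hn')]
      refine P.ht2.trans' ?_
      have : 0 < (p.α - 1) * p.n false := mul_pos (by linarith) hn'
      gcongr
      exact hfs
    linarith
  | c =>
    simp only [T]
    have hr := P.r0
    have hT := P.T0
    rw [norm_div, Complex.norm_real, Real.norm_eq_abs, abs_of_pos (by linarith),
      div_le_iff₀ (by linarith)]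
    have h1 := P.hc1 _ hcs
    have hTc : (p.Θ : ℂ) ≠ 0 := by exact_mod_cast hT.ne'
    have hnc : (p.n false : ℂ) ≠ 0 := by exact_mod_cast hn.ne'
    have ect : 1 - p.cX X false = p.cX X true := by simp [cX]
    rw [ect] at h1
    have ecf : p.cs + p.r * X Idx.c = p.cX X false := by simp [cX]
    rw [ecf]
    have e : p.cX X false - (p.SX X false - p.SX X true) / (p.n false * p.Θ) - p.cs =
      (p.cX X false - (p.n false * (Complex.log p.γ + Complex.log (p.cX X false)) -
      p.n true * (Complex.log p.γ + Complex.log (p.cX X true))) / (p.n false * p.Θ) - p.cs) -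
      ((p.SX X false - p.n false * (Complex.log p.γ + Complex.log (p.cX X false))) -
       (p.SX X true - p.n true * (Complex.log p.γ + Complex.log (p.cX X true)))) /
        ((p.n false * p.Θ : ℝ) : ℂ) := by
      push_cast
      field_simp
      ring
    rw [e]
    refine (norm_sub_le _ _).trans ?_
    have h2 : ‖((p.SX X false - p.n false * (Complex.log p.γ + Complex.log (p.cX X false))) -
       (p.SX X true - p.n true * (Complex.log p.γ + Complex.log (p.cX X true)))) /
        ((p.n false * p.Θ : ℝ) : ℂ)‖ ≤ p.r / 16 := by
      rw [norm_div, Complex.norm_real, Real.norm_eq_abs, abs_of_pos (mul_pos hn' hT)]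
      refine P.hc2.trans' ?_
      gcongr
      exact (norm_sub_le _ _).trans (add_le_add hfs hts)
    linarith

theorem V_zero : (0 : Idx → ℂ) ∈ V := fun i => ⟨differentiableOn_const 0, rfl⟩

theorem V_lin {X : Idx → ℂ} (hX : X ∈ V) {Y : Idx → ℂ} (hY : Y ∈ V) (t : ℂ) : X + t • Y ∈ V := by
  intro i
  refine ⟨(hX i).1.add ((hY i).1.const_smul t), ?_⟩
  have h1 := (hX i).2
  have h2 := (hY i).2
  simp only [Par.hF] at h1 h2
  simp [Par.hF, h1, h2]

theorem path_hol {X : Idx → ℂ} (hX : X ∈ V) {Y : Idx → ℂ} (hY : Y ∈ V) (t : ℂ) (i : Bool) :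
    HolFam (fun t => Par.hF (X + t • Y) i) t :=
  holFam_lin (hX i).1 (hY i).1 t

section path
variable {Y : Idx → ℂ} {t : ℂ}

theorem coord_diff (i : Idx) : DifferentiableAt ℂ (fun t : ℂ => (X + t • Y) i) t := by
  simp only [Pi.add_apply, Pi.smul_apply, smul_eq_mul]
  exact (differentiableAt_id.mul_const _).const_add _

theorem c_diff (i : Bool) : DifferentiableAt ℂ (fun t : ℂ => p.cX (X + t • Y) i) t := by
  cases i
  · simp only [cX, Bool.false_eq_true, if_false]
    exact ((coord_diff _).const_mul _).const_add _
  · simp only [cX, if_true]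
    exact (((coord_diff _).const_mul _).const_add _).const_sub _

theorem x_diff (i : Bool) : DifferentiableAt ℂ (fun t : ℂ => p.xX (X + t • Y) i) t :=
  ((coord_diff _).const_mul _).const_add _

theorem s_diff : DifferentiableAt ℂ (fun t : ℂ => p.sX (X + t • Y)) t :=
  ((((coord_diff _).const_mul _).const_add _).const_mul _).neg.cexp

theorem OK.W_diff (P : p.OK) (hX : X ∈ V) (hY : Y ∈ V) (hb : ∀ i, ‖(X + t • Y) i‖ ≤ 1)
    (i : Bool) {z : ℂ → ℂ} (hz : DifferentiableAt ℂ z t) (hz3 : ‖z t‖ < 3) :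
    DifferentiableAt ℂ (fun t => cW p.γ p.ε (Par.hF (X + t • Y) (!i)) (p.cX (X + t • Y) (!i))
      (p.n (!i)) (p.sX (X + t • Y) * (z t - p.cX (X + t • Y) i))) t := by
  have hs := P.side (V_lin hX hY t) hb
  have hw := (sdom (P.s_lt hb) (hs i).c_le hz3).2.le
  unfold cW
  refine DifferentiableAt.const_sub ?_ 1
  exact (path_hol hX hY t (!i)).G_iter (c_diff _) (hs (!i))
    ((c_diff _).sub (s_diff.mul (hz.sub (c_diff _)))) ((hs (!i)).dom hw) _

theorem OK.F_diff (P : p.OK) (hX : X ∈ V) (hY : Y ∈ V) (hb : ∀ i, ‖(X + t • Y) i‖ ≤ 1)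
    (i : Bool) {z : ℂ → ℂ} (hz : DifferentiableAt ℂ z t) (hz3 : ‖z t‖ < 3) :
    DifferentiableAt ℂ (fun t => p.FX (X + t • Y) i (z t)) t := by
  have hs := P.side (V_lin hX hY t) hb
  have hw := (sdom (P.s_lt hb) (hs i).c_le hz3).2.le
  have h1 := P.W_diff hX hY hb i hz hz3
  exact (path_hol hX hY t i).lam h1 (by linarith [(hs (!i)).W_lt (p.n (!i)) hw])

theorem OK.S_diff (P : p.OK) (hX : X ∈ V) (hY : Y ∈ V) (hb : ∀ i, ‖(X + t • Y) i‖ ≤ 1)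
    (j : Bool) : DifferentiableAt ℂ (fun t => p.SX (X + t • Y) j) t :=
  (path_hol hX hY t j).S (c_diff _) (P.side (V_lin hX hY t) hb j)
    ((c_diff _).sub (s_diff.mul ((x_diff _).sub (c_diff _))))
    (P.qdom (V_lin hX hY t) hb j) _

theorem OK.Th_diff (P : p.OK) (hX : X ∈ V) (hY : Y ∈ V) (hb : ∀ i, ‖(X + t • Y) i‖ ≤ 1)
    (i : Bool) {z : ℂ → ℂ} (hz : DifferentiableAt ℂ z t) (hz3 : ‖z t‖ < 3) :
    DifferentiableAt ℂ (fun t => ((p.FX (X + t • Y) i (z t) -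
      p.FX (X + t • Y) i (p.xX (X + t • Y) i)) / (p.FX (X + t • Y) i 0 -
      p.FX (X + t • Y) i (p.xX (X + t • Y) i)) - (1 - z t)) / p.ε) t := by
  have h1 := P.F_diff hX hY hb i hz hz3
  have h2 := P.F_diff hX hY hb i (x_diff (p := p) i) (P.x_lt hb i)
  have h3 := P.F_diff hX hY hb i (differentiableAt_const (0 : ℂ)) (by simp)
  exact ((((h1.sub h2).div (h3.sub h2) (P.ratio (V_lin hX hY t) hb i hz3).1)).sub
    (hz.const_sub 1)).div_const _

theorem OK.T_diff (P : p.OK) (hX : X ∈ V) (hY : Y ∈ V) (hb : ∀ i, ‖(X + t • Y) i‖ ≤ 1)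
    (i : Idx) : DifferentiableAt ℂ (fun t : ℂ => p.T (X + t • Y) i) t := by
  cases i with
  | h i z =>
    simp only [T]
    split_ifs with hz
    · exact P.Th_diff hX hY hb i (differentiableAt_const z) hz
    · exact differentiableAt_const _
  | x i =>
    simp only [T]
    exact ((P.W_diff hX hY hb i (x_diff i) (P.x_lt hb i)).sub_const _).div_const _
  | t =>
    simp only [T]
    exact (((P.S_diff hX hY hb false).neg.div_const _).sub_const _).div_const _
  | c =>
    simp only [T]
    exact (((((coord_diff _).const_mul _).const_add _).sub
      (((P.S_diff hX hY hb false).sub (P.S_diff hX hY hb true)).div_const _)).sub_const _).div_const _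

end path

theorem OK.T_V (P : p.OK) (hX : X ∈ V) (hb : ∀ i, ‖X i‖ ≤ 1) : p.T X ∈ V := by
  intro i
  constructor
  · have h1 : DifferentiableOn ℂ (fun z => ((p.FX X i z - p.FX X i (p.xX X i)) /
      (p.FX X i 0 - p.FX X i (p.xX X i)) - (1 - z)) / p.ε) (Metric.ball 0 3) := by
      intro z hz
      have hz' : ‖z‖ < 3 := by simpa using hz
      have := P.Th_diff (t := z) hX V_zero (by simpa using hb) i (z := fun z => z)
        differentiableAt_id hz'
      simp only [smul_zero, add_zero] at this
      exact this.differentiableWithinAt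
    refine h1.congr ?_
    intro z hz
    have hz' : ‖z‖ < 3 := by simpa using hz
    simp [Par.hF, T, hz']
  · have := (P.ratio hX hb i (z := 0) (by simp)).1
    simp [Par.hF, T, this]

theorem V_closed (u : ℕ → Idx → ℂ) (X : Idx → ℂ) (hu : ∀ n, u n ∈ V)
    (hl : TendstoUniformly u X atTop) : X ∈ V := by
  intro i
  have h1 : TendstoUniformly (fun n => Par.hF (u n) i) (Par.hF X i) atTop :=
    hl.comp (Idx.h i)
  refine ⟨(h1.tendstoUniformlyOn.tendstoLocallyUniformlyOn).differentiableOn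
    (Eventually.of_forall fun n => (hu n i).1) Metric.isOpen_ball, ?_⟩
  have h2 := h1.tendsto_at 0
  have h3 : (fun n => Par.hF (u n) i 0) = fun _ => 0 := funext fun n => (hu n i).2
  rw [h3] at h2
  exact tendsto_nhds_unique h2 tendsto_const_nhds |>.symm ▸ rfl

theorem R_zero : (0 : Idx → ℂ) ∈ R := by
  simp [R]

theorem R_closed (u : ℕ → Idx → ℂ) (X : Idx → ℂ) (hu : ∀ n, u n ∈ R)
    (hl : TendstoUniformly u X atTop) : X ∈ R := by
  have key : ∀ i j : Idx, (∀ n, u n i = starRingEnd ℂ (u n j)) → X i = starRingEnd ℂ (X j) := by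
    intro i j hij
    have h1 := hl.tendsto_at i
    have h2 := (Complex.continuous_conj.tendsto (X j)).comp (hl.tendsto_at j)
    refine tendsto_nhds_unique h1 (h2.congr fun n => ?_)
    simp [hij n]
  exact ⟨fun i z => key _ _ fun n => (hu n).1 i z, fun i => (key _ _ fun n => ((hu n).2.1 i).symm).symm,
    (key _ _ fun n => (hu n).2.2.1.symm).symm, (key _ _ fun n => (hu n).2.2.2.symm).symm⟩

theorem c_real (hR : X ∈ R) (i : Bool) : starRingEnd ℂ (p.cX X i) = p.cX X i := by
  cases i <;> simp [cX, hR.2.2.2]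
theorem x_real (hR : X ∈ R) (i : Bool) : starRingEnd ℂ (p.xX X i) = p.xX X i := by
  simp [xX, hR.2.1 i, -Complex.ofReal_div]
theorem s_real (hR : X ∈ R) : starRingEnd ℂ (p.sX X) = p.sX X := by
  unfold sX
  rw [← Complex.exp_conj]
  simp [hR.2.2.1, -Complex.ofReal_div]

theorem OK.F_conj (P : p.OK) (hX : X ∈ V) (hb : ∀ i, ‖X i‖ ≤ 1) (hR : X ∈ R) (i : Bool) {z : ℂ}
    (hz : ‖z‖ < 3) : p.FX X i (starRingEnd ℂ z) = starRingEnd ℂ (p.FX X i z) :=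
  (P.side hX hb i).F_conj (P.side hX hb (!i)) (hR.1 i) (hR.1 (!i)) (c_real hR _) (c_real hR _) _
    (s_real hR) (P.s_lt hb) hz

theorem OK.S_conj (P : p.OK) (hX : X ∈ V) (hb : ∀ i, ‖X i‖ ≤ 1) (hR : X ∈ R) (j : Bool) :
    starRingEnd ℂ (p.SX X j) = p.SX X j := by
  have h1 := (P.side hX hb j).S_conj (hR.1 j) (c_real hR j) (P.qdom hX hb j) (p.n j)
  simp only [map_sub, map_mul, c_real hR, x_real hR, s_real hR] at h1
  exact h1.symm

theorem OK.T_R (P : p.OK) (hX : X ∈ V) (hb : ∀ i, ‖X i‖ ≤ 1) (hR : X ∈ R) : p.T X ∈ R := by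
  refine ⟨fun i z => ?_, fun i => ?_, ?_, ?_⟩
  · simp only [T, RCLike.norm_conj]
    split_ifs with hz
    · have e0 := P.F_conj hX hb hR i (z := 0) (by simp)
      have ex := P.F_conj hX hb hR i (P.x_lt hb i)
      rw [map_zero] at e0
      rw [x_real hR] at ex
      simp [P.F_conj hX hb hR i hz, ← e0, ← ex]
    · simp
  · simp only [T]
    have h1 := (P.side hX hb (!i)).W_conj (hR.1 (!i)) (c_real hR (!i)) (p.n (!i)) (P.wdom hX hb i)
    simp only [map_sub, map_mul, c_real hR, x_real hR, s_real hR] at h1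
    simp [← h1, -Complex.ofReal_div]
  · simp [T, P.S_conj hX hb hR, -Complex.ofReal_div]
  · simp [T, P.S_conj hX hb hR, hR.2.2.2]

theorem OK.exists_fixed (P : p.OK) :
    ∃ X ∈ V, X ∈ R ∧ (∀ i, ‖X i‖ ≤ 1) ∧ p.T X = X :=
  fp_exists V R p.T V_zero R_zero (fun _ hX _ hY t => V_lin hX hY t) V_closed R_closed
    (fun _ hX hb => P.T_V hX hb) (fun _ hX hb hR => P.T_R hX hb hR)
    (fun _ hX hb => P.bound hX hb) (fun _ hX _ hY _ hb => P.T_diff hX hY hb)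

end Par

/-! ### Part 5: extraction of real data -/

/-- Real inverse branch. -/
def rG (γ c : ℝ) (lam : ℝ → ℝ) (y : ℝ) : ℝ := c * (1 - lam y ^ γ)

/-- The real data produced by the fixed point. -/
structure Core (α γ ε m s : ℝ) (n : Bool → ℕ) (cc x : Bool → ℝ) (lam : Bool → ℝ → ℝ) : Prop where
  ha : 1 < α
  g0 : 0 < γ
  g1 : γ < 1
  m0 : 0 < m
  m1 : m ≤ 1 / 2
  e0 : 0 < ε
  e1 : ε ≤ m / 16
  n0 : ∀ i, 0 < n i
  cc0 : ∀ i, 3 * m / 4 ≤ cc i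
  ccs : ∀ i, cc (!i) = 1 - cc i
  s0 : 0 < s
  s1 : s < m / 16
  smooth : ∀ i y, |y| < 2 → ContDiffAt ℝ 3 (lam i) y
  der : ∀ i y, |y| < 2 → |deriv (lam i) y + 1| ≤ ε
  near : ∀ i y, |y| < 3 → |lam i y - (1 - y)| ≤ ε * |y|
  zero : ∀ i, lam i (x i) = 0
  xsub : ∀ i, |x i - 1| ≤ ε / 480
  fix : ∀ i, x i = 1 - (rG γ (cc (!i)) (lam (!i)))^[n (!i)] (cc (!i) - s * (x i - cc i))
  func : ∀ i y, |y| < 2 →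
    lam i (1 - (rG γ (cc (!i)) (lam (!i)))^[n (!i)] (cc (!i) - s * (y - cc i))) = s ^ α * lam i y
  dG : ∀ i k y, |y| < 1 - m / 2 →
    |deriv ((rG γ (cc i) (lam i))^[k]) y| ≤ Real.exp (4 / m ^ 2)

namespace Par
variable {p : Par} {X : Idx → ℂ}

theorem OK.S_eq (P : p.OK) (hT : p.T X = X) (j : Bool) :
    p.SX X j = -((p.α - 1) * (p.n false * (p.τ + (p.τ / 2 : ℝ) * X Idx.t))) := by
  have hn : (p.n false : ℂ) ≠ 0 := by exact_mod_cast (P.n0 false).ne'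
  have hα : ((p.α : ℂ) - 1) ≠ 0 := by
    rw [show (p.α : ℂ) - 1 = ((p.α - 1 : ℝ) : ℂ) by push_cast; rfl]
    exact_mod_cast (by linarith [P.ha] : p.α - 1 ≠ 0)
  have ht : ((p.τ / 2 : ℝ) : ℂ) ≠ 0 := by exact_mod_cast (by linarith [P.t0] : p.τ / 2 ≠ 0)
  have hr : (p.r : ℂ) ≠ 0 := by exact_mod_cast P.r0.ne'
  have hTh : (p.Θ : ℂ) ≠ 0 := by exact_mod_cast P.T0.ne'
  have h1 := congrFun hT Idx.t
  have h2 := congrFun hT Idx.c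
  simp only [T] at h1 h2
  rw [div_eq_iff ht] at h1
  rw [div_eq_iff hr] at h2
  have e1 : p.SX X false = -((p.α - 1) * (p.n false * (p.τ + (p.τ / 2 : ℝ) * X Idx.t))) := by
    rw [sub_eq_iff_eq_add, div_eq_iff (mul_ne_zero hα hn)] at h1
    linear_combination -h1
  cases j
  · exact e1
  · rw [← e1]
    have h3 : (p.SX X false - p.SX X true) / (p.n false * p.Θ) = 0 := by
      linear_combination -h2
    rw [div_eq_zero_iff, or_iff_left (mul_ne_zero hn hTh)] at h3
    linear_combination -h3

theorem OK.fixW (P : p.OK) (hT : p.T X = X) (i : Bool) :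
    cW p.γ p.ε (hF X (!i)) (p.cX X (!i)) (p.n (!i)) (p.sX X * (p.xX X i - p.cX X i)) = p.xX X i := by
  have h1 := congrFun hT (Idx.x i)
  simp only [T] at h1
  have he : ((p.ε / 480 : ℝ) : ℂ) ≠ 0 := by exact_mod_cast (by linarith [P.e0] : p.ε / 480 ≠ 0)
  rw [div_eq_iff he] at h1
  unfold xX at h1 ⊢
  linear_combination h1

theorem OK.lam_eq (P : p.OK) (hT : p.T X = X) (i : Bool) {z : ℂ} (hz : ‖z‖ < 3) :
    cLam p.ε (hF X i) z =
      (p.FX X i z - p.FX X i (p.xX X i)) / (p.FX X i 0 - p.FX X i (p.xX X i)) := by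
  have h1 := congrFun hT (Idx.h i z)
  simp only [T, hz, if_true] at h1
  have he : (p.ε : ℂ) ≠ 0 := by exact_mod_cast P.e0.ne'
  rw [div_eq_iff he] at h1
  unfold cLam hF
  linear_combination -h1

theorem OK.lam_x (P : p.OK) (hb : ∀ i, ‖X i‖ ≤ 1) (hT : p.T X = X) (i : Bool) :
    cLam p.ε (hF X i) (p.xX X i) = 0 := by
  rw [P.lam_eq hT i (P.x_lt hb i)]; simp

theorem OK.F_x (P : p.OK) (hb : ∀ i, ‖X i‖ ≤ 1) (hT : p.T X = X) (i : Bool) :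
    p.FX X i (p.xX X i) = 0 := by
  unfold FX cF
  rw [P.fixW hT, P.lam_x hb hT]

theorem OK.F_eq (P : p.OK) (hX : X ∈ V) (hb : ∀ i, ‖X i‖ ≤ 1) (hT : p.T X = X) (i : Bool)
    {z : ℂ} (hz : ‖z‖ < 3) :
    p.FX X i z = p.FX X i 0 * cLam p.ε (hF X i) z := by
  have h0 := (P.ratio hX hb i hz).1
  rw [P.lam_eq hT i hz, P.F_x hb hT] at *
  rw [sub_zero] at *
  field_simp
  simp

theorem OK.x_lt2 (P : p.OK) (hb : ∀ i, ‖X i‖ ≤ 1) (i : Bool) : ‖p.xX X i‖ < 2 := by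
  have h1 := P.x_sub hb i
  have := norm_add_le (p.xX X i - 1) 1
  rw [sub_add_cancel, norm_one] at this
  linarith [P.e_le]

theorem OK.F_zero (P : p.OK) (hX : X ∈ V) (hb : ∀ i, ‖X i‖ ≤ 1) (hT : p.T X = X) (i : Bool) :
    p.FX X i 0 = Complex.exp (-(p.α * (p.n false * (p.τ + (p.τ / 2 : ℝ) * X Idx.t)))) := by
  have hi := P.side hX hb i
  have hj := P.side hX hb (!i)
  have d1 := hi.hasDerivAt_F hj (p.n (!i)) (P.s_lt hb) (P.x_lt hb i)
  have d2 := (hi.hasDerivAt_lam (P.x_lt hb i)).const_mul (p.FX X i 0)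
  have d3 : HasDerivAt (fun z => p.FX X i 0 * cLam p.ε (hF X i) z) _ (p.xX X i) :=
    HasDerivAt.congr_of_eventuallyEq d1 (by
      filter_upwards [Metric.isOpen_ball.mem_nhds (show p.xX X i ∈ Metric.ball (0 : ℂ) 3 by
        simpa using P.x_lt hb i)] with z hz
      exact (P.F_eq hX hb hT i (by simpa using hz)).symm)
  have e := d3.unique d2
  rw [P.fixW hT] at e
  have hre := hi.lamd_re (P.x_lt2 hb i)
  have hne : cLamd p.ε (hF X i) (p.xX X i) ≠ 0 := by
    intro h; rw [h] at hre; simp at hre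
  have e2 : p.FX X i 0 = Complex.exp (p.SX X (!i)) * p.sX X := by
    apply mul_right_cancel₀ hne
    rw [← e]
    unfold SX
    rw [Bool.not_not]
    ring
  rw [e2, P.S_eq hT]
  unfold sX
  rw [← Complex.exp_add]
  congr 1
  ring

theorem conj_re {z : ℂ} (h : starRingEnd ℂ z = z) : ((z.re : ℝ) : ℂ) = z :=
  Complex.conj_eq_iff_re.1 h

theorem OK.core (P : p.OK) (hX : X ∈ V) (hR : X ∈ R) (hb : ∀ i, ‖X i‖ ≤ 1) (hT : p.T X = X) :
    ∃ s cc x lam, Core p.α p.γ p.ε p.m s p.n cc x lam ∧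
      s ≤ Real.exp (-(p.n false * (p.τ / 2))) := by
  set B : ℝ := p.n false * (p.τ + p.τ / 2 * (X Idx.t).re) with hB
  have hBc : (p.n false * (p.τ + (p.τ / 2 : ℝ) * X Idx.t) : ℂ) = (B : ℂ) := by
    rw [hB]; push_cast; rw [conj_re hR.2.2.1]
  set s : ℝ := Real.exp (-B) with hs
  have hsc : p.sX X = (s : ℂ) := by
    unfold sX; rw [hBc, hs]; push_cast; rfl
  have hsn : ‖p.sX X‖ = s := by
    rw [hsc, Complex.norm_real, Real.norm_eq_abs, abs_of_pos (Real.exp_pos _)]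
  set cc : Bool → ℝ := fun i => (p.cX X i).re with hcc
  have hccc : ∀ i, p.cX X i = (cc i : ℂ) := fun i => (conj_re (c_real hR i)).symm
  set x : Bool → ℝ := fun i => (p.xX X i).re with hx
  have hxc : ∀ i, p.xX X i = (x i : ℂ) := fun i => (conj_re (x_real hR i)).symm
  set lam : Bool → ℝ → ℝ := fun i y => (cLam p.ε (hF X i) (y : ℂ)).re with hlam
  have hlc : ∀ i (y : ℝ), cLam p.ε (hF X i) (y : ℂ) = (lam i y : ℂ) := by
    intro i y
    refine (conj_re ?_).symm
    rw [← lam_conj (hR.1 i), Complex.conj_ofReal]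
  have hside := P.side hX hb
  have hrn : ∀ y : ℝ, ‖(y : ℂ)‖ = |y| := fun y => Complex.norm_real y
  have hlpos : ∀ i (y : ℝ), |y| ≤ 1 - p.m / 2 → 0 < lam i y := by
    intro i y hy
    exact (hside i).lam_re (by rw [hrn]; exact hy)
  have hGc : ∀ i (y : ℝ), |y| ≤ 1 - p.m / 2 →
      cG p.γ p.ε (hF X i) (p.cX X i) (y : ℂ) = (rG p.γ (cc i) (lam i) y : ℂ) := by
    intro i y hy
    unfold cG rG
    rw [hlc, hccc]
    push_cast
    rw [Complex.ofReal_cpow (hlpos i y hy).le]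
  have hGd : ∀ i k (y : ℝ), |y| ≤ 1 - p.m / 2 →
      |(rG p.γ (cc i) (lam i))^[k] y| ≤ 1 - p.m / 2 ∧
      (cG p.γ p.ε (hF X i) (p.cX X i))^[k] (y : ℂ) = ((rG p.γ (cc i) (lam i))^[k] y : ℂ) := by
    intro i k y hy
    induction k with
    | zero => exact ⟨hy, rfl⟩
    | succ k ih =>
      have h1 : (cG p.γ p.ε (hF X i) (p.cX X i))^[k+1] (y : ℂ) =
        ((rG p.γ (cc i) (lam i))^[k+1] y : ℂ) := by
        rw [iterate_succ_apply', iterate_succ_apply', ih.2, hGc i _ ih.1]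
      refine ⟨?_, h1⟩
      rw [← hrn, ← h1]
      exact (hside i).G_iter_dom (by rw [hrn]; exact hy) _
  have hlamd : ∀ i (y : ℝ), |y| < 2 → HasDerivAt (lam i) (cLamd p.ε (hF X i) y).re y := by
    intro i y hy
    exact ((hside i).hasDerivAt_lam (z := (y : ℂ)) (by rw [hrn]; linarith)).real_of_complex
  have hcdom : ∀ i (y : ℝ), |y| < 3 → |cc (!i) - s * (y - cc i)| ≤ 1 - p.m / 2 ∧
      ‖p.sX X * ((y : ℂ) - p.cX X i)‖ ≤ p.m / 4 := by
    intro i y hy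
    have h1 := (sdom (P.s_lt hb) (hside i).c_le (z := (y : ℂ)) (by rw [hrn]; exact hy)).2.le
    refine ⟨?_, h1⟩
    have h2 := (hside (!i)).dom h1
    rw [hsc, hccc, hccc] at h2
    rw [← hrn]
    push_cast
    exact h2
  have hWc : ∀ i (y : ℝ), |y| < 3 →
      cW p.γ p.ε (hF X (!i)) (p.cX X (!i)) (p.n (!i)) (p.sX X * ((y : ℂ) - p.cX X i)) =
      ((1 - (rG p.γ (cc (!i)) (lam (!i)))^[p.n (!i)] (cc (!i) - s * (y - cc i)) : ℝ) : ℂ) := by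
    intro i y hy
    unfold cW
    have h1 := (hGd (!i) (p.n (!i)) _ (hcdom i y hy).1).2
    push_cast at h1 ⊢
    rw [← h1, hsc, hccc i, hccc (!i)]
  have hα := P.ha
  have hxs : ∀ i, |x i - 1| ≤ p.ε / 480 := by
    intro i
    have := P.x_sub hb i
    rw [hxc, ← Complex.ofReal_one, ← Complex.ofReal_sub, hrn] at this
    exact this
  have hx3 : ∀ i, |x i| < 3 := by
    intro i
    have := P.x_lt hb i
    rw [hxc, hrn] at this
    exact this
  refine ⟨s, cc, x, lam, ⟨P.ha, P.g0, P.g1, P.m0, P.m1, P.e0, P.e1, P.n0, fun i => (hside i).c0, ?_,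
    Real.exp_pos _, ?_, ?_, ?_, ?_, ?_, hxs, ?_, ?_, ?_⟩, ?_⟩
  · intro i
    cases i <;> simp [hcc, cX]
  · rw [← hsn]; exact P.s_lt hb
  · intro i y hy
    have h1 : DifferentiableOn ℂ (cLam p.ε (hF X i)) (Metric.ball 0 3) := fun z hz =>
      ((hside i).hasDerivAt_lam (by simpa using hz)).differentiableAt.differentiableWithinAt
    have h2 : ContDiffAt ℂ 3 (cLam p.ε (hF X i)) (y : ℂ) :=
      (h1.contDiffOn Metric.isOpen_ball).contDiffAt (Metric.isOpen_ball.mem_nhds (by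
        rw [Metric.mem_ball, dist_zero_right, hrn]; linarith))
    exact h2.real_of_complex
  · intro i y hy
    rw [(hlamd i y hy).deriv]
    have h1 := (hside i).lamd_sub (z := (y : ℂ)) (by rw [hrn]; exact hy)
    have h2 := (Complex.abs_re_le_norm _).trans h1
    rw [Complex.sub_re, Complex.neg_re, Complex.one_re] at h2
    rw [show (cLamd p.ε (hF X i) y).re + 1 = -(-(cLamd p.ε (hF X i) y).re - 1) by ring, abs_neg]
    exact h2
  · intro i y hy
    have h1 := (hside i).h_le (z := (y : ℂ)) (by rw [hrn]; exact hy)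
    have h2 : ((lam i y - (1 - y) : ℝ) : ℂ) = p.ε * hF X i y := by
      push_cast; rw [← hlc]; unfold cLam; ring
    rw [← hrn, h2, norm_mul, hrn, abs_of_pos P.e0]
    rw [hrn] at h1
    have := P.e0
    gcongr
  · intro i
    have := P.lam_x hb hT i
    rw [hxc, hlc] at this
    exact_mod_cast this
  · intro i
    have h1 := P.fixW hT i
    have h2 := hWc i (x i) (hx3 i)
    rw [hxc, h2] at h1
    exact_mod_cast h1.symm
  · intro i y hy
    have h1 := P.F_eq hX hb hT i (z := (y : ℂ)) (by rw [hrn]; linarith)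
    unfold FX cF at h1
    rw [hWc i y (by linarith), hlc, hlc] at h1
    have h2 := P.F_zero hX hb hT i
    unfold FX cF at h2
    rw [h2, hBc] at h1
    have h3 : s ^ p.α = Real.exp (-(p.α * B)) := by
      rw [hs, ← Real.exp_mul]; congr 1; ring
    rw [h3]
    exact_mod_cast h1
  · intro i k y hy
    have h1 := (hside i).hasDerivAt_G_iter (z := (y : ℂ)) (by rw [hrn]; exact hy.le) k
    have h2 := h1.real_of_complex
    have h3 : HasDerivAt ((rG p.γ (cc i) (lam i))^[k])
      (Complex.exp (cS p.γ p.ε (hF X i) (p.cX X i) k y)).re y := by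
      refine h2.congr_of_eventuallyEq ?_
      have : ∀ᶠ y' in 𝓝 y, |y'| < 1 - p.m / 2 := continuous_abs.continuousAt.eventually_lt_const hy
      filter_upwards [this] with y' hy'
      rw [(hGd i k y' hy'.le).2, Complex.ofReal_re]
    rw [h3.deriv]
    exact (Complex.abs_re_le_norm _).trans
      ((hside i).exp_S_le (by rw [hrn]; exact hy.le) k)
  · rw [← hsn]; exact P.s_le hb
end Par

theorem cda_deriv {f : ℝ → ℝ} {x : ℝ} (h : ContDiffAt ℝ 3 f x) : ContDiffAt ℝ 2 (deriv f) x :=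
  ContDiffAt.derivWithin h (by norm_num)

theorem cda_deriv2 {f : ℝ → ℝ} {x : ℝ} (h : ContDiffAt ℝ 3 f x) :
    ContDiffAt ℝ 1 (deriv (deriv f)) x :=
  ContDiffAt.derivWithin (cda_deriv h) (by norm_num)

theorem cda_nonlin {f : ℝ → ℝ} {x : ℝ} (h : ContDiffAt ℝ 3 f x) (h' : deriv f x ≠ 0) :
    ContDiffAt ℝ 1 (nonlinearity f) x :=
  (cda_deriv2 h).div ((cda_deriv h).of_le (by norm_num)) h'

theorem nonlin_comp_at {f g : ℝ → ℝ} {x : ℝ} (hf : ContDiffAt ℝ 3 f (g x)) (hg : ContDiffAt ℝ 3 g x)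
    (hf' : deriv f (g x) ≠ 0) (hg' : deriv g x ≠ 0) :
    nonlinearity (f ∘ g) x = nonlinearity f (g x) * deriv g x + nonlinearity g x := by
  have e1 : ∀ᶠ y in 𝓝 x, deriv (f ∘ g) y = deriv f (g y) * deriv g y := by
    have a := hg.eventually (by simp)
    have b := hg.continuousAt.eventually (hf.eventually (by simp))
    filter_upwards [a, b] with y hy1 hy2
    exact deriv_comp y (hy2.differentiableAt (by simp)) (hy1.differentiableAt (by simp))
  have d1 : HasDerivAt (deriv f) (deriv (deriv f) (g x)) (g x) :=
    ((cda_deriv hf).differentiableAt (by simp)).hasDerivAt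
  have d2 : HasDerivAt (deriv g) (deriv (deriv g) x) x :=
    ((cda_deriv hg).differentiableAt (by simp)).hasDerivAt
  have d3 : HasDerivAt g (deriv g x) x := (hg.differentiableAt (by simp)).hasDerivAt
  have e2 : deriv (deriv (f ∘ g)) x = deriv (deriv f) (g x) * deriv g x * deriv g x
      + deriv f (g x) * deriv (deriv g) x := by
    rw [(show deriv (f ∘ g) =ᶠ[𝓝 x] _ from e1).deriv_eq]
    exact ((d1.comp x d3).mul d2).deriv
  unfold nonlinearity
  rw [e2, e1.self_of_nhds]
  field_simp

theorem schwarzian_comp {f g : ℝ → ℝ} {x : ℝ} (hf : ContDiffAt ℝ 3 f (g x))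
    (hg : ContDiffAt ℝ 3 g x)
    (hf' : deriv f (g x) ≠ 0) (hg' : deriv g x ≠ 0) :
    schwarzian (f ∘ g) x = schwarzian f (g x) * deriv g x ^ 2 + schwarzian g x := by
  have e1 : nonlinearity (f ∘ g) =ᶠ[𝓝 x]
      fun y => nonlinearity f (g y) * deriv g y + nonlinearity g y := by
    have a := hg.eventually (by simp)
    have b := hg.continuousAt.eventually (hf.eventually (by simp))
    have c := (cda_deriv hg).continuousAt.eventually_ne hg'
    have d := hg.continuousAt.eventually ((cda_deriv hf).continuousAt.eventually_ne hf')
    filter_upwards [a, b, c, d] with y h1 h2 h3 h4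
    exact nonlin_comp_at h2 h1 h4 h3
  have d1 : HasDerivAt (nonlinearity f) (deriv (nonlinearity f) (g x)) (g x) :=
    ((cda_nonlin hf hf').differentiableAt (by simp)).hasDerivAt
  have d2 : HasDerivAt (nonlinearity g) (deriv (nonlinearity g) x) x :=
    ((cda_nonlin hg hg').differentiableAt (by simp)).hasDerivAt
  have d3 : HasDerivAt g (deriv g x) x := (hg.differentiableAt (by simp)).hasDerivAt
  have d4 : HasDerivAt (deriv g) (deriv (deriv g) x) x :=
    ((cda_deriv hg).differentiableAt (by simp)).hasDerivAt
  have e2 := e1.deriv_eq.trans (((d1.comp x d3).mul d4).add d2).deriv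
  have e3 : deriv (deriv g) x = nonlinearity g x * deriv g x := by
    unfold nonlinearity; field_simp
  unfold schwarzian
  rw [e2, e1.self_of_nhds, e3]
  simp only [Function.comp]
  ring

theorem schwarzian_congr {f g : ℝ → ℝ} {x : ℝ} (h : f =ᶠ[𝓝 x] g) :
    schwarzian f x = schwarzian g x := by
  have h1 := h.deriv
  have h2 := h1.deriv
  have h3 : nonlinearity f =ᶠ[𝓝 x] nonlinearity g := by
    filter_upwards [h1, h2] with y a b
    unfold nonlinearity; rw [a, b]
  unfold schwarzian
  rw [h3.deriv_eq, h3.self_of_nhds]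

theorem schwarzian_affine (p q : ℝ) (x : ℝ) : schwarzian (fun y => p + q * y) x = 0 := by
  have h1 : deriv (fun y : ℝ => p + q * y) = fun _ => q := by
    funext y; simp
  have : nonlinearity (fun y => p + q * y) = fun _ => 0 := by
    funext y; unfold nonlinearity; rw [h1]; simp
  unfold schwarzian; rw [this]; simp

theorem schwarzian_affine_comp {f : ℝ → ℝ} {x : ℝ} (p q : ℝ) (hq : q ≠ 0) (hf : ContDiffAt ℝ 3 f x)
    (hf' : deriv f x ≠ 0) : schwarzian (fun y => p + q * f y) x = schwarzian f x := by
  have := schwarzian_comp (f := fun y => p + q * y) (g := f) (x := x)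
    (by fun_prop) hf (by simp [hq]) hf'
  rw [schwarzian_affine] at this
  simpa [Function.comp_def] using this

theorem schwarzian_comp_affine {f : ℝ → ℝ} {x : ℝ} (p q : ℝ) (hq : q ≠ 0)
    (hf : ContDiffAt ℝ 3 f (p + q * x))
    (hf' : deriv f (p + q * x) ≠ 0) :
    schwarzian (fun y => f (p + q * y)) x = schwarzian f (p + q * x) * q ^ 2 := by
  have := schwarzian_comp (f := f) (g := fun y => p + q * y) (x := x) hf
    (by fun_prop) hf' (by simp [hq])
  rw [schwarzian_affine] at this
  simpa [Function.comp_def] using this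

theorem schwarzian_rpow {γ t : ℝ} (h0 : 0 < γ) (h1 : γ < 1) (ht : 0 < t) :
    0 ≤ schwarzian (fun y => y ^ γ) t := by
  have a1 : ∀ y : ℝ, 0 < y → deriv (fun y : ℝ => y ^ γ) y = γ * y ^ (γ - 1) := fun y hy =>
    (Real.hasDerivAt_rpow_const (Or.inl hy.ne')).deriv
  have a2 : ∀ y : ℝ, 0 < y → nonlinearity (fun y : ℝ => y ^ γ) y = (γ - 1) * y⁻¹ := by
    intro y hy
    have : deriv (fun y : ℝ => y ^ γ) =ᶠ[𝓝 y] fun y => γ * y ^ (γ - 1) := by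
      filter_upwards [lt_mem_nhds hy] with z hz using a1 z hz
    unfold nonlinearity
    rw [this.deriv_eq, a1 y hy,
      ((Real.hasDerivAt_rpow_const (p := γ - 1) (Or.inl hy.ne')).const_mul γ).deriv,
      Real.rpow_sub_one hy.ne' (γ - 1)]
    have : y ^ (γ - 1) ≠ 0 := (Real.rpow_pos_of_pos hy _).ne'
    field_simp
  have a3 : nonlinearity (fun y : ℝ => y ^ γ) =ᶠ[𝓝 t] fun y => (γ - 1) * y⁻¹ := by
    filter_upwards [lt_mem_nhds ht] with z hz using a2 z hz
  unfold schwarzian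
  rw [a3.deriv_eq, a2 t ht, ((hasDerivAt_inv ht.ne').const_mul (γ - 1)).deriv]
  have : (γ - 1) * -(t ^ 2)⁻¹ - ((γ - 1) * t⁻¹) ^ 2 / 2 = (1 - γ) * (1 + γ) / (2 * t ^ 2) := by
    field_simp; ring
  rw [this]
  have : 0 < 1 - γ := by linarith
  positivity

theorem schwarzian_cont {f : ℝ → ℝ} {x : ℝ} (h : ContDiffAt ℝ 3 f x) (h' : deriv f x ≠ 0) :
    ContinuousAt (schwarzian f) x := by
  have h1 := cda_nonlin h h'
  have h2 : ContDiffAt ℝ 0 (deriv (nonlinearity f)) x := ContDiffAt.derivWithin h1 (by norm_num)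
  exact h2.continuousAt.sub ((h1.continuousAt.pow 2).div_const 2)

namespace Core
variable {α γ ε m s : ℝ} {n : Bool → ℕ} {cc x : Bool → ℝ} {lam : Bool → ℝ → ℝ}

theorem cc1 (K : Core α γ ε m s n cc x lam) (i : Bool) : cc i ≤ 1 - 3 * m / 4 := by
  have := K.cc0 (!i); rw [K.ccs] at this; linarith

theorem lam_lo (K : Core α γ ε m s n cc x lam) (i : Bool) {y : ℝ} (h0 : 0 ≤ y) (h1 : y < 3) :
    1 - (1 + ε) * y ≤ lam i y := by
  have := K.near i y (by rw [abs_of_nonneg h0]; exact h1)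
  rw [abs_of_nonneg h0] at this
  have := (abs_le.1 this).1
  nlinarith

theorem lam_hi (K : Core α γ ε m s n cc x lam) (i : Bool) {y : ℝ} (h0 : 0 ≤ y) (h1 : y < 3) :
    lam i y ≤ 1 - (1 - ε) * y := by
  have := K.near i y (by rw [abs_of_nonneg h0]; exact h1)
  rw [abs_of_nonneg h0] at this
  have := (abs_le.1 this).2
  nlinarith

theorem lam_pos (K : Core α γ ε m s n cc x lam) (i : Bool) {y : ℝ} (h0 : 0 ≤ y) (h1 : y ≤ 1 - m / 2) :
    0 < lam i y := by
  have := K.lam_lo i h0 (by linarith [K.m0])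
  have a := K.m0; have b := K.m1; have c := K.e1; have d := K.e0
  nlinarith

theorem lam_le (K : Core α γ ε m s n cc x lam) (i : Bool) {y : ℝ} (h0 : 0 ≤ y) (h1 : y ≤ 2) :
    lam i y ≤ 1 := by
  have := K.lam_hi i h0 (by linarith [K.m0])
  have a := K.m0; have b := K.m1; have c := K.e1; have d := K.e0
  nlinarith

theorem lam_der_neg (K : Core α γ ε m s n cc x lam) (i : Bool) {y : ℝ} (h : |y| < 2) :
    deriv (lam i) y < 0 := by
  have := (abs_le.1 (K.der i y h)).2
  have a := K.m0; have b := K.m1; have c := K.e1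
  linarith

/-- The inverse branch. -/
abbrev G (_ : Core α γ ε m s n cc x lam) (i : Bool) : ℝ → ℝ := rG γ (cc i) (lam i)

theorem G_nonneg (K : Core α γ ε m s n cc x lam) (i : Bool) {y : ℝ} (h0 : 0 ≤ y)
    (h1 : y ≤ 1 - m / 2) : 0 ≤ K.G i y := by
  have h := K.lam_pos i h0 h1
  have h' := K.lam_le i h0 (by linarith [K.m0])
  have : lam i y ^ γ ≤ 1 := Real.rpow_le_one h.le h' K.g0.le
  have := K.cc0 i; have := K.m0
  unfold G rG
  apply mul_nonneg <;> linarith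

theorem G_le (K : Core α γ ε m s n cc x lam) (i : Bool) {y : ℝ} (h0 : 0 ≤ y)
    (h1 : y ≤ 1 - m / 2) : K.G i y ≤ (1 - m / 2) * y := by
  have h := K.lam_pos i h0 h1
  have h' := K.lam_le i h0 (by linarith [K.m0])
  have h2 := K.lam_lo i h0 (by linarith [K.m0])
  have h3 : lam i y ≤ lam i y ^ γ := by
    have := Real.rpow_le_rpow_of_exponent_ge h h' K.g1.le
    simpa using this
  have a := K.cc0 i; have b := K.m0; have c := K.cc1 i; have d := K.e1; have e := K.e0
  have f := K.m1
  unfold G rG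
  calc cc i * (1 - lam i y ^ γ) ≤ (1 - 3 * m / 4) * ((1 + ε) * y) := by
        apply mul_le_mul c (by linarith) (by linarith [Real.rpow_le_one h.le h' K.g0.le]) (by linarith)
    _ = ((1 - 3 * m / 4) * (1 + ε)) * y := by ring
    _ ≤ _ := by
        apply mul_le_mul_of_nonneg_right _ h0
        nlinarith

theorem G_mem (K : Core α γ ε m s n cc x lam) (i : Bool) (k : ℕ) {y : ℝ} (h0 : 0 ≤ y)
    (h1 : y ≤ 1 - m / 2) : 0 ≤ (K.G i)^[k] y ∧ (K.G i)^[k] y ≤ y := by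
  induction k with
  | zero => simp [h0]
  | succ k ih =>
    rw [Function.iterate_succ_apply']
    refine ⟨K.G_nonneg i ih.1 (by linarith), (K.G_le i ih.1 (by linarith)).trans ?_⟩
    have := K.m0
    nlinarith

theorem G_smooth (K : Core α γ ε m s n cc x lam) (i : Bool) {y : ℝ} (h0 : 0 ≤ y)
    (h1 : y ≤ 1 - m / 2) : ContDiffAt ℝ 3 (K.G i) y := by
  have h := K.lam_pos i h0 h1
  have h2 := K.smooth i y (by rw [abs_of_nonneg h0]; linarith [K.m0])
  exact contDiffAt_const.mul (contDiffAt_const.sub (h2.rpow_const_of_ne h.ne'))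

theorem G_der_pos (K : Core α γ ε m s n cc x lam) (i : Bool) {y : ℝ} (h0 : 0 ≤ y)
    (h1 : y ≤ 1 - m / 2) : 0 < deriv (K.G i) y := by
  have h := K.lam_pos i h0 h1
  have hy : |y| < 2 := by rw [abs_of_nonneg h0]; linarith [K.m0]
  have h2 := ((K.smooth i y hy).differentiableAt (by simp)).hasDerivAt
  have h3 := ((h2.rpow_const (p := γ) (Or.inl h.ne')).const_sub 1).const_mul (cc i)
  have h4 : HasDerivAt (K.G i) (cc i * -(deriv (lam i) y * γ * lam i y ^ (γ - 1))) y := h3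
  rw [h4.deriv]
  have := K.lam_der_neg i hy
  have := K.cc0 i; have := K.m0; have := K.g0
  have h5 : 0 < lam i y ^ (γ - 1) := Real.rpow_pos_of_pos h _
  apply mul_pos (by linarith)
  nlinarith [mul_pos (mul_pos (neg_pos.2 ‹deriv (lam i) y < 0›) K.g0) h5]

theorem G_iter (K : Core α γ ε m s n cc x lam) (i : Bool) (k : ℕ) {y : ℝ} (h0 : 0 ≤ y)
    (h1 : y ≤ 1 - m / 2) : ContDiffAt ℝ 3 (K.G i)^[k] y ∧ 0 < deriv (K.G i)^[k] y := by
  induction k with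
  | zero => simp [contDiffAt_id]
  | succ k ih =>
    have hm := K.G_mem i k h0 h1
    have hs := K.G_smooth i hm.1 (by linarith)
    have hd := K.G_der_pos i hm.1 (by linarith)
    rw [Function.iterate_succ']
    refine ⟨hs.comp y ih.1, ?_⟩
    rw [deriv_comp y (hs.differentiableAt (by simp)) (ih.1.differentiableAt (by simp))]
    exact mul_pos hd ih.2

theorem G_schw (K : Core α γ ε m s n cc x lam) (i : Bool) {μ y : ℝ} (h0 : 0 ≤ y)
    (h1 : y ≤ 1 - m / 2) (hμ : -μ ≤ schwarzian (lam i) y) : -μ ≤ schwarzian (K.G i) y := by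
  have h := K.lam_pos i h0 h1
  have hy : |y| < 2 := by rw [abs_of_nonneg h0]; linarith [K.m0]
  have hc : cc i ≠ 0 := by have := K.cc0 i; have := K.m0; linarith
  have s1 := K.smooth i y hy
  have s2 : ContDiffAt ℝ 3 (fun t : ℝ => t ^ γ) (lam i y) := contDiffAt_id.rpow_const_of_ne h.ne'
  have d2 : deriv (fun t : ℝ => t ^ γ) (lam i y) ≠ 0 := by
    rw [(Real.hasDerivAt_rpow_const (Or.inl h.ne')).deriv]
    exact mul_ne_zero K.g0.ne' (Real.rpow_pos_of_pos h _).ne'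
  have d1 := (K.lam_der_neg i hy).ne
  have e := schwarzian_comp (x := y) s2 s1 d2 d1
  have s3 : ContDiffAt ℝ 3 ((fun t : ℝ => t ^ γ) ∘ lam i) y := s2.comp y s1
  have d3 : deriv ((fun t : ℝ => t ^ γ) ∘ lam i) y ≠ 0 := by
    rw [deriv_comp y (s2.differentiableAt (by simp)) (s1.differentiableAt (by simp))]
    exact mul_ne_zero d2 d1
  have e2 := schwarzian_affine_comp (cc i) (-cc i) (neg_ne_zero.2 hc) s3 d3
  have e3 : (fun t => cc i + -cc i * ((fun t : ℝ => t ^ γ) ∘ lam i) t) = K.G i := by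
    funext t; unfold G rG; simp only [Function.comp]; ring
  rw [e3] at e2
  rw [e2, e]
  have := schwarzian_rpow K.g0 K.g1 h
  have := mul_nonneg this (sq_nonneg (deriv (lam i) y))
  linarith

theorem G_iter_schw (K : Core α γ ε m s n cc x lam) (i : Bool) {μ : ℝ} (hμ0 : 0 ≤ μ)
    (hμ : ∀ y ∈ Icc (0:ℝ) 1, -μ ≤ schwarzian (lam i) y) (k : ℕ) {y : ℝ} (h0 : 0 ≤ y)
    (h1 : y < 1 - m / 2) :
    -(k * μ * Real.exp (4 / m ^ 2) ^ 2) ≤ schwarzian (K.G i)^[k] y := by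
  induction k with
  | zero =>
    have := schwarzian_affine 0 1 y
    have e : (fun y : ℝ => 0 + 1 * y) = id := by funext t; simp
    rw [e] at this
    simp [this]
  | succ k ih =>
    have hm := K.G_mem i k h0 h1.le
    have hs := K.G_smooth i hm.1 (by linarith)
    have hd := K.G_der_pos i hm.1 (by linarith)
    have hi := K.G_iter i k h0 h1.le
    rw [Function.iterate_succ', schwarzian_comp hs hi.1 hd.ne' hi.2.ne']
    have a := K.G_schw i hm.1 (by linarith) (hμ _ ⟨hm.1, by linarith [K.m0]⟩)
    have b := K.dG i k y (by rw [abs_of_nonneg h0]; exact h1)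
    have c : deriv (K.G i)^[k] y ^ 2 ≤ Real.exp (4 / m ^ 2) ^ 2 := sq_le_sq' (abs_le.1 b).1 (abs_le.1 b).2
    have d := mul_le_mul_of_nonneg_right a (sq_nonneg (deriv (K.G i)^[k] y))
    have e := mul_le_mul_of_nonneg_left c hμ0
    push_cast
    linarith

theorem q_mem (K : Core α γ ε m s n cc x lam) (i : Bool) {y : ℝ} (hy : y ∈ Icc (0:ℝ) (3 / 2)) :
    0 ≤ cc (!i) - s * (y - cc i) ∧ cc (!i) - s * (y - cc i) < 1 - m / 2 := by
  have a := K.cc0 i; have b := K.cc0 (!i); have c := K.cc1 i; have d := K.cc1 (!i)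
  have e := K.s0; have f := K.s1; have g := K.m0
  have h1 : s * (y - cc i) ≤ s * 2 := mul_le_mul_of_nonneg_left (by linarith [hy.2]) e.le
  have h2 : s * (-1) ≤ s * (y - cc i) := mul_le_mul_of_nonneg_left (by linarith [hy.1]) e.le
  constructor <;> linarith

theorem lam_schw_step (K : Core α γ ε m s n cc x lam) {μ : ℝ} (hμ0 : 0 ≤ μ)
    (hμ : ∀ i, ∀ y ∈ Icc (0:ℝ) 1, -μ ≤ schwarzian (lam i) y) (i : Bool) {y : ℝ}
    (hy : y ∈ Icc (0:ℝ) 1) :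
    -(s ^ 2 * Real.exp (4 / m ^ 2) ^ 2 * (n (!i) + 1) * μ) ≤ schwarzian (lam i) y := by
  have hs := K.s0
  have hq := K.q_mem i ⟨hy.1, by linarith [hy.2]⟩
  set E := Real.exp (4 / m ^ 2) with hE
  set g := (K.G (!i))^[n (!i)] with hg
  set q : ℝ → ℝ := fun y => (cc (!i) + s * cc i) + (-s) * y with hqd
  have hqy : q y = cc (!i) - s * (y - cc i) := by simp only [hqd]; ring
  have hq0 : 0 ≤ q y := by rw [hqy]; exact hq.1
  have hq1 : q y < 1 - m / 2 := by rw [hqy]; exact hq.2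
  have gi := K.G_iter (!i) (n (!i)) hq0 hq1.le
  have gm := K.G_mem (!i) (n (!i)) hq0 hq1.le
  have gd := K.dG (!i) (n (!i)) (q y) (by rw [abs_of_nonneg hq0]; exact hq1)
  have gS := K.G_iter_schw (!i) hμ0 (hμ _) (n (!i)) hq0 hq1
  rw [← hE] at gd gS
  change ContDiffAt ℝ 3 g (q y) ∧ 0 < deriv g (q y) at gi
  change 0 ≤ g (q y) ∧ g (q y) ≤ q y at gm
  change |deriv g (q y)| ≤ E at gd
  change _ ≤ schwarzian g (q y) at gS
  have s1 := schwarzian_comp_affine (f := g) (x := y) (cc (!i) + s * cc i) (-s)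
    (neg_ne_zero.2 hs.ne') gi.1 gi.2.ne'
  have c1 : ContDiffAt ℝ 3 (fun y => g (q y)) y := gi.1.comp y (by fun_prop)
  have d1 : HasDerivAt (fun y => g (q y)) (deriv g (q y) * -s) y := by
    have : HasDerivAt q (-s) y := by
      have h := ((hasDerivAt_id y).const_mul (-s)).const_add (cc (!i) + s * cc i)
      rw [mul_one] at h
      exact h
    exact ((gi.1.differentiableAt (by simp)).hasDerivAt).comp y this
  have n1 : deriv (fun y => g (q y)) y ≠ 0 := by
    rw [d1.deriv]; exact mul_ne_zero gi.2.ne' (neg_ne_zero.2 hs.ne')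
  set Q : ℝ → ℝ := fun y => 1 + (-1) * g (q y) with hQ
  have s2 : schwarzian Q y = schwarzian (fun y => g (q y)) y :=
    schwarzian_affine_comp 1 (-1) (by norm_num) c1 n1
  have c2 : ContDiffAt ℝ 3 Q y := contDiffAt_const.add (contDiffAt_const.mul c1)
  have d2 : HasDerivAt Q (-1 * (deriv g (q y) * -s)) y := (d1.const_mul (-1)).const_add 1
  have n2 : deriv Q y ≠ 0 := by
    rw [d2.deriv]
    exact mul_ne_zero (by norm_num) (mul_ne_zero gi.2.ne' (neg_ne_zero.2 hs.ne'))
  have hQm : Q y ∈ Icc (0:ℝ) 1 := by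
    simp only [hQ]; constructor <;> linarith [K.m0]
  have hQ2 : |Q y| < 2 := by rw [abs_of_nonneg hQm.1]; linarith [hQm.2]
  have hy2 : |y| < 2 := by rw [abs_of_nonneg hy.1]; linarith [hy.2]
  have c3 := K.smooth i _ hQ2
  have n3 := (K.lam_der_neg i hQ2).ne
  have s3 := schwarzian_comp (x := y) c3 c2 n3 n2
  have n4 := (K.lam_der_neg i hy2).ne
  have s4 := schwarzian_affine_comp (x := y) 0 (s ^ α) (Real.rpow_pos_of_pos hs _).ne'
    (K.smooth i y hy2) n4
  have ev : (lam i ∘ Q) =ᶠ[𝓝 y] fun y => 0 + s ^ α * lam i y := by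
    have : ∀ᶠ z in 𝓝 y, |z| < 2 := (continuous_abs.tendsto y).eventually (gt_mem_nhds hy2)
    filter_upwards [this] with z hz
    have := K.func i z hz
    simp only [Function.comp, hQ, hqd, hg, zero_add]
    rw [← this]
    congr 1
    rw [show cc (!i) - s * (z - cc i) = (cc (!i) + s * cc i) + (-s) * z by ring]
    unfold G; ring
  rw [← s4, ← schwarzian_congr ev, s3, s2]
  change schwarzian (fun y => g (q y)) y = schwarzian g (q y) * (-s) ^ 2 at s1
  rw [s1, d2.deriv]
  have b1 : (-1 * (deriv g (q y) * -s)) ^ 2 ≤ s ^ 2 * E ^ 2 := by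
    have : deriv g (q y) ^ 2 ≤ E ^ 2 := sq_le_sq' (abs_le.1 gd).1 (abs_le.1 gd).2
    nlinarith [sq_nonneg s]
  have b2 := hμ i _ hQm
  have b3 := mul_le_mul_of_nonneg_right b2 (sq_nonneg (-1 * (deriv g (q y) * -s)))
  have b4 := mul_le_mul_of_nonneg_left b1 hμ0
  have b5 := mul_le_mul_of_nonneg_right gS (sq_nonneg s)
  nlinarith

theorem lam_schw (K : Core α γ ε m s n cc x lam)
    (hk : ∀ i, s ^ 2 * Real.exp (4 / m ^ 2) ^ 2 * (n i + 1) < 1) (i : Bool) {y : ℝ}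
    (hy : y ∈ Icc (0:ℝ) 1) : 0 ≤ schwarzian (lam i) y := by
  have hc : ∀ i, ContinuousOn (schwarzian (lam i)) (Icc (0:ℝ) 1) := by
    intro i z hz
    have hz2 : |z| < 2 := by rw [abs_of_nonneg hz.1]; linarith [hz.2]
    exact (schwarzian_cont (K.smooth i z hz2) (K.lam_der_neg i hz2).ne).continuousWithinAt
  have hex : ∀ i, ∃ z ∈ Icc (0:ℝ) 1, ∀ w ∈ Icc (0:ℝ) 1, schwarzian (lam i) z ≤ schwarzian (lam i) w := by
    intro i
    obtain ⟨z, hz, h⟩ := isCompact_Icc.exists_isMinOn (nonempty_Icc.2 zero_le_one) (hc i)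
    exact ⟨z, hz, fun w hw => h hw⟩
  choose z hz hmin using hex
  obtain ⟨j, hj⟩ : ∃ j, ∀ i, schwarzian (lam j) (z j) ≤ schwarzian (lam i) (z i) := by
    obtain ⟨j, -, hj⟩ := Finset.exists_min_image Finset.univ (fun j => schwarzian (lam j) (z j))
      Finset.univ_nonempty
    exact ⟨j, fun i => hj i (Finset.mem_univ i)⟩
  by_contra hneg
  push Not at hneg
  have hneg' : schwarzian (lam j) (z j) < 0 := ((hj i).trans (hmin i y hy)).trans_lt hneg
  have := K.lam_schw_step (μ := -schwarzian (lam j) (z j)) (by linarith)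
    (fun i w hw => by have := (hj i).trans (hmin i w hw); linarith) j (hz j)
  have h2 := mul_lt_mul_of_pos_right (hk (!j)) (neg_pos.2 hneg')
  linarith

end Core

/-- A convenient strengthening of `IsSDiffeo`. -/
structure SD (φ : ℝ → ℝ) : Prop where
  sm : ∀ t ∈ Icc (0:ℝ) 1, ContDiffAt ℝ 3 φ t
  fix0 : φ 0 = 0
  fix1 : φ 1 = 1
  derivPos : ∀ x ∈ Icc (0:ℝ) 1, 0 < deriv φ x
  schwNonpos : ∀ x ∈ Icc (0:ℝ) 1, schwarzian φ x ≤ 0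

theorem SD.isSDiffeo {φ : ℝ → ℝ} (h : SD φ) : IsSDiffeo φ :=
  ⟨fun t ht => (h.sm t ht).contDiffWithinAt, h.fix0, h.fix1, h.derivPos, h.schwNonpos⟩

theorem SD.refl {φ : ℝ → ℝ} (h : SD φ) : SD (fun y => 1 + (-1) * φ (1 + (-1) * y)) := by
  have key : ∀ t ∈ Icc (0:ℝ) 1, 1 + (-1) * t ∈ Icc (0:ℝ) 1 := by
    intro t ht; constructor <;> linarith [ht.1, ht.2]
  have sm : ∀ t ∈ Icc (0:ℝ) 1, ContDiffAt ℝ 3 (fun y => φ (1 + (-1) * y)) t := by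
    intro t ht
    exact (h.sm _ (key t ht)).comp t (by fun_prop)
  have hd : ∀ t ∈ Icc (0:ℝ) 1,
      HasDerivAt (fun y => φ (1 + (-1) * y)) (deriv φ (1 + (-1) * t) * (-1)) t := by
    intro t ht
    have e : HasDerivAt (fun y : ℝ => 1 + (-1) * y) (-1) t := by
      have h := ((hasDerivAt_id t).const_mul (-1)).const_add 1
      rw [mul_one] at h
      exact h
    exact (((h.sm _ (key t ht)).differentiableAt (by simp)).hasDerivAt).comp t e
  refine ⟨fun t ht => contDiffAt_const.add (contDiffAt_const.mul (sm t ht)), ?_, ?_, ?_, ?_⟩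
  · simp [h.fix1]
  · simp [h.fix0]
  · intro t ht
    rw [(((hd t ht).const_mul (-1)).const_add 1).deriv]
    have := h.derivPos _ (key t ht)
    linarith
  · intro t ht
    have p := h.derivPos _ (key t ht)
    rw [schwarzian_affine_comp 1 (-1) (by norm_num) (sm t ht)
      (by rw [(hd t ht).deriv]; intro h0; linarith),
      schwarzian_comp_affine 1 (-1) (by norm_num) (h.sm _ (key t ht)) p.ne']
    have := h.schwNonpos _ (key t ht)
    linarith

/-- Local inverse facts. -/
theorem inv_facts {Φ : ℝ → ℝ} {U : Set ℝ} (hU : IsOpen U) (hinj : InjOn Φ U) {x : ℝ} (hx : x ∈ U)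
    (hs : ContDiffAt ℝ 3 Φ x) (hd : deriv Φ x ≠ 0) :
    invFunOn Φ U (Φ x) = x ∧ ContDiffAt ℝ 3 (invFunOn Φ U) (Φ x) ∧
    deriv (invFunOn Φ U) (Φ x) = (deriv Φ x)⁻¹ ∧
    schwarzian (invFunOn Φ U) (Φ x) * deriv Φ x ^ 2 = - schwarzian Φ x := by
  have h0 : ∀ z ∈ U, invFunOn Φ U (Φ z) = z := fun z hz => hinj.leftInvOn_invFunOn hz
  have hsd : HasStrictDerivAt Φ (deriv Φ x) x := hs.hasStrictDerivAt (by simp)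
  have hsf := hsd.hasStrictFDerivAt_equiv hd
  have hloc := hs.to_localInverse hsf.hasFDerivAt (by simp)
  set g := hs.localInverse hsf.hasFDerivAt (by simp) with hg
  have hgx : g (Φ x) = x := hs.localInverse_apply_image hsf.hasFDerivAt (by simp)
  have hright : ∀ᶠ y in 𝓝 (Φ x), Φ (g y) = y :=
    (hs.hasStrictFDerivAt' hsf.hasFDerivAt (by simp)).eventually_right_inverse
  have hev : invFunOn Φ U =ᶠ[𝓝 (Φ x)] g := by
    have : ∀ᶠ y in 𝓝 (Φ x), g y ∈ U :=
      hloc.continuousAt.eventually (by rw [hgx]; exact hU.mem_nhds hx)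
    filter_upwards [this, hright] with y h1 h2
    rw [← h0 _ h1, h2]
  have hc : ContDiffAt ℝ 3 (invFunOn Φ U) (Φ x) := hloc.congr_of_eventuallyEq hev
  have hev2 : (invFunOn Φ U ∘ Φ) =ᶠ[𝓝 x] id := by
    filter_upwards [hU.mem_nhds hx] with z hz using h0 z hz
  have hder : deriv (invFunOn Φ U) (Φ x) * deriv Φ x = 1 := by
    rw [← deriv_comp x (hc.differentiableAt (by simp)) (hs.differentiableAt (by simp)),
      hev2.deriv_eq]; simp
  have hdne : deriv (invFunOn Φ U) (Φ x) ≠ 0 := left_ne_zero_of_mul_eq_one hder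
  refine ⟨h0 x hx, hc, eq_inv_of_mul_eq_one_left hder, ?_⟩
  have := schwarzian_comp hc hs hdne hd
  rw [schwarzian_congr hev2] at this
  have e := schwarzian_affine 0 1 x
  have e1 : (fun y : ℝ => 0 + 1 * y) = id := by funext t; simp
  rw [e1] at e
  linarith

namespace Core
variable {α γ ε m s : ℝ} {n : Bool → ℕ} {cc x : Bool → ℝ} {lam : Bool → ℝ → ℝ}

theorem lam_anti (K : Core α γ ε m s n cc x lam) (i : Bool) : StrictAntiOn (lam i) (Ioo (-2) 2) := by
  apply strictAntiOn_of_deriv_neg (convex_Ioo _ _)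
  · intro y hy
    exact (K.smooth i y (abs_lt.2 hy)).continuousAt.continuousWithinAt
  · intro y hy
    rw [interior_Ioo] at hy
    exact K.lam_der_neg i (abs_lt.2 hy)

theorem lam_zero (K : Core α γ ε m s n cc x lam) (i : Bool) : lam i 0 = 1 := by
  have := K.near i 0 (by norm_num)
  simp only [abs_zero, mul_zero, sub_zero] at this
  have := abs_eq_zero.1 (le_antisymm this (abs_nonneg _))
  linarith

theorem x_lo (K : Core α γ ε m s n cc x lam) (i : Bool) : 1 - m / 2 < x i := by
  have := (abs_le.1 (K.xsub i)).1
  have := K.m0; have := K.e1; linarith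

theorem x_le (K : Core α γ ε m s n cc x lam) (i : Bool) : x i ≤ 1 := by
  have h1 := K.x_lo i
  have h2 := (abs_le.1 (K.xsub i)).2
  have := K.m0; have := K.e1; have := K.m1
  have hq := K.q_mem i (y := x i) ⟨by linarith, by linarith⟩
  have := (K.G_mem (!i) (n (!i)) hq.1 hq.2.le).1
  have hf := K.fix i
  change x i = 1 - (K.G (!i))^[n (!i)] (cc (!i) - s * (x i - cc i)) at hf
  linarith

theorem x_pos (K : Core α γ ε m s n cc x lam) (i : Bool) : 0 < x i := by
  have := K.x_lo i; have := K.m1; linarith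

theorem lam_nonneg (K : Core α γ ε m s n cc x lam) (i : Bool) {y : ℝ} (hy : y ∈ Icc 0 (x i)) :
    0 ≤ lam i y := by
  rw [← K.zero i]
  have := K.x_le i
  exact (K.lam_anti i).antitoneOn ⟨by linarith [hy.1], by linarith [hy.2]⟩
    ⟨by linarith [K.x_pos i], by linarith⟩ hy.2

theorem lam_one (K : Core α γ ε m s n cc x lam) (i : Bool) : lam i 1 ≤ 0 := by
  rw [← K.zero i]
  have := K.x_le i
  exact (K.lam_anti i).antitoneOn ⟨by linarith [K.x_pos i], by linarith⟩
    ⟨by norm_num, by norm_num⟩ this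

/-- Critical value parameter. -/
def u (_ : Core α γ ε m s n cc x lam) (i : Bool) : ℝ := 1 / (1 - lam i 1)

/-- The inverse of the diffeomorphic part. -/
def Ph (K : Core α γ ε m s n cc x lam) (i : Bool) : ℝ → ℝ := fun y => K.u i + (-K.u i) * lam i y

/-- The diffeomorphic part. -/
def ph (K : Core α γ ε m s n cc x lam) (i : Bool) : ℝ → ℝ := invFunOn (K.Ph i) (Ioo (-2) 2)

theorem u_pos (K : Core α γ ε m s n cc x lam) (i : Bool) : 0 < K.u i := by
  have := K.lam_one i
  unfold u; apply div_pos <;> linarith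

theorem u_le (K : Core α γ ε m s n cc x lam) (i : Bool) : K.u i ≤ 1 := by
  have := K.lam_one i
  unfold u; rw [div_le_one] <;> linarith

theorem Ph_inj (K : Core α γ ε m s n cc x lam) (i : Bool) : InjOn (K.Ph i) (Ioo (-2) 2) := by
  intro y hy z hz h
  apply (K.lam_anti i).injOn hy hz
  have := K.u_pos i
  unfold Ph at h
  have h2 : K.u i * lam i y = K.u i * lam i z := by linarith
  exact mul_left_cancel₀ this.ne' h2

theorem Ph_smooth (K : Core α γ ε m s n cc x lam) (i : Bool) {y : ℝ} (hy : |y| < 2) :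
    ContDiffAt ℝ 3 (K.Ph i) y :=
  contDiffAt_const.add (contDiffAt_const.mul (K.smooth i y hy))

theorem Ph_deriv (K : Core α γ ε m s n cc x lam) (i : Bool) {y : ℝ} (hy : |y| < 2) :
    0 < deriv (K.Ph i) y := by
  have h := (((K.smooth i y hy).differentiableAt (by simp)).hasDerivAt.const_mul
    (-K.u i)).const_add (K.u i)
  have e : HasDerivAt (K.Ph i) (-K.u i * deriv (lam i) y) y := h
  rw [e.deriv]
  have := K.u_pos i; have := K.lam_der_neg i hy
  nlinarith

theorem ph_Ph (K : Core α γ ε m s n cc x lam) (i : Bool) {y : ℝ} (hy : |y| < 2) :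
    K.ph i (K.Ph i y) = y :=
  (K.Ph_inj i).leftInvOn_invFunOn (abs_lt.1 hy)

theorem Ph0 (K : Core α γ ε m s n cc x lam) (i : Bool) : K.Ph i 0 = 0 := by
  unfold Ph; rw [K.lam_zero]; ring

theorem Ph1 (K : Core α γ ε m s n cc x lam) (i : Bool) : K.Ph i 1 = 1 := by
  have : 1 - lam i 1 ≠ 0 := by linarith [K.lam_one i]
  unfold Ph u; field_simp; ring

theorem ph_SD (K : Core α γ ε m s n cc x lam)
    (hk : ∀ i, s ^ 2 * Real.exp (4 / m ^ 2) ^ 2 * (n i + 1) < 1) (i : Bool) : SD (K.ph i) := by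
  have hsurj : ∀ t ∈ Icc (0:ℝ) 1, ∃ y ∈ Icc (0:ℝ) 1, K.Ph i y = t := by
    intro t ht
    have hc : ContinuousOn (K.Ph i) (Icc 0 1) := by
      intro y hy
      exact (K.Ph_smooth i (y := y) (by rw [abs_of_nonneg hy.1]; linarith [hy.2])).continuousAt.continuousWithinAt
    have := intermediate_value_Icc (zero_le_one) hc
    rw [K.Ph0, K.Ph1] at this
    exact this ht
  have key : ∀ y ∈ Icc (0:ℝ) 1, |y| < 2 := by
    intro y hy; rw [abs_of_nonneg hy.1]; linarith [hy.2]
  have facts : ∀ y ∈ Icc (0:ℝ) 1, _ := fun y hy =>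
    inv_facts isOpen_Ioo (K.Ph_inj i) (abs_lt.1 (key y hy)) (K.Ph_smooth i (key y hy))
      (K.Ph_deriv i (key y hy)).ne'
  refine ⟨?_, ?_, ?_, ?_, ?_⟩
  · intro t ht
    obtain ⟨y, hy, rfl⟩ := hsurj t ht
    exact (facts y hy).2.1
  · have := K.ph_Ph i (y := 0) (by norm_num)
    rwa [K.Ph0] at this
  · have := K.ph_Ph i (y := 1) (by norm_num)
    rwa [K.Ph1] at this
  · intro t ht
    obtain ⟨y, hy, rfl⟩ := hsurj t ht
    have := (facts y hy).2.2.1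
    unfold ph
    rw [this]
    exact inv_pos.2 (K.Ph_deriv i (key y hy))
  · intro t ht
    obtain ⟨y, hy, rfl⟩ := hsurj t ht
    have h := (facts y hy).2.2.2
    have e : schwarzian (K.Ph i) y = schwarzian (lam i) y :=
      schwarzian_affine_comp (K.u i) (-K.u i) (neg_ne_zero.2 (K.u_pos i).ne')
        (K.smooth i y (key y hy)) (K.lam_der_neg i (key y hy)).ne
    have p := K.lam_schw hk i hy
    rw [e] at h
    have d := K.Ph_deriv i (key y hy)
    unfold ph
    by_contra hc
    push Not at hc
    have := mul_pos hc (pow_pos d 2)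
    linarith

/-- The left branch in the coordinate `i`. -/
def F (K : Core α γ ε m s n cc x lam) (i : Bool) : ℝ → ℝ := fun y => K.ph i (qminus α (K.u i) (cc i) y)

theorem cc_pos (K : Core α γ ε m s n cc x lam) (i : Bool) : 0 < cc i := by
  have := K.cc0 i; have := K.m0; linarith

theorem G_mono (K : Core α γ ε m s n cc x lam) (i : Bool) : StrictMonoOn (K.G i) (Icc 0 (x i)) := by
  intro y hy z hz h
  have hx := K.x_le i
  have h1 := K.lam_anti i (a := y) (b := z) ⟨by linarith [hy.1], by linarith [hy.2]⟩
    ⟨by linarith [hz.1], by linarith [hz.2]⟩ h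
  have h2 := Real.rpow_lt_rpow (K.lam_nonneg i hz) h1 K.g0
  have := K.cc_pos i
  unfold G rG
  apply mul_lt_mul_of_pos_left _ this
  linarith

theorem G_le_cc (K : Core α γ ε m s n cc x lam) (i : Bool) {y : ℝ} (hy : y ∈ Icc 0 (x i)) :
    K.G i y ≤ cc i := by
  have := Real.rpow_nonneg (K.lam_nonneg i hy) γ
  have := K.cc_pos i
  unfold G rG
  nlinarith

theorem G_nonneg' (K : Core α γ ε m s n cc x lam) (i : Bool) {y : ℝ} (hy : y ∈ Icc 0 (x i)) :
    0 ≤ K.G i y := by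
  have := Real.rpow_le_one (K.lam_nonneg i hy) (K.lam_le i hy.1 (by linarith [hy.2, K.x_le i])) K.g0.le
  have := K.cc_pos i
  unfold G rG
  apply mul_nonneg <;> linarith

theorem G_lt_self (K : Core α γ ε m s n cc x lam) (i : Bool) {y : ℝ} (hy : y ∈ Ioc 0 (x i)) :
    K.G i y < y := by
  have := K.m0
  rcases le_or_gt y (1 - m / 2) with h | h
  · have := K.G_le i hy.1.le h
    nlinarith [hy.1]
  · have := K.G_le_cc i ⟨hy.1.le, hy.2⟩
    have := K.cc1 i
    linarith

theorem G_zero (K : Core α γ ε m s n cc x lam) (i : Bool) : K.G i 0 = 0 := by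
  unfold G rG; rw [K.lam_zero]; simp

theorem F_G (K : Core α γ ε m s n cc x lam) (hγ : γ * α = 1) (i : Bool) {y : ℝ}
    (hy : y ∈ Icc 0 (x i)) : K.F i (K.G i y) = y := by
  have h := K.lam_nonneg i hy
  have hc := (K.cc_pos i).ne'
  have e : (cc i - K.G i y) / cc i = lam i y ^ γ := by
    unfold G rG; field_simp; ring
  unfold F qminus
  rw [e, abs_of_nonneg (Real.rpow_nonneg h _), ← Real.rpow_mul h, hγ, Real.rpow_one]
  have : K.u i * (1 - lam i y) = K.Ph i y := by unfold Ph; ring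
  rw [this]
  apply K.ph_Ph
  rw [abs_of_nonneg hy.1]; linarith [hy.2, K.x_le i]

theorem F_spec (K : Core α γ ε m s n cc x lam) (hγ : γ * α = 1) (i : Bool) {ξ : ℝ}
    (hξ : ξ ∈ Icc 0 (cc i)) : K.F i ξ ∈ Icc 0 (x i) ∧ K.G i (K.F i ξ) = ξ := by
  have hc : ContinuousOn (K.G i) (Icc 0 (x i)) := by
    intro y hy
    have hl : ContinuousAt (lam i) y :=
      (K.smooth i y (by rw [abs_of_nonneg hy.1]; linarith [hy.2, K.x_le i])).continuousAt
    have : ContinuousAt (K.G i) y :=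
      continuousAt_const.mul (continuousAt_const.sub (hl.rpow_const (Or.inr K.g0.le)))
    exact this.continuousWithinAt
  have := intermediate_value_Icc (K.x_pos i).le hc
  have e : K.G i (x i) = cc i := by
    unfold G rG; rw [K.zero, Real.zero_rpow K.g0.ne']; ring
  rw [K.G_zero, e] at this
  obtain ⟨y, hy, rfl⟩ := this hξ
  rw [K.F_G hγ i hy]
  exact ⟨hy, rfl⟩

theorem F_func (K : Core α γ ε m s n cc x lam) (hγ : γ * α = 1) (i : Bool) {ξ : ℝ}
    (hξ : ξ ∈ Icc 0 (cc i)) :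
    K.F i (cc i + s * (ξ - cc i)) =
      1 - (K.G (!i))^[n (!i)] (cc (!i) - s * (K.F i ξ - cc i)) := by
  obtain ⟨hy, hG⟩ := K.F_spec hγ i hξ
  set y := K.F i ξ
  have hx1 := K.x_le i
  have hf := K.func i y (by rw [abs_of_nonneg hy.1]; linarith [hy.2])
  change lam i (1 - (K.G (!i))^[n (!i)] (cc (!i) - s * (y - cc i))) = _ at hf
  have hq := K.q_mem i (y := y) ⟨hy.1, by linarith [hy.2]⟩
  have hm := K.G_mem (!i) (n (!i)) hq.1 hq.2.le
  set P := 1 - (K.G (!i))^[n (!i)] (cc (!i) - s * (y - cc i)) with hP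
  have hl := K.lam_nonneg i hy
  have hs := K.s0
  have hm0 := K.m0
  have hP0 : P ∈ Icc 0 (x i) := by
    refine ⟨by linarith, ?_⟩
    by_contra hc
    push Not at hc
    have := K.lam_anti i (a := x i) (b := P) ⟨by linarith [K.x_pos i], by linarith⟩
      ⟨by linarith, by linarith⟩ hc
    rw [K.zero, hf] at this
    have := mul_nonneg (Real.rpow_nonneg hs.le α) hl
    linarith
  have : K.G i P = cc i + s * (ξ - cc i) := by
    rw [← hG]
    unfold G rG
    rw [hf, Real.mul_rpow (Real.rpow_nonneg hs.le α) hl, ← Real.rpow_mul hs.le, mul_comm α γ, hγ,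
      Real.rpow_one]
    ring
  rw [← this, K.F_G hγ i hP0]

theorem G_lt (K : Core α γ ε m s n cc x lam) (i : Bool) {y : ℝ} (h0 : 0 ≤ y)
    (h1 : y ≤ 1 - m / 2) : K.G i y < cc i - s * cc i := by
  have h := K.lam_pos i h0 h1
  have h' := K.lam_le i h0 (by linarith [K.m0])
  have h2 := K.lam_lo i h0 (by linarith [K.m0])
  have h3 : lam i y ≤ lam i y ^ γ := by
    have := Real.rpow_le_rpow_of_exponent_ge h h' K.g1.le
    simpa using this
  have b := K.m0; have d := K.e1; have e := K.e0; have f := K.m1; have g := K.s1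
  have : s < lam i y := by
    have : (1 + ε) * y ≤ (1 + m / 16) * (1 - m / 2) := by
      apply mul_le_mul <;> linarith
    nlinarith
  have := K.cc_pos i
  unfold G rG
  nlinarith

end Core

namespace Core
variable {α γ ε m s : ℝ} {n : Bool → ℕ} {cc x : Bool → ℝ} {lam : Bool → ℝ → ℝ}

/-- `h` is the map seen from side `i`. -/
def Side (K : Core α γ ε m s n cc x lam) (i : Bool) (h : ℝ → ℝ) : Prop :=
  (∀ y, y < cc i → h y = K.F i y) ∧ ∀ y, cc i < y → h y = 1 - K.F (!i) (1 - y)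

theorem orbit (K : Core α γ ε m s n cc x lam) (hγ : γ * α = 1) {i : Bool} {h : ℝ → ℝ}
    (H : K.Side i h) {ξ : ℝ} (h0 : 0 ≤ ξ) (h1 : ξ < cc i) {k : ℕ} (hk : k ≤ n (!i)) :
    h^[k + 1] (cc i + s * (ξ - cc i)) =
      1 - (K.G (!i))^[n (!i) - k] (cc (!i) - s * (K.F i ξ - cc i)) := by
  obtain ⟨hy, -⟩ := K.F_spec hγ i (ξ := ξ) ⟨h0, h1.le⟩
  have hx1 := K.x_le i
  have hq := K.q_mem i (y := K.F i ξ) ⟨hy.1, by linarith [hy.2]⟩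
  set q := cc (!i) - s * (K.F i ξ - cc i) with hqd
  have hs := K.s0
  induction k with
  | zero =>
    rw [zero_add, Function.iterate_one, H.1 _ (by nlinarith), K.F_func hγ i ⟨h0, h1.le⟩, Nat.sub_zero]
  | succ k ih =>
    rw [Function.iterate_succ_apply', ih (by omega)]
    obtain ⟨p, hp⟩ : ∃ p, n (!i) - k = p + 1 := ⟨n (!i) - k - 1, by omega⟩
    have hp2 : n (!i) - (k + 1) = p := by omega
    have hm := K.G_mem (!i) p hq.1 hq.2.le
    have hlt := K.G_lt (!i) hm.1 (hm.2.trans hq.2.le)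
    rw [hp, hp2, Function.iterate_succ_apply', H.2]
    · rw [show 1 - (1 - K.G (!i) ((K.G (!i))^[p] q)) = K.G (!i) ((K.G (!i))^[p] q) by ring,
        K.F_G hγ (!i) ⟨hm.1, by linarith [hm.2, hq.2, K.x_lo (!i)]⟩]
    · have a := K.ccs i
      have := mul_pos hs (K.cc_pos (!i))
      linarith

theorem orbit_gt (K : Core α γ ε m s n cc x lam) (hγ : γ * α = 1) {i : Bool} {h : ℝ → ℝ}
    (H : K.Side i h) {ξ : ℝ} (h0 : 0 ≤ ξ) (h1 : ξ < cc i) {k : ℕ} (hk0 : 1 ≤ k) (hk : k ≤ n (!i)) :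
    cc i + s * cc (!i) < h^[k] (cc i + s * (ξ - cc i)) := by
  obtain ⟨k, rfl⟩ : ∃ j, k = j + 1 := ⟨k - 1, by omega⟩
  rw [K.orbit hγ H h0 h1 (by omega)]
  obtain ⟨hy, -⟩ := K.F_spec hγ i (ξ := ξ) ⟨h0, h1.le⟩
  have hq := K.q_mem i (y := K.F i ξ) ⟨hy.1, by linarith [hy.2, K.x_le i]⟩
  obtain ⟨p, hp⟩ : ∃ p, n (!i) - k = p + 1 := ⟨n (!i) - k - 1, by omega⟩
  have hm := K.G_mem (!i) p hq.1 hq.2.le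
  have hlt := K.G_lt (!i) hm.1 (hm.2.trans hq.2.le)
  rw [hp, Function.iterate_succ_apply']
  have a := K.ccs i
  linarith

theorem orbit_end (K : Core α γ ε m s n cc x lam) (hγ : γ * α = 1) {i : Bool} {h : ℝ → ℝ}
    (H : K.Side i h) {ξ : ℝ} (h0 : 0 ≤ ξ) (h1 : ξ < cc i) :
    h^[n (!i) + 1] (cc i + s * (ξ - cc i)) = cc i + s * (K.F i ξ - cc i) := by
  rw [K.orbit hγ H h0 h1 le_rfl, Nat.sub_self, Function.iterate_zero, id, K.ccs]
  ring

theorem G_iter_mono (K : Core α γ ε m s n cc x lam) (i : Bool) (k : ℕ) {y z : ℝ} (h0 : 0 ≤ y)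
    (h : y < z) (h1 : z ≤ 1 - m / 2) : (K.G i)^[k] y < (K.G i)^[k] z := by
  induction k with
  | zero => simpa using h
  | succ k ih =>
    rw [Function.iterate_succ_apply', Function.iterate_succ_apply']
    have a := K.G_mem i k h0 (h.le.trans h1)
    have b := K.G_mem i k (h0.trans h.le) h1
    have := K.x_lo i
    exact K.G_mono i ⟨a.1, by linarith⟩ ⟨b.1, by linarith⟩ ih

theorem orbit_dec (K : Core α γ ε m s n cc x lam) (hγ : γ * α = 1) {i : Bool} {h : ℝ → ℝ}
    (H : K.Side i h) {ξ ξ' : ℝ} (h0 : 0 ≤ ξ) (h1 : ξ < cc i) (h0' : 0 ≤ ξ') (h1' : ξ' < cc i)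
    {k : ℕ} (hk0 : 1 ≤ k) (hk : k + 1 ≤ n (!i)) :
    h^[k + 1] (cc i + s * (ξ - cc i)) < h^[k] (cc i + s * (ξ' - cc i)) := by
  obtain ⟨k, rfl⟩ : ∃ j, k = j + 1 := ⟨k - 1, by omega⟩
  rw [K.orbit hγ H h0 h1 (by omega), K.orbit hγ H h0' h1' (by omega)]
  obtain ⟨hy, -⟩ := K.F_spec hγ i (ξ := ξ) ⟨h0, h1.le⟩
  obtain ⟨hy', -⟩ := K.F_spec hγ i (ξ := ξ') ⟨h0', h1'.le⟩
  have hq := K.q_mem i (y := K.F i ξ) ⟨hy.1, by linarith [hy.2, K.x_le i]⟩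
  have hq' := K.q_mem i (y := K.F i ξ') ⟨hy'.1, by linarith [hy'.2, K.x_le i]⟩
  obtain ⟨p, hp⟩ : ∃ p, n (!i) - k = p + 1 := ⟨n (!i) - k - 1, by omega⟩
  have hp2 : n (!i) - (k + 1) = p := by omega
  rw [hp, hp2, Function.iterate_succ_apply]
  have hlt := K.G_lt (!i) hq'.1 hq'.2.le
  have hn := K.G_nonneg (!i) hq'.1 hq'.2.le
  have : cc (!i) - s * cc (!i) ≤ cc (!i) - s * (K.F i ξ - cc i) := by
    have a := K.ccs i
    have : s * (K.F i ξ - cc i) ≤ s * cc (!i) :=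
      mul_le_mul_of_nonneg_left (by linarith [hy.2, K.x_le i]) K.s0.le
    linarith
  have := K.G_iter_mono (!i) p hn (hlt.trans_le this) hq.2.le
  linarith

/-- Renormalization data of a map on an interval, from one side. -/
structure RP (c l r : ℝ) (h : ℝ → ℝ) : Prop where
  l0 : 0 ≤ l
  lc : l < c
  cr : c < r
  r1 : r ≤ 1
  proper : 0 < l ∨ r < 1
  ret : ∀ y ∈ Icc l r, y ≠ c → ∃ k, 0 < k ∧ h^[k] y ∈ Icc l r ∧
    (∀ j, 0 < j → j < k → h^[j] y ∉ Icc l r) ∧ (h^[k] y = y ↔ y = l ∨ y = r)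

theorem iter_conj (h : ℝ → ℝ) (k : ℕ) (y : ℝ) :
    (fun y => 1 - h (1 - y))^[k] y = 1 - h^[k] (1 - y) := by
  induction k with
  | zero => simp
  | succ k ih =>
    rw [Function.iterate_succ_apply', ih, Function.iterate_succ_apply']
    simp

theorem RP.conj {c l r : ℝ} {h : ℝ → ℝ} (R : RP c l r h) :
    RP (1 - c) (1 - r) (1 - l) (fun y => 1 - h (1 - y)) := by
  refine ⟨by linarith [R.r1], by linarith [R.cr], by linarith [R.lc], by linarith [R.l0], ?_, ?_⟩
  · rcases R.proper with h | h
    · right; linarith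
    · left; linarith
  · intro y hy hyc
    have key : ∀ z, 1 - z ∈ Icc (1 - r) (1 - l) ↔ z ∈ Icc l r := by
      intro z; constructor <;> intro hz <;> constructor <;> linarith [hz.1, hz.2]
    have hy' : 1 - y ∈ Icc l r := by constructor <;> linarith [hy.1, hy.2]
    obtain ⟨k, k0, k1, k2, k3⟩ := R.ret (1 - y) hy' (fun hh => hyc (by linarith))
    refine ⟨k, k0, ?_, ?_, ?_⟩
    · rw [iter_conj, key]; exact k1
    · intro j j0 j1
      rw [iter_conj, key]; exact k2 j j0 j1
    · rw [iter_conj]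
      constructor
      · intro hh
        rcases k3.1 (by linarith) with h' | h'
        · right; linarith
        · left; linarith
      · intro hh
        have := k3.2 (by rcases hh with h' | h'; right; linarith; left; linarith)
        linarith

theorem F_gt (K : Core α γ ε m s n cc x lam) (hγ : γ * α = 1) (i : Bool) {ξ : ℝ}
    (hξ : ξ ∈ Ioc 0 (cc i)) : ξ < K.F i ξ := by
  obtain ⟨hy, hG⟩ := K.F_spec hγ i (ξ := ξ) ⟨hξ.1.le, hξ.2⟩
  have h0 : K.F i ξ ≠ 0 := by
    intro h; rw [h, K.G_zero] at hG; linarith [hξ.1]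
  have := K.G_lt_self i ⟨lt_of_le_of_ne hy.1 h0.symm, hy.2⟩
  linarith

theorem Side.conj {K : Core α γ ε m s n cc x lam} {i : Bool} {h : ℝ → ℝ}
    (H : K.Side i h) : K.Side (!i) (fun y => 1 - h (1 - y)) := by
  have e := K.ccs i
  constructor
  · intro y hy
    change 1 - h (1 - y) = _
    rw [H.2 (1 - y) (by linarith)]
    simp
  · intro y hy
    change 1 - h (1 - y) = _
    rw [H.1 (1 - y) (by linarith)]
    simp

theorem RP.l_pos (K : Core α γ ε m s n cc x lam) (hγ : γ * α = 1) {i : Bool} {h : ℝ → ℝ}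
    (H : K.Side i h) {l r : ℝ} (R : RP (cc i) l r h) : 0 < l := by
  by_contra hl
  have hl0 : l = 0 := le_antisymm (not_lt.1 hl) R.l0
  have hr : r < 1 := R.proper.resolve_left hl
  obtain ⟨k, k0, k1, k2, k3⟩ := R.ret r ⟨by linarith [R.lc, R.cr], le_rfl⟩ R.cr.ne'
  have e := K.ccs i
  have hm : 1 - r ∈ Ioc 0 (cc (!i)) := ⟨by linarith, by linarith [R.cr]⟩
  have h1 := K.F_gt hγ (!i) hm
  have h2 := (K.F_spec hγ (!i) (ξ := 1 - r) ⟨hm.1.le, hm.2⟩).1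
  have hr1 := H.2 r R.cr
  have hin : h^[1] r ∈ Icc l r := by
    rw [Function.iterate_one, hr1, hl0]
    constructor <;> linarith [h2.2, K.x_le (!i)]
  have hk : k = 1 := by
    by_contra hne
    exact k2 1 one_pos (by omega) hin
  rw [hk, Function.iterate_one] at k3
  have := k3.2 (Or.inr rfl)
  linarith

theorem RP.out (K : Core α γ ε m s n cc x lam) (hγ : γ * α = 1) {i : Bool} {h : ℝ → ℝ}
    (H : K.Side i h) {l r : ℝ} (R : RP (cc i) l r h) : r < K.F i l := by
  have hl := RP.l_pos K hγ H R
  obtain ⟨k, k0, k1, k2, k3⟩ := R.ret l ⟨le_rfl, by linarith [R.lc, R.cr]⟩ R.lc.ne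
  have h1 := K.F_gt hγ i ⟨hl, R.lc.le⟩
  by_contra hc
  have hin : h^[1] l ∈ Icc l r := by
    rw [Function.iterate_one, H.1 _ R.lc]
    constructor <;> linarith
  have hk : k = 1 := by
    by_contra hne
    exact k2 1 one_pos (by omega) hin
  rw [hk, Function.iterate_one, H.1 _ R.lc] at k3
  have := k3.2 (Or.inl rfl)
  linarith

theorem F_zero (K : Core α γ ε m s n cc x lam) (hγ : γ * α = 1) (i : Bool) : K.F i 0 = 0 := by
  have := K.F_G hγ i (y := 0) ⟨le_rfl, (K.x_pos i).le⟩
  rwa [K.G_zero] at this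

theorem RP.step (K : Core α γ ε m s n cc x lam) (hγ : γ * α = 1) {i : Bool} {h : ℝ → ℝ}
    (H : K.Side i h) {l r : ℝ} (R : RP (cc i) l r h) (hl : l < cc i - s * cc i) :
    1 - K.G (!i) (1 - (cc i - s * cc i)) ≤ r ∧ cc i + s * cc (!i) < r := by
  have hs := K.s0
  have hc := K.cc_pos i
  have hsc := mul_pos hs hc
  obtain ⟨k, k0, k1, k2, k3⟩ := R.ret (cc i - s * cc i) ⟨hl.le, by linarith [R.cr]⟩ (by linarith)
  have e0 : cc i - s * cc i = cc i + s * (0 - cc i) := by ring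
  have hend := K.orbit_end hγ H le_rfl hc
  rw [K.F_zero hγ, ← e0] at hend
  have hkle : k ≤ n (!i) := by
    by_contra hlt
    rcases (by omega : k = n (!i) + 1 ∨ n (!i) + 1 < k) with h' | h'
    · rw [h'] at k3
      rcases k3.1 hend with h' | h'
      · linarith
      · linarith [R.cr]
    · apply k2 _ (by omega) h'
      rw [hend]
      exact ⟨hl.le, by linarith [R.cr]⟩
  have hgt := K.orbit_gt hγ H le_rfl hc (k := k) (by omega) hkle
  rw [← e0] at hgt
  refine ⟨?_, by linarith [k1.2]⟩
  obtain ⟨j, rfl⟩ : ∃ j, k = j + 1 := ⟨k - 1, by omega⟩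
  have horb := K.orbit hγ H le_rfl hc (k := j) (by omega)
  rw [← e0, K.F_zero hγ] at horb
  have hq := K.q_mem i (y := 0) ⟨le_rfl, by norm_num⟩
  have hqe : cc (!i) - s * (0 - cc i) = 1 - (cc i - s * cc i) := by rw [K.ccs]; ring
  rw [hqe] at hq horb
  obtain ⟨p, hp⟩ : ∃ p, n (!i) - j = p + 1 := ⟨n (!i) - j - 1, by omega⟩
  rw [hp, Function.iterate_succ_apply (K.G (!i))] at horb
  have a := K.G_nonneg (!i) hq.1 hq.2.le
  have b := K.G_le (!i) hq.1 hq.2.le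
  have hm := K.G_mem (!i) p a (by nlinarith [K.m0, K.m1])
  linarith [hm.2, k1.2]

theorem RP.max (K : Core α γ ε m s n cc x lam) (hγ : γ * α = 1) {i : Bool} {h : ℝ → ℝ}
    (H : K.Side i h) {l r : ℝ} (R : RP (cc i) l r h) :
    cc i - s * cc i ≤ l ∧ r ≤ cc i + s * cc (!i) := by
  have e := K.ccs i
  have Hc := H.conj
  have Rc : RP (cc (!i)) (1 - r) (1 - l) (fun y => 1 - h (1 - y)) := by
    rw [e]; exact R.conj
  have A : l < cc i - s * cc i → cc i + s * cc (!i) < r := fun h1 => (RP.step K hγ H R h1).2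
  have B : cc i + s * cc (!i) < r → l < cc i - s * cc i ∧ l ≤ K.G i (cc i + s * cc (!i)) := by
    intro h1
    obtain ⟨h2, h3⟩ := RP.step K hγ Hc Rc (by linarith)
    rw [Bool.not_not] at h2 h3
    have e2 : 1 - (cc (!i) - s * cc (!i)) = cc i + s * cc (!i) := by linarith
    rw [e2] at h2
    exact ⟨by linarith, by linarith⟩
  have C : ¬ (cc i + s * cc (!i) < r) := by
    intro h1
    obtain ⟨-, h2⟩ := B h1
    have h3 := RP.out K hγ H R
    have hl := RP.l_pos K hγ H R
    obtain ⟨h4, h5⟩ := K.F_spec hγ i (ξ := l) ⟨hl.le, R.lc.le⟩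
    have p1 := K.cc_pos i
    have p2 := mul_pos K.s0 (K.cc_pos (!i))
    have := K.G_mono i (a := cc i + s * cc (!i)) (b := K.F i l) ⟨by linarith, by linarith [h4.2]⟩ h4
      (by linarith)
    linarith
  exact ⟨not_lt.1 fun h1 => C (A h1), not_lt.1 C⟩

end Core

theorem toFun_zero {α : ℝ} (g : LorenzMap α) : g.toFun 0 = 0 := by
  have hc := g.hc
  unfold LorenzMap.toFun
  rw [if_pos hc.1]
  unfold LorenzMap.fm qminus
  rw [sub_zero, div_self hc.1.ne']
  simp [g.hφ.fix0]

theorem toFun_one {α : ℝ} (g : LorenzMap α) : g.toFun 1 = 1 := by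
  have hc := g.hc
  have : (1 - g.c) ≠ 0 := by linarith [hc.2]
  unfold LorenzMap.toFun
  rw [if_neg (by linarith [hc.2])]
  unfold LorenzMap.fp qplus
  rw [div_self this]
  simp [g.hψ.fix1]

theorem toFun_fix_iff {α : ℝ} (g : LorenzMap α) {t : ℝ} (ht : t ∈ Icc (0:ℝ) 1)
    (htc : t ≠ g.c) : g.toFun t = t ↔ t = 0 ∨ t = 1 := by
  constructor
  · intro h
    by_contra hne
    push Not at hne
    have h0 : 0 < t := lt_of_le_of_ne ht.1 hne.1.symm
    have h1 : t < 1 := lt_of_le_of_ne ht.2 hne.2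
    rcases lt_or_gt_of_ne htc with h' | h'
    · have := g.hleft t ⟨h0, h'.le⟩
      unfold LorenzMap.toFun at h
      rw [if_pos h'] at h
      unfold LorenzMap.fm at h
      linarith
    · have := g.hright t ⟨h'.le, h1⟩
      unfold LorenzMap.toFun at h
      rw [if_neg (not_lt.2 h'.le)] at h
      unfold LorenzMap.fp at h
      linarith
  · rintro (rfl | rfl)
    · exact toFun_zero g
    · exact toFun_one g

theorem RP_of {α : ℝ} {f g : LorenzMap α} {l r : ℝ} (h : IsRenormPair f g l r) :
    Core.RP f.c l r f.toFun := by
  obtain ⟨h0, h1, h2, h3, h4, h5, h6⟩ := h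
  refine ⟨h0, h1, h2, h3, h4, ?_⟩
  intro y hy hyc
  obtain ⟨hex, hval⟩ := h6 y hy hyc
  have hmem := Nat.sInf_mem (s := {k : ℕ | 0 < k ∧ f.toFun^[k] y ∈ Icc l r}) hex
  have hd : 0 < r - l := by linarith
  refine ⟨firstReturn f.toFun (Icc l r) y, hmem.1, hmem.2, ?_, ?_⟩
  · intro j j0 j1 hj
    exact Nat.notMem_of_lt_sInf j1 ⟨j0, hj⟩
  · rw [hval]
    have ht : (y - l) / (r - l) ∈ Icc (0:ℝ) 1 :=
      ⟨div_nonneg (by linarith [hy.1]) hd.le, (div_le_one hd).2 (by linarith [hy.2])⟩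
    have htc : (y - l) / (r - l) ≠ g.c := by
      rw [h5]; intro h
      rw [div_left_inj' hd.ne'] at h
      exact hyc (by linarith)
    have key := toFun_fix_iff g ht htc
    constructor
    · intro h
      have : g.toFun ((y - l) / (r - l)) = (y - l) / (r - l) := by
        rw [eq_div_iff hd.ne']; linarith
      rcases key.1 this with h' | h'
      · left; rw [div_eq_zero_iff] at h'; rcases h' with h' | h' <;> linarith
      · right; rw [div_eq_one_iff_eq hd.ne'] at h'; linarith
    · intro h
      have : g.toFun ((y - l) / (r - l)) = (y - l) / (r - l) := by
        apply key.2
        rcases h with h | h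
        · left; rw [h]; simp
        · right; rw [h]; exact div_self hd.ne'
      rw [this]; field_simp; ring

namespace Core
variable {α γ ε m s : ℝ} {n : Bool → ℕ} {cc x : Bool → ℝ} {lam : Bool → ℝ → ℝ}

theorem right_eq (K : Core α γ ε m s n cc x lam) (y : ℝ) :
    1 + (-1) * K.ph true (1 + (-1) * qplus α (K.u true) (cc false) y) = 1 - K.F true (1 - y) := by
  have e : cc true = 1 - cc false := K.ccs false
  unfold F qplus qminus
  rw [e, show (1 - cc false - (1 - y)) = y - cc false by ring]
  rw [show 1 + -1 * (1 + K.u true * (-1 + |(y - cc false) / (1 - cc false)| ^ α)) =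
    K.u true * (1 - |(y - cc false) / (1 - cc false)| ^ α) by ring]
  ring

/-- The fixed point. -/
def map (K : Core α γ ε m s n cc x lam)
    (hk : ∀ i, s ^ 2 * Real.exp (4 / m ^ 2) ^ 2 * (n i + 1) < 1) (hγ : γ * α = 1) : LorenzMap α where
  u := K.u false
  v := K.u true
  c := cc false
  φ := K.ph false
  ψ := fun y => 1 + (-1) * K.ph true (1 + (-1) * y)
  hu := ⟨(K.u_pos _).le, K.u_le _⟩
  hv := ⟨(K.u_pos _).le, K.u_le _⟩
  hc := ⟨K.cc_pos _, by have := K.cc1 false; have := K.m0; linarith⟩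
  hφ := (K.ph_SD hk false).isSDiffeo
  hψ := (K.ph_SD hk true).refl.isSDiffeo
  hleft := fun y hy => K.F_gt hγ false hy
  hright := fun y hy => by
    rw [K.right_eq]
    have e : cc true = 1 - cc false := K.ccs false
    have := K.F_gt hγ true (ξ := 1 - y) ⟨by linarith [hy.2], by linarith [hy.1]⟩
    linarith

theorem map_side (K : Core α γ ε m s n cc x lam)
    (hk : ∀ i, s ^ 2 * Real.exp (4 / m ^ 2) ^ 2 * (n i + 1) < 1) (hγ : γ * α = 1) :
    K.Side false (K.map hk hγ).toFun := by
  constructor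
  · intro y hy
    unfold LorenzMap.toFun
    rw [if_pos (show y < (K.map hk hγ).c from hy)]
    rfl
  · intro y hy
    unfold LorenzMap.toFun
    rw [if_neg (show ¬ y < (K.map hk hγ).c from not_lt.2 hy.le)]
    exact K.right_eq y

theorem param (K : Core α γ ε m s n cc x lam) {i : Bool} {y : ℝ} (hy : y ∈ Ico (cc i - s * cc i) (cc i)) :
    ∃ ξ, 0 ≤ ξ ∧ ξ < cc i ∧ y = cc i + s * (ξ - cc i) := by
  have hs := K.s0
  refine ⟨(y - cc i) / s + cc i, ?_, ?_, ?_⟩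
  · have : -cc i ≤ (y - cc i) / s := by
      rw [le_div_iff₀ hs]; linarith [hy.1]
    linarith
  · have : (y - cc i) / s < 0 := div_neg_of_neg_of_pos (by linarith [hy.2]) hs
    linarith
  · field_simp; ring

/-- One-sided combinatorics. -/
theorem comb (K : Core α γ ε m s n cc x lam) (hγ : γ * α = 1) {i : Bool} {h : ℝ → ℝ}
    (H : K.Side i h) :
    (∀ k, 1 ≤ k → k ≤ n (!i) → ∀ y ∈ Ico (cc i - s * cc i) (cc i), cc i + s * cc (!i) < h^[k] y) ∧
    (∀ k, 1 ≤ k → k + 1 ≤ n (!i) → ∀ y ∈ Ico (cc i - s * cc i) (cc i),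
      ∀ z ∈ Ico (cc i - s * cc i) (cc i), h^[k + 1] y < h^[k] z) ∧
    (∀ y ∈ Ico (cc i - s * cc i) (cc i), ∃ z ∈ Ico (cc i - s * cc i) (cc i), h^[n (!i) + 1] z = y) ∧
    (∀ y ∈ Ico (cc i - s * cc i) (cc i),
      h^[n (!i) + 1] y ∈ Icc (cc i - s * cc i) (cc i + s * cc (!i)) ∧
      h^[n (!i) + 1] y = (cc i - s * cc i) + s * h ((y - (cc i - s * cc i)) / s)) := by
  have hs := K.s0
  refine ⟨?_, ?_, ?_, ?_⟩
  · intro k k0 k1 y hy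
    obtain ⟨ξ, h0, h1, rfl⟩ := K.param hy
    exact K.orbit_gt hγ H h0 h1 k0 k1
  · intro k k0 k1 y hy z hz
    obtain ⟨ξ, h0, h1, rfl⟩ := K.param hy
    obtain ⟨ξ', h0', h1', rfl⟩ := K.param hz
    exact K.orbit_dec hγ H h0 h1 h0' h1' k0 k1
  · intro y hy
    obtain ⟨η, h0, h1, rfl⟩ := K.param hy
    have hc1 := K.cc1 i
    have hm := K.m0
    have hx := K.x_lo i
    have hη : η ∈ Icc 0 (x i) := ⟨h0, by linarith⟩
    have a := K.G_nonneg i h0 (by linarith)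
    have b := K.G_lt i h0 (by linarith)
    have sc := mul_pos hs (K.cc_pos i)
    refine ⟨cc i + s * (K.G i η - cc i), ⟨?_, ?_⟩, ?_⟩
    · nlinarith
    · nlinarith
    · rw [K.orbit_end hγ H a (by linarith), K.F_G hγ i hη]
  · intro y hy
    obtain ⟨ξ, h0, h1, rfl⟩ := K.param hy
    have hF := (K.F_spec hγ i ⟨h0, h1.le⟩).1
    rw [K.orbit_end hγ H h0 h1]
    have e := K.ccs i
    have a1 := mul_nonneg hs.le hF.1
    have a2 : s * (K.F i ξ - cc i) ≤ s * cc (!i) :=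
      mul_le_mul_of_nonneg_left (by linarith [hF.2, K.x_le i]) hs.le
    refine ⟨⟨by linarith, by linarith⟩, ?_⟩
    have : (cc i + s * (ξ - cc i) - (cc i - s * cc i)) / s = ξ := by field_simp; ring
    rw [this, H.1 _ h1]
    ring

theorem firstReturn_eq {F : ℝ → ℝ} {C : Set ℝ} {y : ℝ} {k : ℕ} (h0 : 0 < k) (h1 : F^[k] y ∈ C)
    (h2 : ∀ j, 1 ≤ j → j < k → F^[j] y ∉ C) : firstReturn F C y = k := by
  have hmem := Nat.sInf_mem (s := {k : ℕ | 0 < k ∧ F^[k] y ∈ C}) ⟨k, h0, h1⟩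
  apply le_antisymm
  · exact Nat.sInf_le ⟨h0, h1⟩
  · by_contra hlt
    exact h2 _ hmem.1 (not_le.1 hlt) hmem.2

theorem final (K : Core α γ ε m s n cc x lam)
    (hk : ∀ i, s ^ 2 * Real.exp (4 / m ^ 2) ^ 2 * (n i + 1) < 1) (hγ : γ * α = 1) :
    ∃ (f : LorenzMap α) (l r : ℝ),
      IsReturnInterval f l r ∧ ABCombinatorics f l r (n true) (n false) ∧ IsRenormPair f f l r := by
  set f := K.map hk hγ with hf
  have hfc : f.c = cc false := rfl
  have H : K.Side false f.toFun := K.map_side hk hγ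
  have H' : K.Side true (fun y => 1 - f.toFun (1 - y)) := H.conj
  obtain ⟨A1, A2, A3, A4⟩ := K.comb hγ H
  obtain ⟨B1, B2, B3, B4⟩ := K.comb hγ H'
  simp only [Bool.not_false, Bool.not_true, iter_conj] at A1 A2 A3 A4 B1 B2 B3 B4
  have e : cc true = 1 - cc false := K.ccs false
  have hs := K.s0
  have p0 := K.cc_pos false
  have p1 := K.cc_pos true
  have q0 := mul_pos hs p0
  have q1 := mul_pos hs p1
  have hs1 : s < 1 := by have := K.s1; have := K.m1; linarith
  set l := cc false - s * cc false with hl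
  set r := cc false + s * cc true with hr
  have hrl : r - l = s := by rw [hl, hr, e]; ring
  have l0 : 0 < l := by rw [hl]; nlinarith
  have r1 : r < 1 := by rw [hr]; nlinarith
  have lc : l < cc false := by rw [hl]; linarith
  have cr : cc false < r := by rw [hr]; linarith
  have l' : cc true - s * cc true = 1 - r := by rw [hr, e]; ring
  have r' : cc true + s * cc false = 1 - l := by rw [hl, e]; ring
  rw [l'] at B1 B2 B3 B4
  rw [r'] at B1 B4
  have mir : ∀ y, y ∈ Ioc (cc false) r → 1 - y ∈ Ico (1 - r) (cc true) := by
    intro y hy; constructor <;> linarith [hy.1, hy.2]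
  have hpair : IsRenormPair f f l r := by
    refine ⟨l0.le, lc, cr, r1.le, Or.inl l0, ?_, ?_⟩
    · rw [hrl, hfc, hl]; field_simp; ring
    · intro y hy hyc
      rw [hfc] at hyc
      rcases lt_or_gt_of_ne hyc with h | h
      · have hy' : y ∈ Ico l (cc false) := ⟨hy.1, h⟩
        obtain ⟨a, b⟩ := A4 y hy'
        have hfr : firstReturn f.toFun (Icc l r) y = n true + 1 := by
          apply firstReturn_eq (by omega) a
          intro j j0 j1 hj
          have := A1 j j0 (by omega) y hy'
          linarith [hj.2]
        refine ⟨⟨_, by omega, a⟩, ?_⟩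
        rw [hfr, b, hrl]
      · have hy' := mir y ⟨h, hy.2⟩
        obtain ⟨a, b⟩ := B4 _ hy'
        rw [sub_sub_cancel] at a b
        have a' : f.toFun^[n false + 1] y ∈ Icc l r := by
          constructor <;> linarith [a.1, a.2]
        have hfr : firstReturn f.toFun (Icc l r) y = n false + 1 := by
          apply firstReturn_eq (by omega) a'
          intro j j0 j1 hj
          have := B1 j j0 (by omega) _ hy'
          rw [sub_sub_cancel] at this
          linarith [hj.1]
        refine ⟨⟨_, by omega, a'⟩, ?_⟩
        rw [hfr, hrl]
        have : 1 - (1 - y - (1 - r)) / s = (y - l) / s := by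
          rw [show y - l = s - (r - y) by linarith]; field_simp; ring
        rw [this] at b
        linarith
  refine ⟨f, l, r, ⟨⟨f, hpair⟩, ?_⟩, ?_, hpair⟩
  · intro g' l' r' hp
    have := RP.max K hγ H (RP_of hp)
    exact Icc_subset_Icc this.1 this.2
  · refine ⟨K.n0 _, K.n0 _, ?_, ?_, ?_, ?_, ?_, ?_, ?_, ?_⟩
    · intro k k0 k1 y hy
      exact cr.trans (A1 k k0 k1 y hy)
    · intro k k0 k1 y hy z hz
      exact A2 k k0 k1 y hy z hz
    · intro y hy
      exact A3 y hy
    · rintro _ ⟨y, hy, rfl⟩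
      exact (A4 y hy).1
    · intro k k0 k1 y hy
      have := B1 k k0 k1 _ (mir y hy)
      rw [sub_sub_cancel] at this
      rw [hfc]; linarith
    · intro k k0 k1 y hy z hz
      have := B2 k k0 k1 _ (mir z hz) _ (mir y hy)
      rw [sub_sub_cancel, sub_sub_cancel] at this
      linarith
    · intro y hy
      obtain ⟨z, hz, hzy⟩ := B3 _ (mir y hy)
      refine ⟨1 - z, ⟨?_, ?_⟩, ?_⟩
      · rw [hfc]; linarith [hz.2]
      · linarith [hz.1]
      · linarith
    · rintro _ ⟨y, hy, rfl⟩
      have := (B4 _ (mir y hy)).1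
      rw [sub_sub_cancel] at this
      constructor <;> linarith [this.1, this.2]

end Core

theorem lin_exp_tendsto (p q τ : ℝ) (hτ : 0 < τ) :
    Tendsto (fun b : ℕ => (p + q * b) * Real.exp (-(b * (τ / 2)))) atTop (𝓝 0) := by
  have hx : Tendsto (fun b : ℕ => (b : ℝ) * (τ / 2)) atTop atTop :=
    tendsto_natCast_atTop_atTop.atTop_mul_const (by linarith)
  have h0 := ((Real.tendsto_pow_mul_exp_neg_atTop_nhds_zero 0).comp hx).const_mul p
  have h1 := ((Real.tendsto_pow_mul_exp_neg_atTop_nhds_zero 1).comp hx).const_mul (2 * q / τ)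
  have h2 := h0.add h1
  simp only [mul_zero, add_zero] at h2
  refine h2.congr fun b => ?_
  simp only [Function.comp, pow_zero, pow_one]
  field_simp

theorem exists_cs {γ B : ℝ} (h0 : 0 < γ) (hB : 0 < B) :
    ∃ c, 0 < c ∧ c < 1 ∧ Real.log γ + Real.log c = B * (Real.log γ + Real.log (1 - c)) := by
  have hc : ContinuousOn (fun c : ℝ => γ * c - (γ * (1 - c)) ^ B) (Icc 0 1) := by
    apply Continuous.continuousOn
    exact (continuous_const.mul continuous_id).sub
      ((continuous_const.mul (continuous_const.sub continuous_id)).rpow_const fun _ => Or.inr hB.le)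
  have := intermediate_value_Icc zero_le_one hc
  have hp := Real.rpow_pos_of_pos h0 B
  obtain ⟨c, hcm, he⟩ := this (show (0:ℝ) ∈ _ by
    simp only [mul_zero, sub_zero, mul_one, zero_sub, sub_self, Real.zero_rpow hB.ne']
    constructor <;> linarith)
  simp only at he
  have c0 : 0 < c := by
    apply lt_of_le_of_ne hcm.1
    rintro rfl
    simp at he
    linarith
  have c1 : c < 1 := by
    apply lt_of_le_of_ne hcm.2
    rintro rfl
    simp [Real.zero_rpow hB.ne'] at he
    linarith
  refine ⟨c, c0, c1, ?_⟩
  have h1 : 0 < 1 - c := by linarith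
  rw [← Real.log_mul h0.ne' c0.ne', ← Real.log_mul h0.ne' h1.ne', ← Real.log_rpow (mul_pos h0 h1)]
  congr 1
  linarith

theorem exists_radius {γ B cs α τ Θ M : ℝ} (c0 : 0 < cs) (c1 : cs < 1)
    (hcs : Real.log γ + Real.log cs = B * (Real.log γ + Real.log (1 - cs))) (hg : 0 < γ)
    (hτ : τ = -(Real.log γ + Real.log cs) / (α - 1)) (hτ0 : 0 < τ)
    (hΘ : Θ = 1 / cs + B / (1 - cs)) (hΘ0 : 0 < Θ) (hM : 0 < M) :
    ∃ r, 0 < r ∧ r ≤ M ∧ ∀ c : ℂ, ‖c - cs‖ ≤ r →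
      ‖-(Complex.log γ + Complex.log c) / (α - 1) - τ‖ ≤ τ / 32 ∧
      ‖c - ((Complex.log γ + Complex.log c) - B * (Complex.log γ + Complex.log (1 - c))) / Θ - cs‖
        ≤ r / 16 := by
  have s1 : (cs : ℂ) ∈ Complex.slitPlane := Complex.ofReal_mem_slitPlane.2 c0
  have s2 : (1 - (cs : ℂ)) ∈ Complex.slitPlane := by
    have : (1 - (cs : ℂ)) = ((1 - cs : ℝ) : ℂ) := by push_cast; rfl
    rw [this]; exact Complex.ofReal_mem_slitPlane.2 (by linarith)
  have lg : Complex.log γ = (Real.log γ : ℂ) := (Complex.ofReal_log hg.le).symm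
  have lc : Complex.log cs = (Real.log cs : ℂ) := (Complex.ofReal_log c0.le).symm
  have lc' : Complex.log (1 - cs) = (Real.log (1 - cs) : ℂ) := by
    rw [Complex.ofReal_log (by linarith)]; push_cast; rfl
  have d1 := Complex.hasDerivAt_log s1
  have d2 : HasDerivAt (fun c : ℂ => Complex.log (1 - c)) ((1 - (cs : ℂ))⁻¹ * (-1)) cs := by
    have e := (hasDerivAt_id (cs : ℂ)).const_sub 1
    exact (Complex.hasDerivAt_log s2).comp (cs : ℂ) e
  set f1 : ℂ → ℂ := fun c => -(Complex.log γ + Complex.log c) / (α - 1) with hf1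
  have e1 : f1 cs = τ := by
    simp only [hf1, lg, lc, hτ]; push_cast; rfl
  have k1 : ContinuousAt f1 cs :=
    ((continuousAt_const.add d1.continuousAt).neg).div_const _
  have ev1 : ∀ᶠ c in 𝓝 (cs : ℂ), ‖f1 c - τ‖ ≤ τ / 32 := by
    rw [ContinuousAt, e1] at k1
    have := Metric.tendsto_nhds.1 k1 (τ / 32) (by linarith)
    filter_upwards [this] with c hc
    rw [dist_eq_norm] at hc
    exact hc.le
  set f2 : ℂ → ℂ := fun c => c - ((Complex.log γ + Complex.log c) -
    B * (Complex.log γ + Complex.log (1 - c))) / Θ with hf2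
  have e2 : f2 cs = cs := by
    simp only [hf2, lg, lc, lc']
    have : ((Real.log γ : ℂ) + Real.log cs) = B * ((Real.log γ : ℂ) + Real.log (1 - cs)) := by
      exact_mod_cast hcs
    rw [this]; simp
  have d3 : HasDerivAt f2 0 cs := by
    have h := (hasDerivAt_id (cs : ℂ)).sub
      (((d1.const_add (Complex.log γ)).sub ((d2.const_add (Complex.log γ)).const_mul (B : ℂ))).div_const (Θ : ℂ))
    have e : (1 : ℂ) - ((cs : ℂ)⁻¹ - B * ((1 - (cs : ℂ))⁻¹ * (-1))) / Θ = 0 := by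
      have : (cs : ℂ)⁻¹ - B * ((1 - (cs : ℂ))⁻¹ * (-1)) = (Θ : ℂ) := by
        rw [hΘ]; push_cast; ring
      rw [this, div_self, sub_self]
      exact_mod_cast hΘ0.ne'
    rw [e] at h
    exact h
  have ev2 : ∀ᶠ c in 𝓝 (cs : ℂ), ‖f2 c - cs‖ ≤ 1 / 16 * ‖c - cs‖ := by
    have := (hasDerivAt_iff_isLittleO.1 d3).def (c := 1 / 16) (by norm_num)
    filter_upwards [this] with c hc
    simpa [e2] using hc
  obtain ⟨δ, δ0, hδ⟩ := Metric.eventually_nhds_iff.1 (ev1.and ev2)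
  refine ⟨min (δ / 2) M, lt_min (by linarith) hM, min_le_right _ _, ?_⟩
  intro c hc
  have h := hδ (y := c) (by
    rw [dist_eq_norm]
    have := min_le_left (δ / 2) M
    linarith)
  refine ⟨h.1, h.2.trans ?_⟩
  linarith

set_option maxHeartbeats 2000000 in
theorem main_aux (α : ℝ) (hα : 1 < α) (B : ℝ) (hB : 0 < B) :
    ∃ N : ℕ, ∀ a b : ℕ, 0 < a → N ≤ b → (a : ℝ) = B * b →
      ∃ (f : LorenzMap α) (l r : ℝ),
        IsReturnInterval f l r ∧ ABCombinatorics f l r a b ∧ IsRenormPair f f l r := by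
  set γ : ℝ := α⁻¹ with hγd
  have hα0 : 0 < α := by linarith
  have g0 : 0 < γ := inv_pos.2 hα0
  have g1 : γ < 1 := inv_lt_one_of_one_lt₀ hα
  have hγ : γ * α = 1 := inv_mul_cancel₀ hα0.ne'
  have lgn : Real.log γ < 0 := Real.log_neg g0 g1
  obtain ⟨cs, c0, c1, hcs⟩ := exists_cs g0 hB
  have lcn : Real.log cs < 0 := Real.log_neg c0 c1
  obtain ⟨τ, hτ⟩ : ∃ τ, τ = -(Real.log γ + Real.log cs) / (α - 1) := ⟨_, rfl⟩
  have τ0 : 0 < τ := by rw [hτ]; apply div_pos <;> linarith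
  obtain ⟨Θ, hΘ⟩ : ∃ Θ, Θ = 1 / cs + B / (1 - cs) := ⟨_, rfl⟩
  have h1c : 0 < 1 - cs := by linarith
  have Θ0 : 0 < Θ := by rw [hΘ]; positivity
  obtain ⟨m, m0, mcs, mcs'⟩ : ∃ m : ℝ, 0 < m ∧ m ≤ cs ∧ m ≤ 1 - cs :=
    ⟨min cs (1 - cs), lt_min c0 h1c, min_le_left _ _, min_le_right _ _⟩
  have m1 : m ≤ 1 / 2 := by linarith
  obtain ⟨r, r0, r1, hr⟩ := exists_radius (α := α) (M := m / 4) c0 c1 hcs g0 hτ τ0 hΘ Θ0 (by linarith)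
  obtain ⟨ε, e0, e1, e2, e3, e4⟩ : ∃ ε : ℝ, 0 < ε ∧ ε ≤ m / 16 ∧ ε ≤ -Real.log γ / 2 ∧
      ε ≤ (α - 1) * τ / 128 ∧ ε ≤ Θ * r / (64 * (1 + B)) := by
    refine ⟨min (min (m / 16) (-Real.log γ / 2)) (min ((α - 1) * τ / 128) (Θ * r / (64 * (1 + B)))),
      ?_, ?_, ?_, ?_, ?_⟩
    · refine lt_min (lt_min (by linarith) (by linarith)) (lt_min ?_ (by positivity))
      have : 0 < α - 1 := by linarith
      positivity
    · exact (min_le_left _ _).trans (min_le_left _ _)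
    · exact (min_le_left _ _).trans (min_le_right _ _)
    · exact (min_le_right _ _).trans (min_le_left _ _)
    · exact (min_le_right _ _).trans (min_le_right _ _)
  set C := Real.exp (4 / m ^ 2) with hC
  have v1 : ∀ᶠ b : ℕ in atTop, Real.exp (-(b * (τ / 2))) < m / 16 := by
    have := (lin_exp_tendsto 1 0 τ τ0).eventually (gt_mem_nhds (show 0 < m / 16 by linarith))
    simpa using this
  have v2 : ∀ D : ℝ, ∀ᶠ b : ℕ in atTop,
      (64 * (4 / m ^ 2 + 2 * ε) / m + 64 * (2 * ε * D) / m * b) * Real.exp (-(b * (τ / 2))) < ε / 480 :=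
    fun D => (lin_exp_tendsto _ _ τ τ0).eventually (gt_mem_nhds (by linarith))
  have v3 : ∀ D : ℝ, ∀ᶠ b : ℕ in atTop,
      (C ^ 2 + C ^ 2 * D * b) * Real.exp (-(b * (τ / 2))) < 1 :=
    fun D => (lin_exp_tendsto _ _ τ τ0).eventually (gt_mem_nhds (by norm_num))
  have v4 : ∀ᶠ b : ℕ in atTop, (1 - m / 2) ^ b < ε / 480 / 8 :=
    (tendsto_pow_atTop_nhds_zero_of_lt_one (by linarith) (by linarith)).eventually
      (gt_mem_nhds (by linarith))
  obtain ⟨N4, hN4⟩ := eventually_atTop.1 v4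
  have v5 : ∀ D : ℝ, ∀ᶠ b : ℕ in atTop, D ≤ b :=
    fun D => tendsto_natCast_atTop_atTop.eventually (eventually_ge_atTop D)
  obtain ⟨N, hN⟩ := eventually_atTop.1 (((v1.and (v2 1)).and ((v2 B).and (v3 1))).and
    (((v3 B).and (v5 (N4 / B))).and ((v5 (4 * 64 / (m ^ 2 * ((α - 1) * τ)))).and
      ((v5 (8 * 32 / (m ^ 2 * (Θ * r)))).and (v5 (max N4 1))))))
  refine ⟨N, fun a b ha hb hab => ?_⟩
  obtain ⟨⟨⟨w1, w2⟩, w3, w4⟩, ⟨w5, w6⟩, w7, w8, w9⟩ := hN b hb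
  have hα1 : 0 < α - 1 := by linarith
  have bN4 : N4 ≤ b := by exact_mod_cast (le_max_left _ _).trans w9
  have b1 : (1 : ℝ) ≤ b := (le_max_right _ _).trans w9
  have b0 : 0 < b := by exact_mod_cast (by linarith : (0:ℝ) < b)
  have b0' : (0:ℝ) < b := by linarith
  have aN4 : N4 ≤ a := by
    rw [div_le_iff₀ hB] at w6
    exact_mod_cast (by rw [hab]; linarith : (N4 : ℝ) ≤ a)
  set n : Bool → ℕ := fun i => if i then a else b with hn
  have nf : n false = b := rfl
  have nt : n true = a := rfl
  set p : Par := ⟨α, γ, cs, m, r, ε, τ, Θ, n⟩ with hp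
  have P : p.OK := by
    refine ⟨hα, g0, g1, m0, m1, mcs, mcs', r0, r1, e0, e1, by simp only [hp]; linarith, τ0, Θ0, ?_, w1, ?_, ?_,
      fun c hc => (hr c hc).1, ?_, ?_, ?_⟩
    · intro i; cases i
      · exact b0
      · exact ha
    · intro j
      cases j
      · change 64 * (4 / m ^ 2 + 2 * ε * b + 2 * ε) / m * Real.exp (-(b * (τ / 2))) ≤ ε / 480
        refine le_of_eq_of_le ?_ w2.le
        ring
      · change 64 * (4 / m ^ 2 + 2 * ε * a + 2 * ε) / m * Real.exp (-(b * (τ / 2))) ≤ ε / 480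
        rw [hab]
        refine le_of_eq_of_le ?_ w3.le
        ring
    · intro j
      cases j
      · exact (hN4 b bN4).le
      · exact (hN4 a aN4).le
    · change (4 / m ^ 2 + 2 * ε * b) / ((α - 1) * b) ≤ τ / 32
      rw [div_le_iff₀ (by positivity)] at w7 ⊢
      have : 4 / m ^ 2 ≤ b * ((α - 1) * τ) / 64 := by
        rw [div_le_iff₀ (by positivity)]; linarith
      nlinarith
    · intro c hc
      have := (hr c hc).2
      change ‖c - ((b : ℂ) * (Complex.log γ + Complex.log c) -
        (a : ℂ) * (Complex.log γ + Complex.log (1 - c))) / ((b : ℂ) * Θ) - cs‖ ≤ r / 16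
      have hac : (a : ℂ) = B * b := by
        rw [← Complex.ofReal_natCast a, hab, Complex.ofReal_mul, Complex.ofReal_natCast]
      have hbc : (b : ℂ) ≠ 0 := by exact_mod_cast b0.ne'
      rw [hac, show (b : ℂ) * (Complex.log γ + Complex.log c) -
        B * b * (Complex.log γ + Complex.log (1 - c)) = (b : ℂ) * ((Complex.log γ + Complex.log c) -
        B * (Complex.log γ + Complex.log (1 - c))) by ring, mul_div_mul_left _ _ hbc]
      exact this
    · change ((4 / m ^ 2 + 2 * ε * b) + (4 / m ^ 2 + 2 * ε * a)) / (b * Θ) ≤ r / 16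
      rw [hab]
      rw [div_le_iff₀ (by positivity)] at w8 ⊢
      rw [le_div_iff₀ (by positivity)] at e4
      have h8 : 8 / m ^ 2 ≤ b * (Θ * r) / 32 := by
        rw [div_le_iff₀ (by positivity)]; linarith
      have h9 : 8 / m ^ 2 = 4 / m ^ 2 + 4 / m ^ 2 := by ring
      nlinarith
  obtain ⟨X, hX, hR, hb', hT⟩ := P.exists_fixed
  obtain ⟨s, cc, x, lam, K, hs⟩ := P.core hX hR hb' hT
  have s0 : 0 < s := K.s0
  have s1 : s < 1 := by have : s < m / 16 := K.s1; linarith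
  have hs' : s ≤ Real.exp (-(b * (τ / 2))) := hs
  have s2 : s ^ 2 ≤ Real.exp (-(b * (τ / 2))) := by nlinarith
  have C0 : 0 < C := Real.exp_pos _
  have hk : ∀ i, s ^ 2 * Real.exp (4 / p.m ^ 2) ^ 2 * (p.n i + 1) < 1 := by
    intro i
    cases i
    · change s ^ 2 * C ^ 2 * (b + 1) < 1
      refine lt_of_le_of_lt ?_ w4
      have := mul_le_mul_of_nonneg_right s2 (show 0 ≤ C ^ 2 * (b + 1) by positivity)
      linarith
    · change s ^ 2 * C ^ 2 * (a + 1) < 1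
      rw [hab]
      refine lt_of_le_of_lt ?_ w5
      have := mul_le_mul_of_nonneg_right s2 (show 0 ≤ C ^ 2 * (B * b + 1) by positivity)
      linarith
  exact K.final hk hγ

/-- **Existence of renormalization fixed points.** For every positive rational `β`
there exists `N < ∞` such that for all positive integers `a, b` with `b ≥ N` and
`a/b = β`, the renormalization operator has an `(a,b)`-renormalizable fixed point:
a Lorenz map `f★` which is `(a,b)`-renormalizable and satisfies `R f★ = f★`. -/
theorem existence_of_fixed_points (α : ℝ) (hα : 1 < α) (β : ℚ) (hβ : 0 < β) :
    ∃ N : ℕ, ∀ a b : ℕ, 0 < a → N ≤ b → (a : ℚ) / b = β →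
      ∃ (f : LorenzMap α) (l r : ℝ),
        IsReturnInterval f l r ∧ ABCombinatorics f l r a b ∧ IsRenormPair f f l r := by
  obtain ⟨N, hN⟩ := main_aux α hα (β : ℝ) (by exact_mod_cast hβ)
  refine ⟨N, fun a b ha hb hab => hN a b ha hb ?_⟩
  have hb0 : (b : ℚ) ≠ 0 := by
    intro h
    rw [h, div_zero] at hab
    exact hβ.ne hab
  rw [div_eq_iff hb0] at hab
  exact_mod_cast hab
end
end

section
/- (Invariant cone field) Define θ' = (λ + (1−τ)θ)/(1 − νθ), θ₀ = 2λ/τ, θ₁ = τ/ν − 2λ/τ, and θ₂ = (μ−1)/(μν+1). If 2√(νλ) < τ, then θ₀ < θ₁ and, for every θ ∈ (θ₀, θ₁): θ' < θ and DF(z)(H_θ) ⊂ H_{θ'} for all z ∈ D. If moreover μ > (τ + 2λ)/(τ − 2λν), then θ₂ > θ₀ and, for every θ ∈ (0, θ₂), ‖DF(z)w‖/‖w‖ ≥ μ(1−νθ)/(1+θ) > 1 for all z ∈ D and all w ∈ H_θ ∖ {0}. -/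
open Set

/-- **Invariant cone field.** Let `F = (ξ, η) : D ⊂ X × Y → X × Y` be continuously
differentiable (`X = ℝⁿ`, `Y` a Banach space, `‖(u,v)‖ = ‖u‖ + ‖v‖`), with
derivative bounds `‖D_xξ(z)u‖ ≥ μ‖u‖`, `‖D_yξ(z)‖‖u‖ ≤ ν‖D_xξ(z)u‖`,
`‖D_xη(z)u‖ ≤ λ‖D_xξ(z)u‖`, `‖D_yη(z)‖‖u‖ ≤ (1-τ)‖D_xξ(z)u‖`. If `2√(νλ) < τ`,
then `θ₀ < θ₁` and for `θ ∈ (θ₀,θ₁)` one has `θ' < θ` and `DF(z)(H_θ) ⊂ H_θ'`;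
if moreover `μ > (τ+2λ)/(τ-2λν)`, then `θ₂ > θ₀` and for `θ ∈ (0,θ₂)` every
`w ∈ H_θ ∖ {0}` is expanded: `‖DF(z)w‖/‖w‖ ≥ μ(1-νθ)/(1+θ) > 1`. -/
theorem invariant_cone_field
    (n : ℕ) (Y : Type*) [NormedAddCommGroup Y] [NormedSpace ℝ Y] [CompleteSpace Y]
    (D : Set (EuclideanSpace ℝ (Fin n) × Y)) (hD : IsOpen D)
    (ξ : EuclideanSpace ℝ (Fin n) × Y → EuclideanSpace ℝ (Fin n))
    (η : EuclideanSpace ℝ (Fin n) × Y → Y)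
    (ξ' : EuclideanSpace ℝ (Fin n) × Y →
      (EuclideanSpace ℝ (Fin n) × Y →L[ℝ] EuclideanSpace ℝ (Fin n)))
    (η' : EuclideanSpace ℝ (Fin n) × Y → (EuclideanSpace ℝ (Fin n) × Y →L[ℝ] Y))
    (hξ : ∀ z ∈ D, HasFDerivAt ξ (ξ' z) z)
    (hη : ∀ z ∈ D, HasFDerivAt η (η' z) z)
    (hξc : ContinuousOn ξ' D) (hηc : ContinuousOn η' D)
    (μ ν lam τ : ℝ) (hμ : 0 < μ) (hν : 0 < ν) (hlam : 0 ≤ lam)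
    (hτ0 : 0 < τ) (hτ1 : τ ≤ 1)
    (h1 : ∀ z ∈ D, ∀ u : EuclideanSpace ℝ (Fin n), μ * ‖u‖ ≤ ‖ξ' z (u, 0)‖)
    (h2 : ∀ z ∈ D, ∀ (u : EuclideanSpace ℝ (Fin n)) (v : Y),
      ‖ξ' z (0, v)‖ * ‖u‖ ≤ ν * ‖ξ' z (u, 0)‖ * ‖v‖)
    (h3 : ∀ z ∈ D, ∀ u : EuclideanSpace ℝ (Fin n),
      ‖η' z (u, 0)‖ ≤ lam * ‖ξ' z (u, 0)‖)
    (h4 : ∀ z ∈ D, ∀ (u : EuclideanSpace ℝ (Fin n)) (v : Y),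
      ‖η' z (0, v)‖ * ‖u‖ ≤ (1 - τ) * ‖ξ' z (u, 0)‖ * ‖v‖)
    (hcone : 2 * Real.sqrt (ν * lam) < τ) :
    (2 * lam / τ < τ / ν - 2 * lam / τ) ∧
    (∀ θ : ℝ, 2 * lam / τ < θ → θ < τ / ν - 2 * lam / τ →
      ((lam + (1 - τ) * θ) / (1 - ν * θ) < θ ∧
        ∀ z ∈ D, ∀ w : EuclideanSpace ℝ (Fin n) × Y, ‖w.2‖ ≤ θ * ‖w.1‖ →
          ‖η' z w‖ ≤ ((lam + (1 - τ) * θ) / (1 - ν * θ)) * ‖ξ' z w‖)) ∧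
    ((τ + 2 * lam) / (τ - 2 * lam * ν) < μ →
      (2 * lam / τ < (μ - 1) / (μ * ν + 1) ∧
        ∀ θ : ℝ, 0 < θ → θ < (μ - 1) / (μ * ν + 1) →
          ∀ z ∈ D, ∀ w : EuclideanSpace ℝ (Fin n) × Y, w ≠ 0 → ‖w.2‖ ≤ θ * ‖w.1‖ →
            1 < μ * (1 - ν * θ) / (1 + θ) ∧
            μ * (1 - ν * θ) / (1 + θ) * (‖w.1‖ + ‖w.2‖) ≤ ‖ξ' z w‖ + ‖η' z w‖)) := by
  have hq : 4 * (ν * lam) < τ ^ 2 := by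
    have h0 : 0 ≤ ν * lam := by positivity
    have hs := Real.sq_sqrt h0
    have hn := Real.sqrt_nonneg (ν * lam)
    nlinarith
  have key : ∀ θ : ℝ, ∀ z ∈ D, ∀ w : EuclideanSpace ℝ (Fin n) × Y,
      ‖w.2‖ ≤ θ * ‖w.1‖ → ∃ a : ℝ, 0 ≤ a ∧ μ * ‖w.1‖ ≤ a ∧
        a * (1 - ν * θ) ≤ ‖ξ' z w‖ ∧ ‖η' z w‖ ≤ (lam + (1 - τ) * θ) * a := by
    intro θ z hz w hw
    obtain ⟨u, v⟩ := w
    simp only at hw ⊢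
    have hsplit : ((u, v) : EuclideanSpace ℝ (Fin n) × Y) = (u, 0) + (0, v) := by simp
    have ha := norm_nonneg (ξ' z (u, 0))
    refine ⟨‖ξ' z (u, 0)‖, ha, h1 z hz u, ?_⟩
    by_cases hu : u = 0
    · subst hu
      have hv : v = 0 := by
        have : ‖v‖ ≤ 0 := by simpa using hw
        exact norm_le_zero_iff.mp this
      subst hv
      have h0 : ((0, 0) : EuclideanSpace ℝ (Fin n) × Y) = 0 := rfl
      simp [h0]
    · have hup : 0 < ‖u‖ := norm_pos_iff.mpr hu
      have e1 : ‖ξ' z (0, v)‖ ≤ ν * ‖ξ' z (u, 0)‖ * θ := by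
        refine le_of_mul_le_mul_right ?_ hup
        calc _ ≤ _ := h2 z hz u v
          _ ≤ ν * ‖ξ' z (u, 0)‖ * (θ * ‖u‖) := by gcongr
          _ = _ := by ring
      have e2 : ‖η' z (0, v)‖ ≤ (1 - τ) * ‖ξ' z (u, 0)‖ * θ := by
        refine le_of_mul_le_mul_right ?_ hup
        calc _ ≤ _ := h4 z hz u v
          _ ≤ (1 - τ) * ‖ξ' z (u, 0)‖ * (θ * ‖u‖) :=
            mul_le_mul_of_nonneg_left hw (mul_nonneg (by linarith) ha)
          _ = _ := by ring
      have e3 := h3 z hz u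
      rw [hsplit, map_add, map_add]
      have t1 := norm_sub_le_norm_add (ξ' z (u, 0)) (ξ' z (0, v))
      have t2 := norm_add_le (η' z (u, 0)) (η' z (0, v))
      constructor <;> linarith
  refine ⟨?_, ?_, ?_⟩
  · have : 4 * lam / τ < τ / ν := by
      rw [div_lt_div_iff₀ hτ0 hν]
      linarith
    have e : 4 * lam / τ = 2 * lam / τ + 2 * lam / τ := by ring
    linarith
  · intro θ hl hr
    have ht0 : 0 ≤ 2 * lam / τ := by positivity
    set t := 2 * lam / τ with ht
    have htτ : t * τ = 2 * lam := by rw [ht]; field_simp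
    have hr' : ν * θ < τ - ν * t := by
      have := mul_lt_mul_of_pos_left hr hν
      rwa [mul_sub, mul_div_cancel₀ _ hν.ne'] at this
    have hνt : 0 ≤ ν * t := by positivity
    have hpos : 0 < 1 - ν * θ := by linarith
    have h2t : 2 * (ν * t) < τ := by
      refine lt_of_mul_lt_mul_right ?_ hτ0.le
      nlinarith
    refine ⟨?_, ?_⟩
    · rw [div_lt_iff₀ hpos]
      have hp : 0 < (θ - t) * (τ - ν * t - ν * θ) := mul_pos (by linarith) (by linarith)
      have hp2 : 0 ≤ t * (τ - 2 * (ν * t)) := mul_nonneg ht0 (by linarith)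
      nlinarith
    · intro z hz w hw
      obtain ⟨a, ha, -, hx, he⟩ := key θ z hz w hw
      have hc : 0 ≤ lam + (1 - τ) * θ :=
        add_nonneg hlam (mul_nonneg (by linarith) (by linarith))
      calc _ ≤ _ := he
        _ = ((lam + (1 - τ) * θ) / (1 - ν * θ)) * (a * (1 - ν * θ)) := by
          rw [mul_comm a, ← mul_assoc, div_mul_cancel₀ _ hpos.ne']
        _ ≤ _ := mul_le_mul_of_nonneg_left hx (div_nonneg hc hpos.le)
  · intro hm
    have hd : 0 < τ - 2 * lam * ν := by nlinarith [mul_nonneg hν.le hlam]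
    rw [div_lt_iff₀ hd] at hm
    have hmn : 0 < μ * ν + 1 := by positivity
    refine ⟨?_, ?_⟩
    · rw [div_lt_div_iff₀ hτ0 hmn]
      linarith
    · intro θ h0 hθ z hz w _ hw
      rw [lt_div_iff₀ hmn] at hθ
      have h1θ : 0 < 1 + θ := by linarith
      have hgt : 1 + θ < μ * (1 - ν * θ) := by linarith
      have hpos : 0 < 1 - ν * θ := pos_of_mul_pos_right (h1θ.trans hgt) hμ.le
      refine ⟨by rw [lt_div_iff₀ h1θ]; linarith, ?_⟩
      obtain ⟨a, ha, hma, hx, -⟩ := key θ z hz w hw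
      have hη0 := norm_nonneg (η' z w)
      calc _ ≤ μ * (1 - ν * θ) / (1 + θ) * ((1 + θ) * ‖w.1‖) :=
            mul_le_mul_of_nonneg_left (by linarith) (by positivity)
        _ = (μ * ‖w.1‖) * (1 - ν * θ) := by field_simp
        _ ≤ a * (1 - ν * θ) := mul_le_mul_of_nonneg_right hma hpos.le
        _ ≤ _ := by linarith
end
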